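/- arXiv:2102.08995 — 3 statements merged into one kernel-verified Lean document; each statement's English description precedes it below -/
import Mathlib

section
/- For every integer r ≥ 3, there exists n₀ ∈ ℕ such that for all n ≥ n₀ and every proper subset A ⊂ ℤ_n, we have g_r(A, ℤ_n) < g_r(ℤ_n). -/
/-- An `r`-coloring of `ZMod n` is rainbow 3-AP-free if no 3-AP `(x, y, z)`
(meaning `x + z = 2y` and `y ≠ x`) receives three pairwise distinct colors. -/
def RainbowAPFreeZ {n r : ℕ} (c : ZMod n → Fin r) : Prop :=
  ∀ x y z : ZMod n, x + z = 2 * y → y ≠ x →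
    (c x = c y ∨ c y = c z ∨ c x = c z)

/-- `gZ r n` is the number of rainbow 3-AP-free `r`-colorings of `ZMod n`. -/
noncomputable def gZ (r n : ℕ) : ℕ :=
  Nat.card {c : ZMod n → Fin r // RainbowAPFreeZ c}

/-- A coloring of a subset `A ⊆ ZMod n` is rainbow 3-AP-free if no 3-AP with
all three members in `A` receives three pairwise distinct colors. -/
def RainbowAPFreeZSub {n r : ℕ} (A : Set (ZMod n)) (c : A → Fin r) : Prop :=
  ∀ (x y z : ZMod n) (hx : x ∈ A) (hy : y ∈ A) (hz : z ∈ A),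
    x + z = 2 * y → y ≠ x →
      (c ⟨x, hx⟩ = c ⟨y, hy⟩ ∨ c ⟨y, hy⟩ = c ⟨z, hz⟩ ∨ c ⟨x, hx⟩ = c ⟨z, hz⟩)

/-- `gZSub r n A` is the number of rainbow 3-AP-free `r`-colorings of `A ⊆ ZMod n`. -/
noncomputable def gZSub (r n : ℕ) (A : Set (ZMod n)) : ℕ :=
  Nat.card {c : A → Fin r // RainbowAPFreeZSub A c}


section RainbowProof

open Finset
open scoped Classical

/-! ### Elementary facts -/

lemma card_mul_eq_le {n : ℕ} [NeZero n] (k : ℕ) (hk : 0 < k) (e : ZMod n) :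
    #{d : ZMod n | (k : ZMod n) * d = e} ≤ k := by
  rcases Finset.eq_empty_or_nonempty ({d : ZMod n | (k : ZMod n) * d = e} : Finset _) with h | ⟨d₀, hd₀⟩
  · simp [h]
  · refine le_trans ?_ (IsAddCyclic.card_nsmul_eq_zero_le (α := ZMod n) hk)
    refine Finset.card_le_card_of_injOn (fun d => d - d₀) ?_ ?_
    · intro d hd
      simp only [coe_filter, mem_univ, true_and, Set.mem_ofPred_eq, mem_filter] at hd hd₀ ⊢
      rw [nsmul_eq_mul, mul_sub, hd, hd₀, sub_self]
    · intro a _ b _ h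
      simpa using h

/-- Greedy covering. -/
lemma greedy_cover {α β : Type*} [Fintype β] [Nonempty β] (X : Finset α) (R : α → β → Prop)
    (δ : ℝ) (hδ1 : δ ≤ 1)
    (h : ∀ x ∈ X, δ * Fintype.card β ≤ (#{y : β | R x y} : ℝ)) (J : ℕ) :
    ∃ y : Fin J → β, (#{x ∈ X | ∀ j, ¬ R x (y j)} : ℝ) ≤ (1 - δ) ^ J * #X := by
  induction J with
  | zero => exact ⟨Fin.elim0, by simp⟩
  | succ J ih =>
    obtain ⟨y, hy⟩ := ih
    set U : Finset α := {x ∈ X | ∀ j, ¬ R x (y j)} with hU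
    have hsum : ∑ b : β, (#{x ∈ U | R x b} : ℝ) = ∑ x ∈ U, (#{b : β | R x b} : ℝ) := by
      simp only [Finset.card_filter, Nat.cast_sum]
      exact Finset.sum_comm
    have hlow : δ * Fintype.card β * #U ≤ ∑ b : β, (#{x ∈ U | R x b} : ℝ) := by
      rw [hsum]
      calc δ * Fintype.card β * #U = ∑ x ∈ U, δ * Fintype.card β := by simp; ring
        _ ≤ _ := Finset.sum_le_sum fun x hx => h x (Finset.mem_of_mem_filter x hx)
    have hex : ∃ b : β, δ * #U ≤ (#{x ∈ U | R x b} : ℝ) := by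
      by_contra! hcon
      have : ∑ b : β, (#{x ∈ U | R x b} : ℝ) < ∑ b : β, δ * #U :=
        Finset.sum_lt_sum_of_nonempty Finset.univ_nonempty fun b _ => hcon b
      simp at this
      linarith
    obtain ⟨b, hb⟩ := hex
    refine ⟨Fin.cons b y, ?_⟩
    have hset : ({x ∈ X | ∀ j, ¬ R x ((Fin.cons b y : Fin (J+1) → β) j)} : Finset α)
        = {x ∈ U | ¬ R x b} := by
      ext x
      simp only [hU, mem_filter, Fin.forall_fin_succ, Fin.cons_zero, Fin.cons_succ]
      tauto
    rw [hset]
    have hc := Finset.card_filter_add_card_filter_not (s := U) (fun x => R x b)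
    have hc' : (#{x ∈ U | R x b} : ℝ) + #{x ∈ U | ¬ R x b} = #U := by exact_mod_cast hc
    calc (#{x ∈ U | ¬ R x b} : ℝ) ≤ (1 - δ) * #U := by linarith
      _ ≤ (1 - δ) * ((1 - δ) ^ J * #X) := by
        apply mul_le_mul_of_nonneg_left hy; linarith
      _ = _ := by ring

/-! ### Varnavides -/

lemma varnavides (ε : ℝ) (hε : 0 < ε) : ∃ κ : ℝ, 0 < κ ∧ κ ≤ 1 ∧ ∀ n : ℕ, ∀ _ : NeZero n,
    ∀ B : Finset (ZMod n), ε * n ≤ #B →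
      κ * (n : ℝ) ^ 2 ≤ #{p : ZMod n × ZMod n | p.1 ∈ B ∧ p.2 ∈ B ∧ 2 * p.2 - p.1 ∈ B} := by
  obtain ⟨M, hM0, hM⟩ : ∃ M : ℕ, 0 < M ∧ (rothNumberNat M : ℝ) ≤ ε / 4 * M := by
    have h := rothNumberNat_isLittleO_id.bound (show (0:ℝ) < ε / 4 by positivity)
    obtain ⟨M, h1, h2⟩ := (h.and (Filter.eventually_gt_atTop 0)).exists
    exact ⟨M, h2, by simpa using h1⟩
  have hMr : (0 : ℝ) < M := by exact_mod_cast hM0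
  refine ⟨min 1 (ε / (2 * M ^ 3)), by positivity, min_le_left _ _, fun n _ B hB => ?_⟩
  have hn : (0 : ℝ) < n := by exact_mod_cast Nat.pos_of_ne_zero (NeZero.ne n)
  set T : Finset (ZMod n × ZMod n) := {p | p.1 ∈ B ∧ p.2 ∈ B ∧ 2 * p.2 - p.1 ∈ B} with hT
  suffices h : ε / 2 * (n : ℝ) ^ 2 ≤ M ^ 3 * #T by
    have : ε / (2 * M ^ 3) * (n : ℝ) ^ 2 ≤ #T := by
      rw [div_mul_eq_mul_div, div_le_iff₀ (by positivity)]; linarith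
    refine le_trans ?_ this
    gcongr
    exact min_le_right _ _
  let hits : ZMod n × ZMod n → Finset ℕ := fun p => {i ∈ range M | p.1 + i * p.2 ∈ B}
  let Gd : Finset (ZMod n × ZMod n) := {p | ε / 2 * M ≤ #(hits p)}
  have hGlow : ε / 2 * (n : ℝ) ^ 2 ≤ #Gd := by
    have htot : ∑ p : ZMod n × ZMod n, (#(hits p) : ℝ) = M * n * #B := by
      have : ∑ p : ZMod n × ZMod n, (#(hits p)) = M * n * #B := by
        simp only [hits, Finset.card_filter]
        rw [Finset.sum_comm]
        have : ∀ i ∈ range M, ∑ p : ZMod n × ZMod n, (if p.1 + i * p.2 ∈ B then 1 else 0) = n * #B := by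
          intro i _
          rw [Fintype.sum_prod_type_right]
          have : ∀ d : ZMod n, ∑ a : ZMod n, (if a + i * d ∈ B then 1 else 0) = #B := by
            intro d
            rw [Fintype.sum_equiv (Equiv.addRight ((i : ZMod n) * d)) _ (fun a => if a ∈ B then 1 else 0)]
            · simp
            · intro a; simp only [Equiv.coe_addRight]; congr
          simp [this, ZMod.card]
        rw [Finset.sum_congr rfl this]
        simp [mul_assoc]
      exact_mod_cast this
    have hup : ∑ p : ZMod n × ZMod n, (#(hits p) : ℝ) ≤ M * #Gd + n ^ 2 * (ε / 2 * M) := by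
      have hle : ∀ p : ZMod n × ZMod n, (#(hits p) : ℝ) ≤ (if p ∈ Gd then (M:ℝ) else 0) + ε / 2 * M := by
        intro p
        split_ifs with hp
        · have : #(hits p) ≤ M := by
            simpa using Finset.card_filter_le (range M) (fun i : ℕ => p.1 + i * p.2 ∈ B)
          have : (#(hits p) : ℝ) ≤ M := by exact_mod_cast this
          have : 0 ≤ ε / 2 * M := by positivity
          linarith
        · simp only [Gd, mem_filter, mem_univ, true_and, not_le] at hp
          linarith
      calc _ ≤ ∑ p : ZMod n × ZMod n, ((if p ∈ Gd then (M:ℝ) else 0) + ε / 2 * M) :=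
            Finset.sum_le_sum fun p _ => hle p
        _ = _ := by
          rw [Finset.sum_add_distrib, ← Finset.sum_filter]
          simp [ZMod.card]
          ring
    rw [htot] at hup
    have h3 : (M:ℝ) * n * (ε * n) ≤ M * n * #B := by gcongr
    have h4 : (M:ℝ) * (ε / 2 * n ^ 2) ≤ M * #Gd := by nlinarith
    exact le_of_mul_le_mul_left h4 hMr
  have hGup : #Gd ≤ M ^ 3 * #T := by
    let S : ℕ × ℕ → Finset (ZMod n × ZMod n) := fun q =>
      {p | (p.1 + q.1 * p.2, p.1 + q.2 * p.2) ∈ T}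
    have hsub : Gd ⊆ ((range M ×ˢ range M).filter fun q => q.1 ≠ q.2).biUnion S := by
      intro p hp
      have hp' : ε / 2 * M ≤ #(hits p) := by simpa [Gd] using hp
      have hnot : ¬ ThreeAPFree (hits p : Set ℕ) := by
        intro hfree
        have h1 := ThreeAPFree.le_rothNumberNat (n := M) (hits p) hfree
          (fun x hx => by simpa using (Finset.mem_filter.1 hx).1) rfl
        have h2 : (#(hits p) : ℝ) ≤ rothNumberNat M := by exact_mod_cast h1
        have : 0 < ε * M := by positivity
        nlinarith
      simp only [ThreeAPFree, not_forall] at hnot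
      obtain ⟨i, hi, j, hj, k, hk, hijk, hne⟩ := hnot
      simp only [hits, coe_filter, Set.mem_ofPred_eq, mem_range] at hi hj hk
      simp only [mem_biUnion, mem_filter, mem_product, mem_range]
      refine ⟨(i, j), ⟨⟨hi.1, hj.1⟩, hne⟩, ?_⟩
      simp only [S, hT, mem_filter, mem_univ, true_and]
      refine ⟨hi.2, hj.2, ?_⟩
      have : (i : ZMod n) + k = j + j := by exact_mod_cast congrArg (Nat.cast : ℕ → ZMod n) hijk
      have h5 : 2 * (p.1 + (j : ZMod n) * p.2) - (p.1 + i * p.2) = p.1 + k * p.2 := by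
        linear_combination (-p.2) * this
      rw [h5]; exact hk.2
    have hS : ∀ q ∈ (range M ×ˢ range M).filter fun q => q.1 ≠ q.2, #(S q) ≤ M * #T := by
      rintro ⟨i, j⟩ hq
      simp only [mem_filter, mem_product, mem_range] at hq
      refine Finset.card_le_mul_card_image_of_maps_to
        (f := fun p : ZMod n × ZMod n => (p.1 + i * p.2, p.1 + j * p.2)) ?_ M ?_
      · intro p hp
        simpa [S] using hp
      · rintro ⟨x, t⟩ _
        have key : ∀ k : ℕ, 0 < k → k < M → ∀ e : ZMod n,
            (∀ p : ZMod n × ZMod n, p.1 + i * p.2 = x → p.1 + j * p.2 = t → k * p.2 = e) →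
            #((S (i, j)).filter fun p => ((p.1 + i * p.2, p.1 + j * p.2) : ZMod n × ZMod n) = (x, t)) ≤ M := by
          intro k hk hkM e hke
          refine le_trans ?_ ((card_mul_eq_le k hk e).trans hkM.le)
          refine Finset.card_le_card_of_injOn Prod.snd ?_ ?_
          · intro p hp
            simp only [coe_filter, Set.mem_ofPred_eq, Prod.mk.injEq, mem_univ, true_and] at hp ⊢
            exact hke p hp.2.1 hp.2.2
          · intro p hp p' hp' h
            simp only [coe_filter, Set.mem_ofPred_eq, Prod.mk.injEq] at hp hp'
            refine Prod.ext ?_ h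
            have h1 := hp.2.1
            have h2 := hp'.2.1
            rw [← h2, h] at h1
            exact add_right_cancel h1
        rcases lt_or_gt_of_ne hq.2 with hlt | hlt
        · refine key (j - i) (by omega) (by omega) (t - x) ?_
          intro p h1 h2
          rw [Nat.cast_sub hlt.le, ← h1, ← h2]; ring
        · refine key (i - j) (by omega) (by omega) (x - t) ?_
          intro p h1 h2
          rw [Nat.cast_sub hlt.le, ← h1, ← h2]; ring
    calc #Gd ≤ _ := Finset.card_le_card hsub
      _ ≤ #((range M ×ˢ range M).filter fun q => q.1 ≠ q.2) * (M * #T) :=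
        Finset.card_biUnion_le_card_mul _ _ _ hS
      _ ≤ (M * M) * (M * #T) := by
        gcongr
        refine (Finset.card_filter_le _ _).trans ?_
        simp
      _ = _ := by ring
  have hGup' : (#Gd : ℝ) ≤ M ^ 3 * #T := by exact_mod_cast hGup
  linarith

/-! ### Sampling -/

lemma exists_pow_small (ρ ε : ℝ) (hρ : 0 < ρ) (_ : ρ ≤ 1) (hε : 0 < ε) :
    ∃ m : ℕ, (1 - ρ) ^ m ≤ ε := by
  obtain ⟨m, hm⟩ := exists_pow_lt_of_lt_one hε (show 1 - ρ < 1 by linarith)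
  exact ⟨m, hm.le⟩

lemma greedy_cover' {α β : Type*} [Fintype β] [Nonempty β] (X : Finset α) (R : α → β → Prop)
    (δ : ℝ) (hδ1 : δ ≤ 1)
    (h : ∀ x ∈ X, ∃ s : Finset β, (∀ y ∈ s, R x y) ∧ δ * Fintype.card β ≤ (#s : ℝ)) (J : ℕ) :
    ∃ y : Fin J → β, ∀ s : Finset α, (∀ x ∈ s, x ∈ X ∧ ∀ j, ¬ R x (y j)) →
      (#s : ℝ) ≤ (1 - δ) ^ J * #X := by
  obtain ⟨y, hy⟩ := greedy_cover X R δ hδ1 (by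
    intro x hx
    obtain ⟨s, h1, h2⟩ := h x hx
    refine h2.trans (Nat.cast_le.2 (Finset.card_le_card fun y hy => ?_))
    simpa using h1 y hy) J
  refine ⟨y, fun s hs => le_trans (Nat.cast_le.2 (Finset.card_le_card fun x hx => ?_)) hy⟩
  rw [Finset.mem_filter]
  exact hs x hx

lemma sample_cover (δ ε η : ℝ) (hδ : 0 < δ) (hδ1 : δ ≤ 1) (hε : 0 < ε) (hη : 0 < η) (hη1 : η ≤ 1) :
    ∃ J m n₀ : ℕ, ∀ n : ℕ, n₀ ≤ n → ∀ _ : NeZero n, ∃ L : ℕ, (J * L : ℝ) ≤ η * n ∧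
      ∀ (X : Finset (ZMod n)) (T : ZMod n → Finset (ZMod n)), (∀ x ∈ X, δ * n ≤ #(T x)) →
        ∃ (u : Fin J → ZMod n) (v : Fin m → ZMod n),
          (#{x ∈ X | ¬ ∃ (j : Fin J) (l : Fin L) (k : Fin m),
            u j + ((l : ℕ) : ZMod n) ∈ T x ∧ 2 * (u j + ((l : ℕ) : ZMod n)) - x = v k} : ℝ) ≤ ε * n := by
  obtain ⟨J, hJ⟩ := exists_pow_small (δ / 2) (ε / 2) (by positivity) (by linarith) (by positivity)
  set ρ : ℝ := δ * η / (8 * (J + 1)) with hρdef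
  have hJ1 : (1 : ℝ) ≤ J + 1 := by linarith [Nat.cast_nonneg (α := ℝ) J]
  have hρ : 0 < ρ := by positivity
  have hρ1 : ρ ≤ 1 := by
    rw [hρdef, div_le_one (by positivity)]
    nlinarith
  obtain ⟨m, hm⟩ := exists_pow_small ρ (ε / 2) hρ hρ1 (by positivity)
  obtain ⟨n₀, hn₀⟩ := exists_nat_ge (2 * (J + 1) / η)
  refine ⟨J, m, n₀, fun n hn _ => ⟨⌊η * n / (J + 1)⌋₊, ?_, ?_⟩⟩
  · have h1 := Nat.floor_le (show 0 ≤ η * n / (J + 1) by positivity)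
    have : ((J:ℝ) + 1) * ⌊η * n / (J + 1)⌋₊ ≤ η * n := by
      rw [mul_comm]; exact (le_div_iff₀ (by positivity)).1 h1
    have h2 : (0:ℝ) ≤ ⌊η * n / (J + 1)⌋₊ := by positivity
    linarith
  intro X T hT
  have hnr : (0 : ℝ) < n := by exact_mod_cast Nat.pos_of_ne_zero (NeZero.ne n)
  set L : ℕ := ⌊η * n / (J + 1)⌋₊ with hL
  have hbig : 2 ≤ η * n / (J + 1) := by
    have : 2 * (J + 1) / η ≤ (n : ℝ) := hn₀.trans (by exact_mod_cast hn)
    rw [div_le_iff₀ hη] at this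
    rw [le_div_iff₀ (by positivity)]; linarith
  have hLlow : η * n / (2 * (J + 1)) ≤ (L : ℝ) := by
    have h1 := Nat.lt_floor_add_one (η * n / (J + 1))
    rw [← hL] at h1
    have h2 : η * n / (2 * (J + 1)) = (η * n / (J + 1)) / 2 := by field_simp
    rw [h2]; linarith
  have hLpos : (0 : ℝ) < L := lt_of_lt_of_le (by positivity) hLlow
  have hLn : L ≤ n := by
    have h1 := Nat.floor_le (show 0 ≤ η * n / (J + 1) by positivity)
    have h2 : η * n / (J + 1) ≤ n := by
      rw [div_le_iff₀ (by positivity)]; nlinarith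
    exact Nat.cast_le.1 (h1.trans h2)
  -- first greedy step
  obtain ⟨u, hu⟩ := greedy_cover' X
    (fun x (u : ZMod n) => δ * L / 2 ≤ #{l : Fin L | u + ((l : ℕ) : ZMod n) ∈ T x}) (δ / 2) (by linarith)
    (by
      intro x hx
      refine ⟨({u | δ * L / 2 ≤ #{l : Fin L | u + ((l : ℕ) : ZMod n) ∈ T x}} : Finset (ZMod n)), by simp, ?_⟩
      rw [ZMod.card]
      have htot : ∑ u : ZMod n, (#{l : Fin L | u + ((l : ℕ) : ZMod n) ∈ T x} : ℝ) = L * #(T x) := by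
        have : ∑ u : ZMod n, (#{l : Fin L | u + ((l : ℕ) : ZMod n) ∈ T x}) = L * #(T x) := by
          simp only [Finset.card_filter]
          rw [Finset.sum_comm]
          have : ∀ l : Fin L, ∑ a : ZMod n, (if a + ((l : ℕ) : ZMod n) ∈ T x then 1 else 0) = #(T x) := by
            intro l
            rw [Fintype.sum_equiv (Equiv.addRight ((l : ℕ) : ZMod n)) _ (fun a => if a ∈ T x then 1 else 0)]
            · simp
            · intro a; simp only [Equiv.coe_addRight]; congr
          simp [this]
        exact_mod_cast this
      set Gd : Finset (ZMod n) :=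
        {u | δ * L / 2 ≤ #{l : Fin L | u + ((l : ℕ) : ZMod n) ∈ T x}} with hGd
      have hle : ∀ u : ZMod n, (#{l : Fin L | u + ((l : ℕ) : ZMod n) ∈ T x} : ℝ) ≤
          (if u ∈ Gd then (L:ℝ) else 0) + δ * L / 2 := by
        intro u
        split_ifs with hp
        · have : #{l : Fin L | u + ((l : ℕ) : ZMod n) ∈ T x} ≤ L := by
            simpa using Finset.card_filter_le (univ : Finset (Fin L)) (fun l => u + ((l : ℕ) : ZMod n) ∈ T x)
          have : (#{l : Fin L | u + ((l : ℕ) : ZMod n) ∈ T x} : ℝ) ≤ L := by exact_mod_cast this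
          have : 0 ≤ δ * L / 2 := by positivity
          linarith
        · simp only [hGd, mem_filter, mem_univ, true_and, not_le] at hp
          linarith
      have hup := Finset.sum_le_sum (s := univ) fun u _ => hle u
      rw [htot, Finset.sum_add_distrib, ← Finset.sum_filter] at hup
      simp [ZMod.card] at hup
      have h3 : (L:ℝ) * (δ * n) ≤ L * #(T x) := by gcongr; exact hT x hx
      have h4 : (L:ℝ) * (δ / 2 * n) ≤ L * #Gd := by nlinarith
      exact le_of_mul_le_mul_left h4 hLpos) J
  set X2 : Finset (ZMod n) :=
    {x ∈ X | ∃ j, δ * L / 2 ≤ #{l : Fin L | u j + ((l : ℕ) : ZMod n) ∈ T x}} with hX2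
  obtain ⟨v, hv⟩ := greedy_cover' X2
    (fun x (v : ZMod n) => ∃ (j : Fin J) (l : Fin L), u j + ((l : ℕ) : ZMod n) ∈ T x ∧
      2 * (u j + ((l : ℕ) : ZMod n)) - x = v) ρ hρ1
    (by
      intro x hx
      refine ⟨({v | ∃ (j : Fin J) (l : Fin L), u j + ((l : ℕ) : ZMod n) ∈ T x ∧
          2 * (u j + ((l : ℕ) : ZMod n)) - x = v} : Finset (ZMod n)), by simp, ?_⟩
      rw [ZMod.card]
      obtain ⟨j, hj⟩ := (Finset.mem_filter.1 hx).2
      set S : Finset (Fin L) := {l : Fin L | u j + ((l : ℕ) : ZMod n) ∈ T x} with hS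
      have hcard := Finset.card_le_mul_card_image_of_maps_to
        (f := fun l : Fin L => 2 * (u j + ((l : ℕ) : ZMod n)) - x) (s := S)
        (t := {v | ∃ (j : Fin J) (l : Fin L), u j + ((l : ℕ) : ZMod n) ∈ T x ∧
          2 * (u j + ((l : ℕ) : ZMod n)) - x = v})
        (by
          intro l hl
          simp only [mem_filter, mem_univ, true_and]
          exact ⟨j, l, by simpa [hS] using hl, rfl⟩) 2
        (by
          intro b _
          refine le_trans ?_ (card_mul_eq_le (n := n) 2 (by norm_num) (b + x - 2 * u j))
          refine Finset.card_le_card_of_injOn (fun l : Fin L => ((l : ℕ) : ZMod n)) ?_ ?_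
          · intro l hl
            simp only [coe_filter, Set.mem_ofPred_eq, mem_univ, true_and] at hl ⊢
            rw [← hl.2]; push_cast; ring
          · intro l _ l' _ h
            have h1 : (l : ℕ) < n := l.2.trans_le hLn
            have h2 : (l' : ℕ) < n := l'.2.trans_le hLn
            have h3 := congrArg ZMod.val h
            simp only [ZMod.val_natCast, Nat.mod_eq_of_lt h1, Nat.mod_eq_of_lt h2] at h3
            exact Fin.ext h3)
      have hcard' : (#S : ℝ) ≤ 2 * #{v | ∃ (j : Fin J) (l : Fin L), u j + ((l : ℕ) : ZMod n) ∈ T x ∧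
          2 * (u j + ((l : ℕ) : ZMod n)) - x = v} := by exact_mod_cast hcard
      have h5 : ρ * n ≤ δ * L / 4 := by
        have : ρ * n = δ * (η * n / (2 * (J + 1))) / 4 := by rw [hρdef]; field_simp; ring
        rw [this]; gcongr
      linarith) m
  refine ⟨u, v, ?_⟩
  have hsub : ({x ∈ X | ¬ ∃ (j : Fin J) (l : Fin L) (k : Fin m),
            u j + ((l : ℕ) : ZMod n) ∈ T x ∧ 2 * (u j + ((l : ℕ) : ZMod n)) - x = v k} : Finset (ZMod n)) ⊆
      {x ∈ X | ∀ j, ¬ δ * L / 2 ≤ #{l : Fin L | u j + ((l : ℕ) : ZMod n) ∈ T x}} ∪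
      {x ∈ X2 | ∀ k, ¬ ∃ (j : Fin J) (l : Fin L), u j + ((l : ℕ) : ZMod n) ∈ T x ∧
        2 * (u j + ((l : ℕ) : ZMod n)) - x = v k} := by
    intro x hx
    simp only [mem_union, hX2, mem_filter] at hx ⊢
    by_cases h : ∃ j, δ * L / 2 ≤ #{l : Fin L | u j + ((l : ℕ) : ZMod n) ∈ T x}
    · right
      refine ⟨⟨hx.1, h⟩, ?_⟩
      rintro k ⟨j, l, hjl⟩
      exact hx.2 ⟨j, l, k, hjl⟩
    · left
      exact ⟨hx.1, fun j hj => h ⟨j, hj⟩⟩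
  have hc : (#{x ∈ X | ¬ ∃ (j : Fin J) (l : Fin L) (k : Fin m),
            u j + ((l : ℕ) : ZMod n) ∈ T x ∧ 2 * (u j + ((l : ℕ) : ZMod n)) - x = v k} : ℝ) ≤ _ :=
    Nat.cast_le.2 ((Finset.card_le_card hsub).trans (Finset.card_union_le _ _))
  push_cast at hc
  have hXn : (#X : ℝ) ≤ n := by
    have := Finset.card_le_univ X
    rw [ZMod.card] at this
    exact_mod_cast this
  have hX2n : (#X2 : ℝ) ≤ n := by
    have := Finset.card_le_univ X2
    rw [ZMod.card] at this
    exact_mod_cast this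
  have hu' := hu {x ∈ X | ∀ j, ¬ δ * L / 2 ≤ #{l : Fin L | u j + ((l : ℕ) : ZMod n) ∈ T x}}
    (fun x hx => Finset.mem_filter.1 hx)
  have hv' := hv {x ∈ X2 | ∀ k, ¬ ∃ (j : Fin J) (l : Fin L), u j + ((l : ℕ) : ZMod n) ∈ T x ∧
        2 * (u j + ((l : ℕ) : ZMod n)) - x = v k} (fun x hx => Finset.mem_filter.1 hx)
  have h6 : (1 - δ / 2) ^ J * (#X : ℝ) ≤ ε / 2 * n := by gcongr
  have h7 : (1 - ρ) ^ m * (#X2 : ℝ) ≤ ε / 2 * n := by gcongr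
  linarith

/-! ### The nearly monochromatic part -/

lemma mono_part (ε : ℝ) (hε : 0 < ε) : ∃ (m : ℕ) (ζ : ℝ), 0 < ζ ∧ ∀ n : ℕ, ∀ _ : NeZero n,
    ∀ (r : ℕ) (B : Finset (ZMod n)) (f : ZMod n → Fin r),
      (#{p : ZMod n × ZMod n | p.1 ∈ B ∧ p.2 ∈ B ∧ 2 * p.2 - p.1 ∈ B ∧ f p.2 ≠ f (2 * p.2 - p.1)} : ℝ)
        ≤ ζ * (n : ℝ) ^ 2 →
      ∃ (w : Fin m → ZMod n) (e : Fin m → Option (Fin r)),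
        (#{x ∈ B | ¬ ∃ j, (e j).isSome ∧ 2 * w j - x ∈ B} : ℝ) ≤ 2 * ε * n ∧
        (#{x ∈ B | ∃ j, (e j).isSome ∧ 2 * w j - x ∈ B ∧ e j ≠ some (f x)} : ℝ) ≤ ε * n := by
  obtain ⟨κ, hκ, hκ1, hV⟩ := varnavides ε hε
  obtain ⟨m, hm⟩ := exists_pow_small (κ / 2) ε (by positivity) (by linarith) hε
  set ω : ℝ := ε / (m + 1) with hω
  have hω0 : 0 < ω := by positivity
  refine ⟨m, κ * ω / 2, by positivity, fun n _ r B f hB => ?_⟩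
  have hnr : (0 : ℝ) < n := by exact_mod_cast Nat.pos_of_ne_zero (NeZero.ne n)
  set wr : ZMod n → Finset (ZMod n) := fun t => {x ∈ B | 2 * t - x ∈ B ∧ f x ≠ f t} with hwr
  have hsumwr : ∑ t ∈ B, (#(wr t) : ℝ) ≤ κ * ω / 2 * (n : ℝ) ^ 2 := by
    refine le_trans ?_ hB
    have : ∑ t ∈ B, #(wr t) ≤
        #{p : ZMod n × ZMod n | p.1 ∈ B ∧ p.2 ∈ B ∧ 2 * p.2 - p.1 ∈ B ∧ f p.2 ≠ f (2 * p.2 - p.1)} := by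
      rw [← Finset.card_sigma]
      refine Finset.card_le_card_of_injOn (fun q => (2 * q.1 - q.2, q.1)) ?_ ?_
      · rintro ⟨t, x⟩ hq
        simp only [hwr, coe_sigma, Set.mem_sigma_iff, mem_coe, mem_filter, mem_univ, true_and] at hq ⊢
        refine ⟨hq.2.2.1, hq.1, ?_, ?_⟩
        · simpa using hq.2.1
        · simpa using fun h => hq.2.2.2 h.symm
      · rintro ⟨t, x⟩ _ ⟨t', x'⟩ _ h
        simp only [Prod.mk.injEq] at h
        obtain ⟨h1, rfl⟩ := h
        have : x = x' := by simpa using h1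
        rw [this]
    exact_mod_cast this
  set bad : Finset (ZMod n) := {t ∈ B | ω * n < #(wr t)} with hbad
  have hbadcard : (#bad : ℝ) ≤ κ / 2 * n := by
    have h1 : (#bad : ℝ) * (ω * n) ≤ ∑ t ∈ B, (#(wr t) : ℝ) := by
      calc (#bad : ℝ) * (ω * n) = ∑ t ∈ bad, ω * n := by simp
        _ ≤ ∑ t ∈ bad, (#(wr t) : ℝ) := Finset.sum_le_sum fun t ht => (Finset.mem_filter.1 ht).2.le
        _ ≤ _ := Finset.sum_le_sum_of_subset_of_nonneg (Finset.filter_subset _ _) fun _ _ _ => by positivity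
    have h2 := h1.trans hsumwr
    have h3 : (#bad : ℝ) * (ω * n) ≤ (κ / 2 * n) * (ω * n) := by nlinarith
    exact le_of_mul_le_mul_right h3 (by positivity)
  set H : Finset (ZMod n) := {x ∈ B | κ * n ≤ #{t ∈ B | 2 * t - x ∈ B}} with hH
  set H' : Finset (ZMod n) := {x ∈ B | ¬ κ * n ≤ #{t ∈ B | 2 * t - x ∈ B}} with hH'
  have hH'card : (#H' : ℝ) ≤ ε * n := by
    by_contra! hcon
    have h1 := hV n inferInstance H' hcon.le
    have h2 : #{p : ZMod n × ZMod n | p.1 ∈ H' ∧ p.2 ∈ H' ∧ 2 * p.2 - p.1 ∈ H'} ≤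
        ∑ x ∈ H', #{t ∈ B | 2 * t - x ∈ B} := by
      rw [← Finset.card_sigma]
      refine Finset.card_le_card_of_injOn (fun q => ⟨q.1, q.2⟩) ?_ ?_
      · rintro ⟨x, t⟩ hq
        simp only [hH', coe_sigma, Set.mem_sigma_iff, mem_coe, mem_filter, mem_univ, true_and] at hq ⊢
        exact ⟨hq.1, hq.2.1.1, hq.2.2.1⟩
      · rintro ⟨x, t⟩ _ ⟨x', t'⟩ _ h
        simpa using h
    have h2' : (#{p : ZMod n × ZMod n | p.1 ∈ H' ∧ p.2 ∈ H' ∧ 2 * p.2 - p.1 ∈ H'} : ℝ) ≤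
        ∑ x ∈ H', (#{t ∈ B | 2 * t - x ∈ B} : ℝ) := by exact_mod_cast h2
    have hne : H'.Nonempty := by
      rw [← Finset.card_pos]
      have : (0 : ℝ) < #H' := lt_trans (by positivity) hcon
      exact_mod_cast this
    have h3 : ∑ x ∈ H', (#{t ∈ B | 2 * t - x ∈ B} : ℝ) < ∑ x ∈ H', κ * n :=
      Finset.sum_lt_sum_of_nonempty hne fun x hx => not_le.1 (Finset.mem_filter.1 hx).2
    have hH'n : (#H' : ℝ) ≤ n := by
      have := Finset.card_le_univ H'
      rw [ZMod.card] at this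
      exact_mod_cast this
    have h4 : ∑ x ∈ H', κ * n ≤ κ * (n : ℝ) ^ 2 := by
      simp only [sum_const, nsmul_eq_mul]
      have : (#H' : ℝ) * (κ * n) ≤ n * (κ * n) := by gcongr
      linarith
    linarith
  obtain ⟨w, hw⟩ := greedy_cover' H (fun x t => t ∈ B ∧ t ∉ bad ∧ 2 * t - x ∈ B) (κ / 2) (by linarith)
    (by
      intro x hx
      refine ⟨({t | t ∈ B ∧ t ∉ bad ∧ 2 * t - x ∈ B} : Finset (ZMod n)), by simp, ?_⟩
      rw [ZMod.card]
      have h1 := (Finset.mem_filter.1 hx).2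
      have h2 : ({t ∈ B | 2 * t - x ∈ B} : Finset (ZMod n)) ⊆
          ({t | t ∈ B ∧ t ∉ bad ∧ 2 * t - x ∈ B} : Finset (ZMod n)) ∪ bad := by
        intro t ht
        simp only [mem_union, mem_filter, mem_univ, true_and] at ht ⊢
        tauto
      have h3 : (#{t ∈ B | 2 * t - x ∈ B} : ℝ) ≤ _ :=
        Nat.cast_le.2 ((Finset.card_le_card h2).trans (Finset.card_union_le _ _))
      push_cast at h3
      linarith) m
  refine ⟨w, fun j => if w j ∈ B ∧ w j ∉ bad then some (f (w j)) else none, ?_, ?_⟩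
  · have hsub : ({x ∈ B | ¬ ∃ j, (if w j ∈ B ∧ w j ∉ bad then some (f (w j)) else none).isSome ∧
        2 * w j - x ∈ B} : Finset (ZMod n)) ⊆
        H' ∪ {x ∈ H | ∀ j, ¬ (w j ∈ B ∧ w j ∉ bad ∧ 2 * w j - x ∈ B)} := by
      intro x hx
      simp only [mem_union, hH, hH', mem_filter] at hx ⊢
      by_cases h : κ * n ≤ #{t ∈ B | 2 * t - x ∈ B}
      · right
        refine ⟨⟨hx.1, h⟩, fun j hj => hx.2 ⟨j, ?_, hj.2.2⟩⟩
        rw [if_pos ⟨hj.1, hj.2.1⟩]; rfl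
      · left; exact ⟨hx.1, h⟩
    have hc := Nat.cast_le (α := ℝ).2 ((Finset.card_le_card hsub).trans (Finset.card_union_le _ _))
    push_cast at hc
    have hHn : (#H : ℝ) ≤ n := by
      have := Finset.card_le_univ H
      rw [ZMod.card] at this
      exact_mod_cast this
    have hw' := hw {x ∈ H | ∀ j, ¬ (w j ∈ B ∧ w j ∉ bad ∧ 2 * w j - x ∈ B)}
      (fun x hx => Finset.mem_filter.1 hx)
    have h6 : (1 - κ / 2) ^ m * (#H : ℝ) ≤ ε * n := by gcongr
    refine le_trans (le_of_eq ?_) (hc.trans (b := _) ?_)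
    · congr
    linarith
  · have hsub : ({x ∈ B | ∃ j, (if w j ∈ B ∧ w j ∉ bad then some (f (w j)) else none).isSome ∧
        2 * w j - x ∈ B ∧ (if w j ∈ B ∧ w j ∉ bad then some (f (w j)) else none) ≠ some (f x)} :
          Finset (ZMod n)) ⊆
        (univ : Finset (Fin m)).biUnion fun j => if w j ∈ B ∧ w j ∉ bad then wr (w j) else ∅ := by
      intro x hx
      simp only [mem_filter] at hx
      obtain ⟨hxB, j, h1, h2, h3⟩ := hx
      simp only [mem_biUnion, mem_univ, true_and]
      refine ⟨j, ?_⟩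
      by_cases hj : w j ∈ B ∧ w j ∉ bad
      · rw [if_pos hj] at h3 ⊢
        simp only [hwr, mem_filter]
        exact ⟨hxB, h2, fun h => h3 (by rw [h])⟩
      · rw [if_neg hj] at h1
        simp at h1
    have hc := Nat.cast_le (α := ℝ).2 ((Finset.card_le_card hsub).trans Finset.card_biUnion_le)
    push_cast at hc
    refine le_trans (le_of_eq ?_) (hc.trans ?_)
    · congr
    have : ∀ j ∈ (univ : Finset (Fin m)),
        ((#(if w j ∈ B ∧ w j ∉ bad then wr (w j) else ∅) : ℕ) : ℝ) ≤ ω * n := by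
      intro j _
      split_ifs with hj
      · by_contra! hcon
        exact hj.2 (Finset.mem_filter.2 ⟨hj.1, hcon⟩)
      · simp; positivity
    refine (Finset.sum_le_sum this).trans ?_
    simp only [sum_const, card_univ, Fintype.card_fin, nsmul_eq_mul]
    have : (m : ℝ) * ω ≤ ε := by
      rw [hω, mul_div_assoc', div_le_iff₀ (by positivity)]
      nlinarith
    nlinarith

/-! ### Containers -/

/-- Rainbow-freeness on a finset, for total functions. -/
def RFon {n r : ℕ} (A : Finset (ZMod n)) (f : ZMod n → Fin r) : Prop :=
  ∀ x ∈ A, ∀ y ∈ A, ∀ z ∈ A, x + z = 2 * y → f x = f y ∨ f y = f z ∨ f x = f z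

/-- `x` completes a progression with two sampled points of different colors. -/
def Resolved {n r : ℕ} {ι κ : Type} (A : Finset (ZMod n)) (s : ι → ZMod n) (a : ι → Fin r)
    (v : κ → ZMod n) (b : κ → Fin r) (x : ZMod n) : Prop :=
  ∃ i k, s i ∈ A ∧ v k ∈ A ∧ 2 * s i - x = v k ∧ a i ≠ b k

/-- The template given by sampled data. -/
noncomputable def template {n r : ℕ} {ι κ μ : Type} (A : Finset (ZMod n)) (s : ι → ZMod n)
    (a : ι → Fin r) (v : κ → ZMod n) (b : κ → Fin r) (w : μ → ZMod n) (e : μ → Option (Fin r))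
    (x : ZMod n) : Finset (Fin r) :=
  if h : Resolved A s a v b x then {a h.choose, b h.choose_spec.choose}
  else if h : ∃ j, (e j).isSome ∧ (2 * w j - x ∈ A ∧ ¬ Resolved A s a v b (2 * w j - x)) then
    (e h.choose).toFinset
  else ∅

lemma template_card {n r : ℕ} {ι κ μ : Type} (A : Finset (ZMod n)) (s : ι → ZMod n)
    (a : ι → Fin r) (v : κ → ZMod n) (b : κ → Fin r) (w : μ → ZMod n) (e : μ → Option (Fin r))
    (x : ZMod n) : #(template A s a v b w e x) ≤ 2 := by
  unfold template
  split_ifs with h h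
  · exact Finset.card_le_two
  · cases e h.choose <;> simp
  · simp

lemma poly_le_exp (C c : ℝ) (K : ℕ) (hc : 0 < c) :
    ∃ n₀ : ℕ, ∀ n : ℕ, n₀ ≤ n → C * (n : ℝ) ^ K ≤ (2 : ℝ) ^ (c * n) := by
  have hb : (1 : ℝ) < 2 ^ c := Real.one_lt_rpow (by norm_num) hc
  have h := (isLittleO_pow_const_const_pow_of_one_lt (R := ℝ) K hb).bound
    (show (0 : ℝ) < 1 / (|C| + 1) by positivity)
  obtain ⟨n₀, hn₀⟩ := Filter.eventually_atTop.1 h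
  refine ⟨n₀, fun n hn => ?_⟩
  have h1 := hn₀ n hn
  rw [Real.norm_of_nonneg (by positivity), Real.norm_of_nonneg (by positivity),
    div_mul_eq_mul_div, le_div_iff₀ (by positivity), one_mul] at h1
  rw [Real.rpow_mul (by norm_num), Real.rpow_natCast]
  have h2 : C * (n : ℝ) ^ K ≤ (|C| + 1) * (n : ℝ) ^ K := by
    gcongr
    linarith [le_abs_self C]
  linarith

lemma container_approx (r : ℕ) (hr : 1 ≤ r) (ε : ℝ) (hε : 0 < ε) :
    ∃ n₀ : ℕ, ∀ n : ℕ, n₀ ≤ n → ∀ _ : NeZero n, ∀ A : Finset (ZMod n),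
      ∃ PP : Finset (ZMod n → Finset (Fin r)), (#PP : ℝ) ≤ (2 : ℝ) ^ (ε * n) ∧
        (∀ P ∈ PP, ∀ x, #(P x) ≤ 2) ∧
        ∀ f : ZMod n → Fin r, RFon A f →
          ∃ P ∈ PP, ∃ W : Finset (ZMod n), (#W : ℝ) ≤ ε * n ∧ ∀ x ∈ A, x ∉ W → f x ∈ P x := by
  obtain ⟨m₃, ζ, hζ, hmono⟩ := mono_part (ε / 3) (by positivity)
  have hrr : (0 : ℝ) < r := by exact_mod_cast hr
  set δ : ℝ := min 1 (ζ / 2) with hδ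
  have hδ0 : 0 < δ := by positivity
  set η : ℝ := min 1 (ε / (2 * r)) with hη
  have hη0 : 0 < η := by positivity
  obtain ⟨J, m, n₁, hsample⟩ := sample_cover δ (ζ / 2) η hδ0 (min_le_left _ _) (by positivity)
    hη0 (min_le_left _ _)
  obtain ⟨n₂, hpoly⟩ := poly_le_exp ((r : ℝ) ^ m * (r + 1 : ℝ) ^ m₃) (ε / 2) (J + m + m₃) (by positivity)
  refine ⟨max n₁ n₂, fun n hn _ A => ?_⟩
  have hnr : (0 : ℝ) < n := by exact_mod_cast Nat.pos_of_ne_zero (NeZero.ne n)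
  obtain ⟨L, hL, hcov⟩ := hsample n ((le_max_left _ _).trans hn) inferInstance
  let F : ((Fin J → ZMod n) × (Fin m → ZMod n) × (Fin m₃ → ZMod n)) ×
      ((Fin J × Fin L → Fin r) × (Fin m → Fin r) × (Fin m₃ → Option (Fin r))) →
      (ZMod n → Finset (Fin r)) := fun d =>
    template A (fun q : Fin J × Fin L => d.1.1 q.1 + ((q.2 : ℕ) : ZMod n)) d.2.1 d.1.2.1 d.2.2.1
      d.1.2.2 d.2.2.2
  refine ⟨univ.image F, ?_, ?_, ?_⟩
  · have h1 : #(univ.image F) ≤ n ^ J * (n ^ m * n ^ m₃) * (r ^ (J * L) * (r ^ m * (r + 1) ^ m₃)) := by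
      refine Finset.card_image_le.trans ?_
      simp [ZMod.card, Fintype.card_prod, Fintype.card_pi]
    have h1' : (#(univ.image F) : ℝ) ≤
        (n : ℝ) ^ J * (n ^ m * n ^ m₃) * (r ^ (J * L) * (r ^ m * (r + 1) ^ m₃)) := by exact_mod_cast h1
    refine h1'.trans ?_
    have h2 : ((r : ℝ) ^ (J * L)) ≤ (2 : ℝ) ^ (ε / 2 * n) := by
      have h3 : (r : ℝ) ≤ 2 ^ (r : ℝ) := by
        rw [Real.rpow_natCast]; exact_mod_cast (Nat.lt_two_pow_self (n := r)).le
      calc ((r : ℝ) ^ (J * L)) ≤ ((2 : ℝ) ^ (r : ℝ)) ^ (J * L) := by gcongr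
        _ = (2 : ℝ) ^ ((r : ℝ) * (J * L)) := by
          rw [← Real.rpow_natCast, ← Real.rpow_mul (by norm_num)]; push_cast; rfl
        _ ≤ (2 : ℝ) ^ (ε / 2 * n) := by
          apply Real.rpow_le_rpow_of_exponent_le (by norm_num)
          have : η ≤ ε / (2 * r) := min_le_right _ _
          calc (r : ℝ) * (J * L) ≤ r * (η * n) := by gcongr
            _ ≤ r * (ε / (2 * r) * n) := by gcongr
            _ = ε / 2 * n := by field_simp
    have h4 := hpoly n ((le_max_right _ _).trans hn)
    have h5 : ε * n = ε / 2 * n + ε / 2 * n := by ring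
    rw [h5, Real.rpow_add (by norm_num)]
    calc (n : ℝ) ^ J * (n ^ m * n ^ m₃) * (r ^ (J * L) * (r ^ m * (r + 1) ^ m₃))
        = ((r : ℝ) ^ m * (r + 1 : ℝ) ^ m₃ * (n : ℝ) ^ (J + m + m₃)) * r ^ (J * L) := by ring
      _ ≤ _ := by gcongr
  · intro P hP x
    obtain ⟨d, _, rfl⟩ := Finset.mem_image.1 hP
    exact template_card _ _ _ _ _ _ _ _
  · intro f hf
    let T : ZMod n → Finset (ZMod n) := fun x => {t ∈ A | 2 * t - x ∈ A ∧ f t ≠ f (2 * t - x)}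
    let X : Finset (ZMod n) := {x ∈ A | δ * n ≤ #(T x)}
    obtain ⟨u, v, huv⟩ := hcov X T (fun x hx => (Finset.mem_filter.1 hx).2)
    let s : Fin J × Fin L → ZMod n := fun q => u q.1 + ((q.2 : ℕ) : ZMod n)
    let B : Finset (ZMod n) := {x ∈ A | ¬ Resolved A s (fun q => f (s q)) v (fun k => f (v k)) x}
    have hBX : (#(B ∩ X) : ℝ) ≤ ζ / 2 * n := by
      refine le_trans (Nat.cast_le.2 (Finset.card_le_card fun x hx => ?_)) huv
      rw [Finset.mem_inter] at hx
      refine Finset.mem_filter.2 ⟨hx.2, ?_⟩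
      rintro ⟨j, l, k, h1, h2⟩
      refine (Finset.mem_filter.1 hx.1).2 ⟨(j, l), k, ?_⟩
      have h1' := Finset.mem_filter.1 h1
      rw [h2] at h1'
      exact ⟨h1'.1, h1'.2.1, h2, h1'.2.2⟩
    have hpairs : (#{p : ZMod n × ZMod n | p.1 ∈ B ∧ p.2 ∈ B ∧ 2 * p.2 - p.1 ∈ B ∧
        f p.2 ≠ f (2 * p.2 - p.1)} : ℝ) ≤ ζ * (n : ℝ) ^ 2 := by
      have h2 : #{p : ZMod n × ZMod n | p.1 ∈ B ∧ p.2 ∈ B ∧ 2 * p.2 - p.1 ∈ B ∧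
        f p.2 ≠ f (2 * p.2 - p.1)} ≤ ∑ x ∈ B, #(T x) := by
        rw [← Finset.card_sigma]
        refine Finset.card_le_card_of_injOn (fun q => ⟨q.1, q.2⟩) ?_ ?_
        · rintro ⟨x, t⟩ hq
          simp only [coe_sigma, Set.mem_sigma_iff, mem_coe, mem_filter, mem_univ, true_and] at hq ⊢
          exact ⟨hq.1, Finset.mem_filter.2 ⟨(Finset.mem_filter.1 hq.2.1).1,
            (Finset.mem_filter.1 hq.2.2.1).1, hq.2.2.2⟩⟩
        · rintro ⟨x, t⟩ _ ⟨x', t'⟩ _ h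
          simpa using h
      have h2' : (#{p : ZMod n × ZMod n | p.1 ∈ B ∧ p.2 ∈ B ∧ 2 * p.2 - p.1 ∈ B ∧
        f p.2 ≠ f (2 * p.2 - p.1)} : ℝ) ≤ ∑ x ∈ B, (#(T x) : ℝ) := by exact_mod_cast h2
      refine h2'.trans ?_
      have h3 : ∀ x ∈ B, (#(T x) : ℝ) ≤ (if x ∈ X then (n : ℝ) else 0) + ζ / 2 * n := by
        intro x hx
        split_ifs with hxX
        · have : #(T x) ≤ n := by
            have := Finset.card_le_univ (T x)
            rwa [ZMod.card] at this
          have : (#(T x) : ℝ) ≤ n := by exact_mod_cast this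
          have : 0 ≤ ζ / 2 * n := by positivity
          linarith
        · have : ¬ δ * n ≤ #(T x) := fun h => hxX (Finset.mem_filter.2 ⟨(Finset.mem_filter.1 hx).1, h⟩)
          have h4 : δ * n ≤ ζ / 2 * n := by gcongr; exact min_le_right _ _
          linarith
      refine (Finset.sum_le_sum h3).trans ?_
      rw [Finset.sum_add_distrib, ← Finset.sum_filter]
      have hBn : (#B : ℝ) ≤ n := by
        have := Finset.card_le_univ B
        rw [ZMod.card] at this
        exact_mod_cast this
      have h6 : (B.filter (fun x => x ∈ X)) = B ∩ X := by ext; simp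
      rw [h6]
      simp only [sum_const, nsmul_eq_mul]
      have h7 : (#(B ∩ X) : ℝ) * n ≤ ζ / 2 * n * n := by gcongr
      have h8 : (#B : ℝ) * (ζ / 2 * n) ≤ n * (ζ / 2 * n) := by gcongr
      nlinarith
    obtain ⟨w, e, hwe1, hwe2⟩ := hmono n inferInstance r B f hpairs
    refine ⟨F ((u, v, w), (fun q => f (s q), fun k => f (v k), e)),
      Finset.mem_image_of_mem _ (Finset.mem_univ _),
      ({x ∈ B | ¬ ∃ j, (e j).isSome ∧ 2 * w j - x ∈ B} ∪
        {x ∈ B | ∃ j, (e j).isSome ∧ 2 * w j - x ∈ B ∧ e j ≠ some (f x)}), ?_, ?_⟩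
    · refine (Nat.cast_le.2 (Finset.card_union_le _ _)).trans ?_
      push_cast
      linarith
    · intro x hxA hxW
      show f x ∈ template A s (fun q => f (s q)) v (fun k => f (v k)) w e x
      unfold template
      split_ifs with h1 h2
      · obtain ⟨h3, h4, h5, h6⟩ := h1.choose_spec.choose_spec
        set i := h1.choose
        set k := h1.choose_spec.choose
        have := hf x hxA (s i) h3 (v k) h4 (by rw [← h5]; ring)
        simp only [mem_insert, mem_singleton]
        tauto
      · obtain ⟨h3, h4⟩ := h2.choose_spec
        set j := h2.choose
        have hxB : x ∈ B := Finset.mem_filter.2 ⟨hxA, h1⟩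
        have hmem : 2 * w j - x ∈ B := Finset.mem_filter.2 h4
        by_contra hcon
        refine hxW (Finset.mem_union_right _ (Finset.mem_filter.2 ⟨hxB, j, h3, hmem, ?_⟩))
        intro hej
        apply hcon
        rw [hej]; simp
      · exfalso
        have hxB : x ∈ B := Finset.mem_filter.2 ⟨hxA, h1⟩
        refine hxW (Finset.mem_union_left _ (Finset.mem_filter.2 ⟨hxB, ?_⟩))
        rintro ⟨j, h3, h4⟩
        exact h2 ⟨j, h3, Finset.mem_filter.1 h4⟩

/-- Number of partial functions with small support. -/
lemma card_small_support {α β : Type*} [Fintype α] [Fintype β] (lam : ℝ) (hl : 0 < lam) (hl1 : lam ≤ 1) (k : ℝ) :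
    (#{g : α → Option β | (#{x | (g x).isSome} : ℝ) ≤ k} : ℝ) * lam ^ k ≤
      (1 + Fintype.card β * lam) ^ Fintype.card α := by
  have h1 : ∑ g : α → Option β, lam ^ (#{x | (g x).isSome}) =
      (1 + Fintype.card β * lam) ^ Fintype.card α := by
    have : ∀ g : α → Option β, lam ^ (#{x | (g x).isSome}) =
        ∏ x, (if (g x).isSome then lam else 1) := by
      intro g
      rw [Finset.prod_ite]; simp
    simp only [this]
    rw [← Fintype.prod_sum (fun (_ : α) (o : Option β) => if o.isSome then lam else (1:ℝ))]
    simp [Fintype.sum_option]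
  rw [← h1]
  calc _ = ∑ g ∈ ({g : α → Option β | (#{x | (g x).isSome} : ℝ) ≤ k} : Finset _), lam ^ k := by simp
    _ ≤ ∑ g ∈ ({g : α → Option β | (#{x | (g x).isSome} : ℝ) ≤ k} : Finset _),
        lam ^ (#{x | (g x).isSome}) := by
      refine Finset.sum_le_sum fun g hg => ?_
      rw [← Real.rpow_natCast]
      exact Real.rpow_le_rpow_of_exponent_ge hl hl1 (Finset.mem_filter.1 hg).2
    _ ≤ _ := Finset.sum_le_sum_of_subset_of_nonneg (Finset.subset_univ _) fun _ _ _ => by positivity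

lemma container_exact (r : ℕ) (hr : 1 ≤ r) (θ : ℝ) (hθ : 0 < θ) :
    ∃ n₀ : ℕ, ∀ n : ℕ, n₀ ≤ n → ∀ _ : NeZero n, ∀ A : Finset (ZMod n),
      ∃ PP : Finset (ZMod n → Finset (Fin r)), (#PP : ℝ) ≤ (2 : ℝ) ^ (θ * n) ∧
        (∀ P ∈ PP, ∀ x, #(P x) ≤ 2) ∧
        ∀ f : ZMod n → Fin r, RFon A f → ∃ P ∈ PP, ∀ x ∈ A, f x ∈ P x := by
  have hrr : (0 : ℝ) < r := by exact_mod_cast hr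
  have hb : (1 : ℝ) < 2 ^ (θ / 3) := Real.one_lt_rpow (by norm_num) (by positivity)
  set lam : ℝ := min (1 / 2) ((2 ^ (θ / 3) - 1) / r) with hlam
  have hl0 : 0 < lam := lt_min (by norm_num) (div_pos (by linarith) hrr)
  have hl1 : lam ≤ 1 := (min_le_left _ _).trans (by norm_num)
  have hl2 : 1 + r * lam ≤ 2 ^ (θ / 3) := by
    have : lam ≤ (2 ^ (θ / 3) - 1) / r := min_le_right _ _
    rw [le_div_iff₀ hrr] at this
    linarith
  set q : ℝ := - Real.logb 2 lam with hq
  have hq0 : 0 < q := by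
    have : Real.logb 2 lam < 0 := Real.logb_neg (by norm_num) hl0 (lt_of_le_of_lt (min_le_left _ _) (by norm_num))
    linarith
  have hlamq : lam = 2 ^ (-q) := by
    rw [hq, neg_neg, Real.rpow_logb (by norm_num) (by norm_num) hl0]
  set ε : ℝ := min (θ / 3) (θ / (3 * q)) with hε
  have hε0 : 0 < ε := by positivity
  obtain ⟨n₀, h⟩ := container_approx r hr ε hε0
  refine ⟨n₀, fun n hn _ A => ?_⟩
  obtain ⟨PP, h1, h2, h3⟩ := h n hn inferInstance A
  let GG : Finset (ZMod n → Option (Fin r)) := {g | (#{x | (g x).isSome} : ℝ) ≤ ε * n}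
  let F : (ZMod n → Finset (Fin r)) × (ZMod n → Option (Fin r)) → (ZMod n → Finset (Fin r)) :=
    fun d x => if (d.2 x).isSome then (d.2 x).toFinset else d.1 x
  refine ⟨(PP ×ˢ GG).image F, ?_, ?_, ?_⟩
  · have hG : (#GG : ℝ) ≤ 2 ^ (θ / 3 * n) * 2 ^ (θ / 3 * n) := by
      have h4 := card_small_support (α := ZMod n) (β := Fin r) lam hl0 hl1 (ε * n)
      rw [ZMod.card, Fintype.card_fin] at h4
      have h4a : (#GG : ℝ) * lam ^ (ε * n) ≤ (1 + r * lam) ^ n := by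
        convert h4 using 3
        congr!
      have h5 : (1 + r * lam) ^ n ≤ (2 : ℝ) ^ (θ / 3 * n) := by
        rw [Real.rpow_mul (by norm_num), Real.rpow_natCast]
        gcongr
      have h6 : (2 : ℝ) ^ (-(θ / 3 * n)) ≤ lam ^ (ε * n) := by
        rw [hlamq, ← Real.rpow_mul (by norm_num)]
        apply Real.rpow_le_rpow_of_exponent_le (by norm_num)
        have : ε ≤ θ / (3 * q) := min_le_right _ _
        have : ε * q ≤ θ / 3 := by
          rw [le_div_iff₀ (by positivity)] at this
          linarith
        have : ε * q * n ≤ θ / 3 * n := by gcongr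
        linarith
      have h7 : (#GG : ℝ) * (2 : ℝ) ^ (-(θ / 3 * n)) ≤ 2 ^ (θ / 3 * n) :=
        le_trans (le_trans (mul_le_mul_of_nonneg_left h6 (Nat.cast_nonneg _)) h4a) h5
      rw [Real.rpow_neg (by norm_num), ← div_eq_mul_inv, div_le_iff₀ (by positivity)] at h7
      exact h7
    have hP : (#PP : ℝ) ≤ 2 ^ (θ / 3 * n) := by
      refine h1.trans (Real.rpow_le_rpow_of_exponent_le (by norm_num) ?_)
      gcongr
      exact min_le_left _ _
    have h8 : (#((PP ×ˢ GG).image F) : ℝ) ≤ #PP * #GG := by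
      have : #((PP ×ˢ GG).image F) ≤ #PP * #GG := Finset.card_image_le.trans (Finset.card_product _ _).le
      exact_mod_cast this
    have h9 : θ * n = θ / 3 * n + (θ / 3 * n + θ / 3 * n) := by ring
    rw [h9, Real.rpow_add (by norm_num), Real.rpow_add (by norm_num)]
    exact h8.trans (mul_le_mul hP hG (Nat.cast_nonneg _) (Real.rpow_nonneg (by norm_num) _))
  · intro P hP x
    obtain ⟨⟨P', g⟩, hd, rfl⟩ := Finset.mem_image.1 hP
    simp only [F]
    split_ifs with hs
    · cases g x <;> simp
    · exact h2 P' (Finset.mem_product.1 hd).1 x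
  · intro f hf
    obtain ⟨P, hP, W, hW, hPW⟩ := h3 f hf
    let g : ZMod n → Option (Fin r) := fun x => if x ∈ W then some (f x) else none
    refine ⟨F (P, g), Finset.mem_image_of_mem _ (Finset.mem_product.2 ⟨hP, ?_⟩), ?_⟩
    · refine Finset.mem_filter.2 ⟨Finset.mem_univ _, le_trans ?_ hW⟩
      refine Nat.cast_le.2 (Finset.card_le_card fun x hx => ?_)
      have hx' := (Finset.mem_filter.1 hx).2
      by_contra hxW
      simp [g, hxW] at hx'
    · intro x hx
      by_cases hxW : x ∈ W
      · simp [F, g, hxW]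
      · simpa [F, g, hxW] using hPW x hx hxW

/-! ### Final counting -/

lemma pair_card {r : ℕ} (P₁ P₂ : Finset (Fin r)) (i : Fin r) (hi : i ∉ P₁) (h₁ : #P₁ ≤ 2)
    (h₂ : #P₂ ≤ 2) : #((P₁ ×ˢ P₂).filter (fun p => p.2 = p.1 ∨ p.2 = i)) ≤ 3 := by
  by_cases h : i ∈ P₂
  · have hsub : ((P₁ ×ˢ P₂).filter (fun p => p.2 = p.1 ∨ p.2 = i)) ⊆
        P₁.image (fun a => (a, i)) ∪ (P₂.erase i).image (fun a => (a, a)) := by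
      rintro ⟨a, b⟩ hab
      simp only [mem_filter, mem_product, mem_union, mem_image, mem_erase] at hab ⊢
      obtain ⟨⟨ha, hb⟩, h3⟩ := hab
      by_cases hbi : b = i
      · left; exact ⟨a, ha, by rw [hbi]⟩
      · right
        have : b = a := by tauto
        exact ⟨b, ⟨hbi, hb⟩, by rw [this]⟩
    refine (card_le_card hsub).trans ((card_union_le _ _).trans ?_)
    have h3 : #(P₁.image (fun a => (a, i))) ≤ 2 := card_image_le.trans h₁
    have h4 : #((P₂.erase i).image (fun a => (a, a))) ≤ 1 := by
      refine card_image_le.trans ?_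
      rw [card_erase_of_mem h]; omega
    omega
  · have hsub : ((P₁ ×ˢ P₂).filter (fun p => p.2 = p.1 ∨ p.2 = i)) ⊆
        P₁.image (fun a => (a, a)) := by
      rintro ⟨a, b⟩ hab
      simp only [mem_filter, mem_product, mem_image] at hab ⊢
      obtain ⟨⟨ha, hb⟩, h3⟩ := hab
      rcases h3 with h3 | h3
      · exact ⟨a, ha, by rw [h3]⟩
      · exact absurd (h3 ▸ hb) h
    exact (card_le_card hsub).trans (card_image_le.trans (h₁.trans (by norm_num)))

lemma involution_select {α : Type*} (v : α → ℕ) (hv : Function.Injective v) (σ : α → α)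
    (hσ : ∀ y, σ (σ y) = y) (K : Finset α) (hK : ∀ y ∈ K, σ y ≠ y) :
    ∃ Q : Finset α, Q ⊆ K ∧ (∀ y ∈ Q, σ y ∉ Q) ∧ #K ≤ 2 * #Q := by
  refine ⟨K.filter (fun y => σ y ∉ K ∨ v y < v (σ y)), filter_subset _ _, ?_, ?_⟩
  · intro y hy hy'
    simp only [mem_filter, hσ] at hy hy'
    rcases hy.2 with h | h
    · exact h hy'.1
    · rcases hy'.2 with h' | h'
      · exact h' hy.1
      · omega
  · have hsub : K ⊆ K.filter (fun y => σ y ∉ K ∨ v y < v (σ y)) ∪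
        (K.filter (fun y => σ y ∉ K ∨ v y < v (σ y))).image σ := by
      intro y hy
      rw [mem_union]
      by_cases h : σ y ∉ K ∨ v y < v (σ y)
      · left; exact mem_filter.2 ⟨hy, h⟩
      · right
        push Not at h
        refine mem_image.2 ⟨σ y, mem_filter.2 ⟨h.1, Or.inr ?_⟩, hσ y⟩
        rw [hσ]
        exact lt_of_le_of_ne h.2 fun hh => hK y hy (hv hh)
    refine (card_le_card hsub).trans ((card_union_le _ _).trans ?_)
    have := card_image_le (s := K.filter (fun y => σ y ∉ K ∨ v y < v (σ y))) (f := σ)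
    omega

lemma count_pairs {n r : ℕ} [NeZero n] (i₀ : Fin r) (A : Finset (ZMod n))
    (P : ZMod n → Finset (Fin r)) (hP : ∀ x, #(P x) ≤ 2) (x : ZMod n) (hx : x ∈ A) (i : Fin r)
    (Q : Finset (ZMod n)) (hQA : Q ⊆ A) (hQi : ∀ y ∈ Q, i ∉ P y)
    (hQσ : ∀ y ∈ Q, 2 * x - y ∈ A) (hQd : ∀ y ∈ Q, 2 * x - y ∉ Q)
    (S : Finset (ZMod n → Fin r))
    (hS : ∀ f ∈ S, (∀ y, y ∉ A → f y = i₀) ∧ RFon A f ∧ (∀ y ∈ A, f y ∈ P y) ∧ f x = i) :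
    #S * 4 ^ #Q ≤ 2 ^ n * 3 ^ #Q := by
  have hσσ : ∀ y : ZMod n, 2 * x - (2 * x - y) = y := fun y => by ring
  let pal : ZMod n → Finset (Fin r × Fin r) := fun y =>
    if y ∈ Q then (P y ×ˢ P (2 * x - y)).filter (fun p => p.2 = p.1 ∨ p.2 = i)
    else if 2 * x - y ∈ Q then {(i₀, i₀)}
    else (if y ∈ A then P y else {i₀}) ×ˢ {i₀}
  let Φ : (ZMod n → Fin r) → (ZMod n → Fin r × Fin r) := fun f y =>
    if y ∈ Q then (f y, f (2 * x - y)) else if 2 * x - y ∈ Q then (i₀, i₀) else (f y, i₀)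
  have h1 : #S ≤ #(Fintype.piFinset pal) := by
    refine card_le_card_of_injOn Φ ?_ ?_
    · intro f hf
      obtain ⟨hf0, hfR, hfP, hfx⟩ := hS f hf
      rw [mem_coe, Fintype.mem_piFinset]
      intro y
      simp only [Φ, pal]
      split_ifs with h1 h2 h3
      · refine mem_filter.2 ⟨mem_product.2 ⟨hfP y (hQA h1), hfP _ (hQσ y h1)⟩, ?_⟩
        have := hfR y (hQA h1) x hx (2 * x - y) (hQσ y h1) (by ring)
        have hne : f y ≠ i := fun h => hQi y h1 (h ▸ hfP y (hQA h1))
        rw [hfx] at this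
        rcases this with h | h | h
        · exact absurd h hne
        · right; exact h.symm
        · left; exact h.symm
      · simp
      · simpa using hfP y h3
      · simpa using hf0 y h3
    · intro f hf g hg hfg
      funext y
      by_cases h1 : y ∈ Q
      · have := congrFun hfg y
        simp only [Φ, h1, if_true, Prod.mk.injEq] at this
        exact this.1
      · by_cases h2 : 2 * x - y ∈ Q
        · have := congrFun hfg (2 * x - y)
          simp only [Φ, h2, if_true, Prod.mk.injEq, hσσ] at this
          exact this.2
        · have := congrFun hfg y
          simp only [Φ, h1, h2, if_false, Prod.mk.injEq] at this
          exact this.1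
  rw [Fintype.card_piFinset] at h1
  have h2 : (∏ y, #(pal y)) * ((∏ y, if y ∈ Q then 2 else 1) *
      (∏ y, if 2 * x - y ∈ Q then 2 else 1)) ≤ 2 ^ n * ∏ y, if y ∈ Q then 3 else 1 := by
    have h3 : (2 : ℕ) ^ n = ∏ _y : ZMod n, 2 := by simp [ZMod.card]
    rw [h3, ← prod_mul_distrib, ← prod_mul_distrib, ← prod_mul_distrib]
    refine prod_le_prod' fun y _ => ?_
    simp only [pal]
    by_cases h1 : y ∈ Q
    · have := pair_card (P y) (P (2 * x - y)) i (hQi y h1) (hP _) (hP _)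
      simp only [h1, hQd y h1, if_true, if_false]
      omega
    · by_cases h2 : 2 * x - y ∈ Q
      · simp [h1, h2]
      · simp only [h1, h2, if_false, card_product, card_singleton, mul_one]
        split_ifs
        · exact hP y
        · simp
  have h4 : ∀ a : ℕ, (∏ y, if y ∈ Q then a else 1) = a ^ #Q := by
    intro a
    rw [prod_ite]; simp
  have h5 : (∏ y, if 2 * x - y ∈ Q then 2 else 1) = 2 ^ #Q := by
    rw [← h4]
    exact Fintype.prod_equiv (Equiv.subLeft (2 * x)) _ _ (fun y => by simp)
  rw [h4, h4, h5, ← mul_pow] at h2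
  exact le_trans (Nat.mul_le_mul_right _ h1) h2

lemma count_triple {n r : ℕ} [NeZero n] (i₀ : Fin r) (A : Finset (ZMod n))
    (hA : 23 * n ≤ 24 * #A)
    (P : ZMod n → Finset (Fin r)) (hP : ∀ x, #(P x) ≤ 2) (x : Fin 3 → ZMod n)
    (hx : ∀ k, x k ∈ A) (i : Fin 3 → Fin r) (hi : Function.Injective i)
    (S : Finset (ZMod n → Fin r))
    (hS : ∀ f ∈ S, (∀ y, y ∉ A → f y = i₀) ∧ RFon A f ∧ (∀ y ∈ A, f y ∈ P y) ∧
      ∀ k, f (x k) = i k) :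
    ∃ q : ℕ, 5 * n ≤ 36 * q + 36 ∧ #S * 4 ^ q ≤ 2 ^ n * 3 ^ q := by
  have hcov : A ⊆ univ.biUnion (fun k : Fin 3 => A.filter (fun y => i k ∉ P y)) := by
    intro y hy
    by_contra hcon
    have hall : ∀ k, i k ∈ P y := by
      intro k
      by_contra hk
      exact hcon (mem_biUnion.2 ⟨k, mem_univ _, mem_filter.2 ⟨hy, hk⟩⟩)
    have : #(univ.image i) ≤ #(P y) := card_le_card (by
      intro c hc
      obtain ⟨k, _, rfl⟩ := mem_image.1 hc
      exact hall k)
    rw [card_image_of_injective _ hi, card_univ, Fintype.card_fin] at this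
    have := hP y
    omega
  obtain ⟨k, hk⟩ : ∃ k : Fin 3, #A ≤ 3 * #(A.filter (fun y => i k ∉ P y)) := by
    by_contra! hcon
    have h1 := (card_le_card hcov).trans card_biUnion_le
    rw [Fin.sum_univ_three] at h1
    have := hcon 0
    have := hcon 1
    have := hcon 2
    omega
  set K := A.filter (fun y => i k ∉ P y) with hK
  set K' := K.filter (fun y => 2 * x k - y ∈ A ∧ 2 * x k - y ≠ y) with hK'
  have hAn : #A ≤ n := by
    have := card_le_univ A
    rwa [ZMod.card] at this
  have hcardK : #K ≤ #K' + (n - #A) + 2 := by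
    have hsub : K ⊆ (K' ∪ Aᶜ.image (fun y => 2 * x k - y)) ∪
        univ.filter (fun d : ZMod n => ((2 : ℕ) : ZMod n) * d = 2 * x k) := by
      intro y hy
      simp only [mem_union]
      by_cases h1 : 2 * x k - y ∈ A
      · by_cases h2 : 2 * x k - y = y
        · right
          refine mem_filter.2 ⟨mem_univ _, ?_⟩
          push_cast
          linear_combination -h2
        · left; left; exact mem_filter.2 ⟨hy, h1, h2⟩
      · left; right
        exact mem_image.2 ⟨2 * x k - y, mem_compl.2 h1, by ring⟩
    refine (card_le_card hsub).trans ((card_union_le _ _).trans ?_)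
    have h1 := card_union_le K' (Aᶜ.image (fun y => 2 * x k - y))
    have h2 : #(Aᶜ.image (fun y => 2 * x k - y)) ≤ n - #A := by
      refine card_image_le.trans ?_
      rw [card_compl, ZMod.card]
    have h3 : #(univ.filter (fun d : ZMod n => ((2 : ℕ) : ZMod n) * d = 2 * x k)) ≤ 2 := by
      have := card_mul_eq_le (n := n) 2 (by norm_num) (2 * x k)
      convert this
    omega
  obtain ⟨Q, hQK, hQd, hQc⟩ := involution_select (fun y : ZMod n => y.val)
    (ZMod.val_injective n) (fun y => 2 * x k - y) (fun y => by ring) K'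
    (fun y hy => (mem_filter.1 hy).2.2)
  refine ⟨#Q, by omega, ?_⟩
  have hQK' : ∀ y ∈ Q, (y ∈ A ∧ i k ∉ P y) ∧ 2 * x k - y ∈ A := by
    intro y hy
    have h1 := mem_filter.1 (hQK hy)
    exact ⟨mem_filter.1 h1.1, h1.2.1⟩
  exact count_pairs i₀ A P hP (x k) (hx k) (i k) Q (fun y hy => (hQK' y hy).1.1)
    (fun y hy => (hQK' y hy).1.2) (fun y hy => (hQK' y hy).2) hQd S
    (fun f hf => ⟨(hS f hf).1, (hS f hf).2.1, (hS f hf).2.2.1, (hS f hf).2.2.2 k⟩)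

/-- At least three colors are used on `A`. -/
def Three {n r : ℕ} (A : Finset (ZMod n)) (f : ZMod n → Fin r) : Prop :=
  ∃ x : Fin 3 → ZMod n, (∀ k, x k ∈ A) ∧ Function.Injective (fun k => f (x k))

lemma pow34 (q n : ℕ) (N : ℝ) (hN : 0 ≤ N) (h : 5 * n ≤ 36 * q + 36)
    (hc : N * 4 ^ q ≤ 2 ^ n * 3 ^ q) :
    N ≤ 2 ^ n * (2 * (2 : ℝ) ^ (-(n : ℝ) / 18)) := by
  have h1 : ((3 : ℝ) / 4) ≤ 2 ^ (-(2 : ℝ) / 5) := by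
    have h2 : ((3 : ℝ) / 4) ^ 5 ≤ ((2 : ℝ) ^ (-(2 : ℝ) / 5)) ^ 5 := by
      rw [← Real.rpow_natCast ((2 : ℝ) ^ (-(2 : ℝ) / 5)), ← Real.rpow_mul (by norm_num)]
      norm_num
    exact le_of_pow_le_pow_left₀ (by norm_num) (by positivity) h2
  have h3 : N ≤ 2 ^ n * (3 / 4) ^ q := by
    rw [div_pow, mul_div_assoc', le_div_iff₀ (by positivity)]
    exact hc
  refine h3.trans ?_
  gcongr
  calc ((3 : ℝ) / 4) ^ q ≤ (2 ^ (-(2 : ℝ) / 5)) ^ q := by gcongr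
    _ = 2 ^ (-(2 : ℝ) / 5 * q) := by
      rw [← Real.rpow_natCast, ← Real.rpow_mul (by norm_num)]
    _ ≤ 2 ^ (1 + -(n : ℝ) / 18) := by
      apply Real.rpow_le_rpow_of_exponent_le (by norm_num)
      have : (5 : ℝ) * n ≤ 36 * q + 36 := by exact_mod_cast h
      linarith
    _ = _ := by rw [Real.rpow_add (by norm_num), Real.rpow_one]

lemma three_part (r : ℕ) (i₀ : Fin r) : ∃ n₀ : ℕ, ∀ n : ℕ, n₀ ≤ n → ∀ _ : NeZero n,
    ∀ A : Finset (ZMod n), ∀ S : Finset (ZMod n → Fin r),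
      (∀ f ∈ S, (∀ y, y ∉ A → f y = i₀) ∧ RFon A f ∧ Three A f) → 4 * #S < 2 ^ n := by
  have hr : 1 ≤ r := Fin.pos i₀
  obtain ⟨n₁, hcont⟩ := container_exact r hr (1 / 100) (by norm_num)
  obtain ⟨n₂, hpoly⟩ := poly_le_exp (16 * (r : ℝ) ^ 3) (1 / 50) 3 (by norm_num)
  obtain ⟨n₃, hpoly'⟩ := poly_le_exp 8 (1 / 50) 0 (by norm_num)
  refine ⟨max n₁ (max n₂ n₃), fun n hn _ A S hS => ?_⟩
  have hnp : (0 : ℝ) < n := by exact_mod_cast Nat.pos_of_ne_zero (NeZero.ne n)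
  obtain ⟨PP, hPP, hP2, hPf⟩ := hcont n ((le_max_left _ _).trans hn) inferInstance A
  have hp := hpoly n (((le_max_left _ _).trans (le_max_right _ _)).trans hn)
  have hp' := hpoly' n (((le_max_right _ _).trans (le_max_right _ _)).trans hn)
  suffices h : 4 * (#S : ℝ) < 2 ^ n by exact_mod_cast h
  have h2n : (2 : ℝ) ^ n = 2 ^ (n : ℝ) := (Real.rpow_natCast _ _).symm
  by_cases hA : 23 * n ≤ 24 * #A
  · -- nearly full sets
    let D := (Fin 3 → ZMod n) × (Fin 3 → Fin r)
    let T : (ZMod n → Finset (Fin r)) × D → Finset (ZMod n → Fin r) := fun d =>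
      S.filter (fun f => (∀ y ∈ A, f y ∈ d.1 y) ∧ (∀ k, d.2.1 k ∈ A) ∧ 
        Function.Injective d.2.2 ∧ ∀ k, f (d.2.1 k) = d.2.2 k)
    have hcov : S ⊆ (PP ×ˢ (univ : Finset D)).biUnion T := by
      intro f hf
      obtain ⟨h0, hR, x, hxA, hinj⟩ := hS f hf
      obtain ⟨P, hP, hfP⟩ := hPf f hR
      exact mem_biUnion.2 ⟨(P, x, fun k => f (x k)), mem_product.2 ⟨hP, mem_univ _⟩,
        mem_filter.2 ⟨hf, hfP, hxA, hinj, fun _ => rfl⟩⟩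
    have hT : ∀ d ∈ PP ×ˢ (univ : Finset D),
        (#(T d) : ℝ) ≤ 2 ^ n * (2 * (2 : ℝ) ^ (-(n : ℝ) / 18)) := by
      rintro ⟨P, x, i⟩ hd
      by_cases hgood : (∀ k, x k ∈ A) ∧ Function.Injective i
      · obtain ⟨q, hq1, hq2⟩ := count_triple i₀ A hA P (hP2 P (mem_product.1 hd).1) x hgood.1 i
          hgood.2 (T (P, x, i)) (fun f hf => by
            have h1 := mem_filter.1 hf
            have h2 := hS f h1.1
            exact ⟨h2.1, h2.2.1, h1.2.1, h1.2.2.2.2⟩)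
        exact pow34 q n _ (Nat.cast_nonneg _) hq1 (by exact_mod_cast hq2)
      · have : T (P, x, i) = ∅ := by
          refine filter_eq_empty_iff.2 fun f _ hf => hgood ⟨hf.2.1, hf.2.2.1⟩
        rw [this]
        simp only [card_empty, Nat.cast_zero]
        positivity
    have h1 : (#S : ℝ) ≤ ∑ d ∈ PP ×ˢ (univ : Finset D), (#(T d) : ℝ) := by
      exact_mod_cast (card_le_card hcov).trans card_biUnion_le
    have h2 := h1.trans (sum_le_sum hT)
    have hD : (#(univ : Finset D) : ℝ) = (n : ℝ) ^ 3 * (r : ℝ) ^ 3 := by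
      simp [D, ZMod.card]
    rw [sum_const, nsmul_eq_mul, card_product, Nat.cast_mul, hD] at h2
    have h3 : (4 : ℝ) * #S ≤ 2 ^ (1 / 100 * (n : ℝ)) * (16 * (r : ℝ) ^ 3 * (n : ℝ) ^ 3) *
        (2 ^ (n : ℝ) * (2 : ℝ) ^ (-(n : ℝ) / 18)) := by
      have : (#PP : ℝ) * ((n : ℝ) ^ 3 * (r : ℝ) ^ 3) * (2 ^ n * (2 * (2 : ℝ) ^ (-(n : ℝ) / 18)))
        ≤ 2 ^ (1 / 100 * (n : ℝ)) * ((n : ℝ) ^ 3 * (r : ℝ) ^ 3) *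
          (2 ^ n * (2 * (2 : ℝ) ^ (-(n : ℝ) / 18))) := by gcongr
      rw [h2n] at this h2
      have h5 : (0 : ℝ) ≤ 2 ^ (1 / 100 * (n : ℝ)) * ((n : ℝ) ^ 3 * (r : ℝ) ^ 3) *
        (2 ^ (n : ℝ) * (2 : ℝ) ^ (-(n : ℝ) / 18)) := by positivity
      linarith
    have h4 : 2 ^ (1 / 100 * (n : ℝ)) * (16 * (r : ℝ) ^ 3 * (n : ℝ) ^ 3) *
        (2 ^ (n : ℝ) * (2 : ℝ) ^ (-(n : ℝ) / 18)) ≤ 2 ^ (1 / 100 * (n : ℝ)) * (2 : ℝ) ^ (1 / 50 * (n : ℝ)) *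
        (2 ^ (n : ℝ) * (2 : ℝ) ^ (-(n : ℝ) / 18)) := by gcongr
    have h6 := h3.trans h4
    rw [← Real.rpow_add (by norm_num), ← Real.rpow_add (by norm_num),
      ← Real.rpow_add (by norm_num)] at h6
    refine h6.trans_lt ?_
    rw [h2n]
    apply Real.rpow_lt_rpow_of_exponent_lt (by norm_num)
    linarith
  · -- smaller sets
    let pal : (ZMod n → Finset (Fin r)) → ZMod n → Finset (Fin r) := fun P y =>
      if y ∈ A then P y else {i₀}
    have hcov : S ⊆ PP.biUnion (fun P => Fintype.piFinset (pal P)) := by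
      intro f hf
      obtain ⟨h0, hR, -⟩ := hS f hf
      obtain ⟨P, hP, hfP⟩ := hPf f hR
      refine mem_biUnion.2 ⟨P, hP, Fintype.mem_piFinset.2 fun y => ?_⟩
      simp only [pal]
      split_ifs with h
      · exact hfP y h
      · simpa using h0 y h
    have h1 : #S ≤ #PP * 2 ^ #A := by
      refine (card_le_card hcov).trans (card_biUnion_le.trans ?_)
      rw [← smul_eq_mul]
      refine sum_le_card_nsmul _ _ _ fun P hP => ?_
      rw [Fintype.card_piFinset]
      have h2 : (2 : ℕ) ^ #A = ∏ y, if y ∈ A then 2 else 1 := by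
        rw [prod_ite]; simp
      rw [h2]
      refine prod_le_prod' fun y _ => ?_
      simp only [pal]
      split_ifs
      · exact hP2 P hP y
      · simp
    have h1' : (#S : ℝ) ≤ #PP * 2 ^ #A := by exact_mod_cast h1
    have h2 : (2 : ℝ) ^ #A ≤ 2 ^ (23 / 24 * (n : ℝ)) := by
      rw [← Real.rpow_natCast]
      apply Real.rpow_le_rpow_of_exponent_le (by norm_num)
      have : 24 * #A ≤ 23 * n := by omega
      have : (24 : ℝ) * #A ≤ 23 * n := by exact_mod_cast this
      linarith
    have h3 : (#S : ℝ) ≤ 2 ^ (1 / 100 * (n : ℝ)) * 2 ^ (23 / 24 * (n : ℝ)) :=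
      h1'.trans (mul_le_mul hPP h2 (by positivity) (by positivity))
    have h4 : 4 * (#S : ℝ) ≤ 2 ^ (1 / 50 * (n : ℝ)) * (2 ^ (1 / 100 * (n : ℝ)) * 2 ^ (23 / 24 * (n : ℝ))) := by
      refine mul_le_mul ?_ h3 (Nat.cast_nonneg _) (by positivity)
      rw [pow_zero] at hp'
      linarith
    rw [← Real.rpow_add (by norm_num), ← Real.rpow_add (by norm_num)] at h4
    refine h4.trans_lt ?_
    rw [h2n]
    apply Real.rpow_lt_rpow_of_exponent_lt (by norm_num)
    linarith

lemma two_part {n r : ℕ} [NeZero n] (hn : 2 ≤ n) (i₀ i₁ : Fin r) (hi : i₀ ≠ i₁)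
    (A : Finset (ZMod n)) (hA : A ≠ univ) (S G : Finset (ZMod n → Fin r))
    (hS : ∀ f ∈ S, (∀ y, y ∉ A → f y = i₀) ∧ ¬ Three A f)
    (hG : ∀ f, RFon univ f → f ∈ G) : 4 * #S + 2 ^ n ≤ 4 * #G := by
  obtain ⟨x₀, hx₀⟩ : ∃ x, x ∉ A := by
    by_contra! h
    exact hA (eq_univ_iff_forall.2 h)
  obtain ⟨a₀, ha₀, haA⟩ : ∃ a, a ≠ x₀ ∧ (A.Nonempty → a ∈ A) := by
    by_cases h : A.Nonempty
    · obtain ⟨a, ha⟩ := h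
      exact ⟨a, fun h => hx₀ (h ▸ ha), fun _ => ha⟩
    · have : Nontrivial (ZMod n) := ZMod.nontrivial_iff.2 (by omega)
      obtain ⟨a, ha⟩ := exists_ne x₀
      exact ⟨a, ha, fun h' => absurd h' h⟩
  let E : (ZMod n → Fin r) → ZMod n → Fin r := fun f y => if y ∈ A then f y else f a₀
  let pal : ZMod n → Finset (Fin r) := fun y =>
    if y = a₀ then {i₀} else if y = x₀ then {i₁} else {i₀, i₁}
  have hH : 4 * #(Fintype.piFinset pal) = 2 ^ n := by
    rw [Fintype.card_piFinset]
    have h1 : (4 : ℕ) = (∏ y : ZMod n, if y = a₀ then 2 else 1) * ∏ y : ZMod n, if y = x₀ then 2 else 1 := by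
      simp
    have h3 : (2 : ℕ) ^ n = ∏ _y : ZMod n, 2 := by simp [ZMod.card]
    rw [h1, h3, ← prod_mul_distrib, ← prod_mul_distrib]
    refine prod_congr rfl fun y _ => ?_
    simp only [pal]
    by_cases h4 : y = a₀
    · subst h4; simp [ha₀]
    · by_cases h5 : y = x₀
      · subst h5; simp [h4]
      · simp [h4, h5, card_pair hi]
  have hdisj : Disjoint (S.image E) (Fintype.piFinset pal) := by
    rw [disjoint_left]
    intro g hg hg'
    obtain ⟨f, hf, rfl⟩ := mem_image.1 hg
    rw [Fintype.mem_piFinset] at hg'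
    have h1 := hg' a₀
    have h2 := hg' x₀
    simp only [E, pal, hx₀, ha₀.symm, if_true, if_false, mem_singleton, ite_self] at h1 h2
    exact hi (h1.symm.trans h2)
  have hinj : Set.InjOn E S := by
    intro f hf g hg hfg
    funext y
    by_cases hy : y ∈ A
    · have := congrFun hfg y
      simpa [E, hy] using this
    · rw [(hS f hf).1 y hy, (hS g hg).1 y hy]
  have hsub : S.image E ∪ Fintype.piFinset pal ⊆ G := by
    intro g hg
    apply hG
    rcases mem_union.1 hg with hg | hg
    · obtain ⟨f, hf, rfl⟩ := mem_image.1 hg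
      intro x _ y _ z _ _
      by_contra! hcon
      obtain ⟨h1, h2, h3⟩ := hcon
      by_cases hAn : A.Nonempty
      · apply (hS f hf).2
        let π : ZMod n → ZMod n := fun y => if y ∈ A then y else a₀
        have hπ : ∀ y, π y ∈ A := by
          intro y
          simp only [π]
          split_ifs with h
          · exact h
          · exact haA hAn
        have hE : ∀ y, E f y = f (π y) := by
          intro y
          simp only [E, π]
          split_ifs <;> rfl
        rw [hE, hE] at h1 h2 h3
        refine ⟨fun k => π (![x, y, z] k), fun k => hπ _, ?_⟩
        intro k l hkl
        fin_cases k <;> fin_cases l <;> simp_all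
      · rw [not_nonempty_iff_eq_empty] at hAn
        exact h1 (by simp [E, hAn])
    · rw [Fintype.mem_piFinset] at hg
      have h01 : ∀ y, g y = i₀ ∨ g y = i₁ := by
        intro y
        have := hg y
        simp only [pal] at this
        split_ifs at this <;> simp at this <;> tauto
      intro x _ y _ z _ _
      rcases h01 x with h1 | h1 <;> rcases h01 y with h2 | h2 <;> rcases h01 z with h3 | h3 <;>
        simp [h1, h2, h3]
  have h := card_le_card hsub
  rw [card_union_of_disjoint hdisj, card_image_of_injOn hinj] at h
  omega

lemma main_count (r : ℕ) (hr : 3 ≤ r) : ∃ n₀ : ℕ, ∀ n : ℕ, n₀ ≤ n →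
    ∀ A : Set (ZMod n), A ≠ Set.univ → gZSub r n A < gZ r n := by
  obtain ⟨n₁, h3⟩ := three_part r ⟨0, by omega⟩
  refine ⟨max 2 n₁, fun n hn A hA => ?_⟩
  have hn2 : 2 ≤ n := (le_max_left _ _).trans hn
  haveI : NeZero n := ⟨by omega⟩
  set i₀ : Fin r := ⟨0, by omega⟩ with hi₀
  let B : Finset (ZMod n) := univ.filter (fun x => x ∈ A)
  have hBA : ∀ x, x ∈ B ↔ x ∈ A := fun x => by simp [B]
  let G : Finset (ZMod n → Fin r) := univ.filter (fun f => RFon univ f)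
  let S : Finset (ZMod n → Fin r) := univ.filter (fun f => (∀ y, y ∉ B → f y = i₀) ∧ RFon B f)
  have hGc : #G ≤ gZ r n := by
    unfold gZ
    rw [Nat.card_eq_fintype_card, ← card_univ]
    refine card_le_card_of_injOn (fun f => if h : RainbowAPFreeZ f then ⟨f, h⟩ else
      ⟨fun _ => i₀, fun _ _ _ _ _ => Or.inl rfl⟩) (fun _ _ => mem_coe.2 (mem_univ _)) ?_
    have key : ∀ f ∈ (G : Set (ZMod n → Fin r)), RainbowAPFreeZ f := by
      intro f hf x y z hxyz _
      exact (mem_filter.1 hf).2 x (mem_univ _) y (mem_univ _) z (mem_univ _) hxyz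
    intro f hf g hg hfg
    simpa [key f hf, key g hg] using hfg
  have hSc : gZSub r n A ≤ #S := by
    unfold gZSub
    rw [Nat.card_eq_fintype_card, ← card_univ]
    refine card_le_card_of_injOn (fun c y => if h : y ∈ A then c.1 ⟨y, h⟩ else i₀) ?_ ?_
    · rintro ⟨c, hc⟩ _
      refine mem_coe.2 (mem_filter.2 ⟨mem_univ _, ?_, ?_⟩)
      · intro y hy
        rw [hBA] at hy
        simp [hy]
      · intro x hx y hy z hz hxyz
        rw [hBA] at hx hy hz
        simp only [hx, hy, hz, dif_pos]
        by_cases hyx : y = x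
        · left; subst hyx; rfl
        · exact hc x y z hx hy hz hxyz hyx
    · rintro ⟨c, hc⟩ _ ⟨d, hd⟩ _ hcd
      apply Subtype.ext
      funext ⟨y, hy⟩
      have := congrFun hcd y
      simpa [hy] using this
  have hsplit := card_filter_add_card_filter_not (s := S) (fun f => Three B f)
  have hS3 := h3 n ((le_max_right _ _).trans hn) inferInstance B (S.filter (fun f => Three B f))
    (fun f hf => by
      have h1 := mem_filter.1 hf
      have h2 := (mem_filter.1 h1.1).2
      exact ⟨h2.1, h2.2, h1.2⟩)
  have hS2 := two_part hn2 i₀ ⟨1, by omega⟩ (by simp [hi₀]) B (by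
      intro h
      apply hA
      ext x
      rw [← hBA, h]; simp) (S.filter (fun f => ¬ Three B f)) G
    (fun f hf => by
      have h1 := mem_filter.1 hf
      exact ⟨(mem_filter.1 h1.1).2.1, h1.2⟩)
    (fun f hf => mem_filter.2 ⟨mem_univ _, hf⟩)
  omega

end RainbowProof

theorem stmt_5 (r : ℕ) (hr : 3 ≤ r) :
    ∃ n₀ : ℕ, ∀ n : ℕ, n₀ ≤ n → ∀ A : Set (ZMod n), A ≠ Set.univ →
      gZSub r n A < gZ r n := by
  exact main_count r hr
end

section
/- For any prime p ≥ 3 and integer r ≥ 3, we have g_r(ℤ_p) = C(r,2)·2^p − r² + 2r + r·C(r−1,2)·p·(2^{(p−1)/(c·ord_p(2))} − 2), where ord_p(2) is the multiplicative order of 2 modulo p, c = 1 if ord_p(2) is even, and c = 2 if ord_p(2) is odd; here C(m,2) = m(m−1)/2. -/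
namespace RainbowAux

/-- No three-term progression (possibly trivial) is rainbow. -/
def RF {G κ : Type*} [CommRing G] (c : G → κ) : Prop :=
  ∀ x y z : G, x + z = 2 * y → (c x = c y ∨ c y = c z ∨ c x = c z)

/-- Descent: an excursion away from a color starts and ends with the same color. -/
lemma excursion {G κ : Type*} [CommRing G] (c : G → κ) (h : RF c) :
    ∀ t : ℕ, ∀ a d : G, 1 ≤ t → c (a + ((t + 1 : ℕ) : G) * d) = c a →
      (∀ j : ℕ, 0 < j → j < t + 1 → c (a + (j : G) * d) ≠ c a) →
      c (a + d) = c (a + (t : G) * d) := by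
  intro t
  induction t using Nat.strong_induction_on with
  | _ t ih =>
  intro a d ht hX hne
  rcases Nat.eq_or_lt_of_le ht with h1 | h1
  · subst h1; simp
  have e1 : c (a + d) ≠ c a := by simpa using hne 1 (by omega) (by omega)
  have e2 : c (a + 2 * d) ≠ c a := by simpa using hne 2 (by omega) (by omega)
  have e12 : c (a + 2 * d) = c (a + d) := by
    rcases h a (a + d) (a + 2 * d) (by ring) with q | q | q
    · exact absurd q.symm e1
    · exact q.symm
    · exact absurd q.symm e2
  rcases Nat.even_or_odd' t with ⟨s, hs | hs⟩
  · -- t = 2 s, t + 1 odd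
    have k1 : c (a + ((s + 1 : ℕ) : G) * d) = c (a + d) := by
      have n1 := hne (s + 1) (by omega) (by omega)
      rcases h (a + d) (a + ((s + 1 : ℕ) : G) * d) (a + ((t + 1 : ℕ) : G) * d)
        (by subst hs; push_cast; ring) with q | q | q
      · exact q.symm
      · rw [hX] at q; exact absurd q n1
      · rw [hX] at q; exact absurd q e1
    by_contra hcon
    have k2 : c (a + ((s + 1 : ℕ) : G) * (2 * d)) = c a := by
      have hz : a + ((s + 1 : ℕ) : G) * (2 * d) = a + ((t + 2 : ℕ) : G) * d := by
        subst hs; push_cast; ring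
      rw [hz]
      by_contra hc
      have u1 : c (a + ((t + 2 : ℕ) : G) * d) = c (a + d) := by
        rcases h a (a + ((s + 1 : ℕ) : G) * d) (a + ((t + 2 : ℕ) : G) * d)
          (by subst hs; push_cast; ring) with q | q | q
        · rw [k1] at q; exact absurd q.symm e1
        · rw [← q, k1]
        · exact absurd q.symm hc
      have n2 := hne t (by omega) (by omega)
      rcases h (a + (t : G) * d) (a + ((t + 1 : ℕ) : G) * d) (a + ((t + 2 : ℕ) : G) * d)
          (by push_cast; ring) with q | q | q
      · rw [hX] at q; exact n2 q
      · rw [hX] at q; exact hc q.symm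
      · rw [u1] at q; exact hcon q.symm
    have := ih s (by omega) a (2 * d) (by omega) k2 (by
      intro j hj hj2
      have := hne (2 * j) (by omega) (by omega)
      have hz : a + (j : G) * (2 * d) = a + ((2 * j : ℕ) : G) * d := by push_cast; ring
      rwa [hz])
    apply hcon
    rw [← e12, this]
    congr 1
    subst hs; push_cast; ring
  · -- t = 2 s + 1
    have hs1 : 1 ≤ s := by omega
    have := ih s (by omega) a (2 * d) hs1 (by
      rw [← hX]; congr 1; subst hs; push_cast; ring) (by
      intro j hj hj2
      have := hne (2 * j) (by omega) (by omega)
      have hz : a + (j : G) * (2 * d) = a + ((2 * j : ℕ) : G) * d := by push_cast; ring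
      rwa [hz])
    rw [← e12, this]
    have hz : a + (s : G) * (2 * d) = a + ((2 * s : ℕ) : G) * d := by push_cast; ring
    rw [hz]
    have n1 := hne (2 * s) (by omega) (by omega)
    have n2 := hne t (by omega) (by omega)
    rcases h (a + ((2 * s : ℕ) : G) * d) (a + (t : G) * d) (a + ((t + 1 : ℕ) : G) * d)
      (by subst hs; push_cast; ring) with q | q | q
    · exact q
    · rw [hX] at q; exact absurd q n2
    · rw [hX] at q; exact absurd q n1

/-- Dominant colors for sequences. -/
lemma seq_dom (f : ℕ → Fin 3)
    (hE : ∀ m t : ℕ, 1 ≤ t → f (m + (t + 1)) = f m →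
      (∀ j : ℕ, 0 < j → j < t + 1 → f (m + j) ≠ f m) → f (m + 1) = f (m + t))
    (hs : Function.Surjective f) :
    ∃ Q, ∀ i, f i = f (i + 1) ∨ f i = Q ∨ f (i + 1) = Q := by
  classical
  have hex : ∃ n, ∀ q, ∃ i ≤ n, f i = q := by
    choose g hg using hs
    refine ⟨∑ q, g q, fun q => ⟨g q, ?_, hg q⟩⟩
    exact Finset.single_le_sum (f := g) (fun _ _ => Nat.zero_le _) (Finset.mem_univ q)
  obtain ⟨n, hn, hmin⟩ : ∃ n, (∀ q, ∃ i ≤ n, f i = q) ∧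
      ∀ m < n, ¬ (∀ q, ∃ i ≤ m, f i = q) :=
    ⟨Nat.find hex, Nat.find_spec hex, fun m hm => Nat.find_min hex hm⟩
  have hn0 : n ≠ 0 := by
    rintro rfl
    obtain ⟨i, hi, hi'⟩ := hn 0
    obtain ⟨j, hj, hj'⟩ := hn 1
    have : i = j := by omega
    rw [this, hj'] at hi'
    exact absurd hi' (by decide)
  obtain ⟨k, rfl⟩ := Nat.exists_eq_succ_of_ne_zero hn0
  have hk := hmin k (by simp)
  push Not at hk
  obtain ⟨R, hR⟩ := hk
  have hfR : ∀ i ≤ k, f i ≠ R := hR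
  refine ⟨f k, ?_⟩
  intro i
  induction i using Nat.strong_induction_on with
  | _ i ih =>
  rcases lt_trichotomy i k with hlt | heq | hgt
  · have a1 := hfR i (by omega)
    have a2 := hfR (i + 1) (by omega)
    have a3 := hfR k le_rfl
    generalize f i = x at *
    generalize f (i + 1) = y at *
    generalize f k = z at *
    clear ih hR hmin hn hs hE hex hfR
    revert x y z R
    decide
  · right; left; rw [heq]
  · by_contra hcon
    push Not at hcon
    obtain ⟨c1, c2, c3⟩ := hcon
    -- last occurrence of f (i+1)
    obtain ⟨m0, hm0, hm0'⟩ := hn (f (i + 1))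
    have hm0i : m0 ≤ i := by simp at hm0; omega
    let P : ℕ → Prop := fun m => f m = f (i + 1)
    have hspec : P (Nat.findGreatest P i) := Nat.findGreatest_spec (P := P) hm0i hm0'
    have hle : Nat.findGreatest P i ≤ i := Nat.findGreatest_le i
    have hgr : ∀ j, Nat.findGreatest P i < j → j ≤ i → ¬ P j := fun j h1 h2 =>
      Nat.findGreatest_is_greatest h1 h2
    generalize Nat.findGreatest P i = m at *
    simp only [P] at *
    have hmi : m < i := lt_of_le_of_ne hle (by rintro rfl; exact c1 hspec)
    have hm1 : f (m + 1) = f k := by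
      rcases ih m hmi with q | q | q
      · exact absurd (q.symm.trans hspec) (hgr (m + 1) (by omega) (by omega))
      · exact absurd (hspec.symm.trans q) c3
      · exact q
    have := hE m (i - m) (by omega) (by rw [hspec]; congr 1; omega) (by
      intro j hj hj2
      rw [hspec]
      exact hgr (m + j) (by omega) (by omega))
    rw [hm1, show m + (i - m) = i by omega] at this
    exact c2 this.symm

section prime
variable {p : ℕ} [hp : Fact p.Prime]

lemma closed_univ (S : Finset (ZMod p)) (hS : S.Nonempty) (e : ZMod p) (he : e ≠ 0)
    (h : ∀ x ∈ S, x + e ∈ S) (y : ZMod p) : y ∈ S := by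
  obtain ⟨x, hx⟩ := hS
  have h2 : ∀ n : ℕ, x + (n : ZMod p) * e ∈ S := by
    intro n
    induction n with
    | zero => simpa using hx
    | succ n ih =>
      have := h _ ih
      have hz : x + ((n + 1 : ℕ) : ZMod p) * e = x + (n : ZMod p) * e + e := by push_cast; ring
      rwa [hz]
  have := h2 ((y - x) / e).val
  rw [ZMod.natCast_zmod_val, div_mul_cancel₀ _ he] at this
  simpa using this

lemma dom (c : ZMod p → Fin 3) (h : RF c) (hs : Function.Surjective c) (d : ZMod p) (hd : d ≠ 0) :
    ∃ Q, ∀ y, c y = c (y + d) ∨ c y = Q ∨ c (y + d) = Q := by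
  have hcov : ∀ y : ZMod p, ∃ n : ℕ, (n : ZMod p) * d = y := fun y =>
    ⟨(y / d).val, by rw [ZMod.natCast_zmod_val, div_mul_cancel₀ _ hd]⟩
  obtain ⟨Q, hQ⟩ := seq_dom (fun i => c ((i : ZMod p) * d)) (by
    intro m t ht h1 h2
    have := excursion c h t ((m : ZMod p) * d) d ht (by
      rw [← h1]; congr 1; push_cast; ring) (by
      intro j hj hj2
      have := h2 j hj hj2
      have hz : (m : ZMod p) * d + (j : ZMod p) * d = ((m + j : ℕ) : ZMod p) * d := by
        push_cast; ring
      rwa [hz])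
    convert this using 2 <;> · push_cast; ring) (by
    intro q
    obtain ⟨y, rfl⟩ := hs q
    obtain ⟨n, rfl⟩ := hcov y
    exact ⟨n, rfl⟩)
  refine ⟨Q, fun y => ?_⟩
  obtain ⟨n, rfl⟩ := hcov y
  have := hQ n
  have hz : (n : ZMod p) * d + d = ((n + 1 : ℕ) : ZMod p) * d := by push_cast; ring
  rw [hz]; exact this

open Pointwise in
/-- Special case of Vosper for symmetric, doubling-closed sets. -/
lemma no_tight (hp2 : p ≠ 2) (K : Finset (ZMod p)) (h0 : 0 ∈ K) (hneg : ∀ x ∈ K, -x ∈ K)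
    (hdbl : ∀ x ∈ K, 2 * x ∈ K) (hK2 : 2 ≤ K.card) :
    ∀ n : ℕ, ∀ C : Finset (ZMod p), C.card = n → 2 ≤ C.card → 2 * C.card + K.card ≤ p + 1 →
      (C + K).card < C.card + K.card → False := by
  have h20 : (2 : ZMod p) ≠ 0 := by
    intro h
    have : ((2 : ℕ) : ZMod p) = 0 := by exact_mod_cast h
    rw [ZMod.natCast_eq_zero_iff] at this
    exact hp2 ((Nat.prime_dvd_prime_iff_eq hp.out Nat.prime_two).mp this)
  intro n
  induction n using Nat.strong_induction_on with
  | _ n ih =>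
  intro C hCn hC2 hbound htight
  have hrefl : ∀ f1 ∈ C, ∀ f2 ∈ C, f1 ≠ f2 → ∀ x ∈ C, f1 + f2 - x ∈ C := by
    intro f1 hf1 f2 hf2 hne
    set G := C.image (fun x => f1 + f2 - x) with hG
    have hGc : G.card = C.card := Finset.card_image_of_injective _ (fun a b hab => by
      simpa using hab)
    have hGK : G + K = (C + K).image (fun x => f1 + f2 - x) := by
      ext y
      simp only [hG, Finset.mem_add, Finset.mem_image]
      constructor
      · rintro ⟨_, ⟨a, ha, rfl⟩, k, hk, rfl⟩
        exact ⟨a + -k, ⟨a, ha, -k, hneg k hk, rfl⟩, by ring⟩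
      · rintro ⟨_, ⟨a, ha, k, hk, rfl⟩, rfl⟩
        exact ⟨_, ⟨a, ha, rfl⟩, -k, hneg k hk, by ring⟩
    have hGKc : (G + K).card = (C + K).card := by
      rw [hGK]
      exact Finset.card_image_of_injective _ (fun a b hab => by simpa using hab)
    have hinter : ({f1, f2} : Finset (ZMod p)) ⊆ C ∩ G := by
      intro x hx
      simp only [Finset.mem_insert, Finset.mem_singleton] at hx
      simp only [Finset.mem_inter, hG, Finset.mem_image]
      rcases hx with rfl | rfl
      · exact ⟨hf1, f2, hf2, by ring⟩
      · exact ⟨hf2, f1, hf1, by ring⟩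
    have hinter2 : 2 ≤ (C ∩ G).card := by
      rw [← Finset.card_pair hne]; exact Finset.card_le_card hinter
    have hui := Finset.card_union_add_card_inter C G
    have hui2 := Finset.card_union_add_card_inter (C + K) (G + K)
    rw [← Finset.union_add] at hui2
    have hsub : ((C ∩ G) + K).card ≤ ((C + K) ∩ (G + K)).card :=
      Finset.card_le_card Finset.inter_add_subset
    have hcd := ZMod.cauchy_davenport hp.out (s := C ∪ G) (t := K)
      ⟨f1, Finset.mem_union_left _ hf1⟩ ⟨0, h0⟩
    have hmin : min p ((C ∪ G).card + K.card - 1) = (C ∪ G).card + K.card - 1 := by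
      apply min_eq_right; omega
    rw [hmin] at hcd
    have hge : C.card ≤ (C ∩ G).card := by
      by_contra hlt
      push Not at hlt
      exact ih _ (hCn ▸ hlt) (C ∩ G) rfl hinter2 (by omega) (by omega)
    have heq : C ∩ G = C := Finset.eq_of_subset_of_card_le Finset.inter_subset_left hge
    intro x hx
    have hCG : C ⊆ G := Finset.inter_eq_left.mp heq
    have hx2 := hCG hx
    simp only [hG, Finset.mem_image] at hx2
    obtain ⟨y, hy, rfl⟩ := hx2
    simpa using hy
  have hcardC : C.card = 2 := by
    by_contra hne
    obtain ⟨f1, f2, f3, hf1, hf2, hf3, h12, h13, h23⟩ :=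
      Finset.two_lt_card_iff.mp (show 2 < C.card by omega)
    have hall := closed_univ C ⟨f1, hf1⟩ (f2 - f3) (sub_ne_zero.mpr h23) (by
      intro x hx
      have := hrefl f1 hf1 f2 hf2 h12 _ (hrefl f1 hf1 f3 hf3 h13 x hx)
      convert this using 1; ring)
    have : C = Finset.univ := by ext; simp [hall]
    rw [this, Finset.card_univ, ZMod.card] at hbound
    have := hp.out.two_le
    omega
  obtain ⟨f1, f2, hne, rfl⟩ := Finset.card_eq_two.mp hcardC
  obtain ⟨e, rfl⟩ : ∃ e, f2 = f1 + e := ⟨f2 - f1, by ring⟩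
  have he : e ≠ 0 := by rintro rfl; simp at hne
  -- unique exit
  have huniq : ∀ x ∈ K, ∀ y ∈ K, x + e ∉ K → y + e ∉ K → x = y := by
    intro x hx y hy hx' hy'
    by_contra hxy
    have hsub : (insert (x + e) (insert (y + e) K)).image (fun z => f1 + z) ⊆ {f1, f1 + e} + K := by
      intro z hz
      simp only [Finset.mem_image, Finset.mem_insert] at hz
      rw [Finset.mem_add]
      obtain ⟨w, rfl | rfl | hw, rfl⟩ := hz
      · exact ⟨f1 + e, by simp, x, hx, by ring⟩
      · exact ⟨f1 + e, by simp, y, hy, by ring⟩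
      · exact ⟨f1, by simp, w, hw, rfl⟩
    have hc := Finset.card_le_card hsub
    rw [Finset.card_image_of_injective _ (add_right_injective f1),
      Finset.card_insert_of_notMem (by simp [hx', hxy]),
      Finset.card_insert_of_notMem hy'] at hc
    omega
  have hex : ∃ k ∈ K, k + e ∉ K := by
    by_contra hcon
    push Not at hcon
    have hall := closed_univ K ⟨0, h0⟩ e he hcon
    have : K = Finset.univ := by ext; simp [hall]
    rw [this, Finset.card_univ, ZMod.card] at hbound
    omega
  obtain ⟨k, hk, hke⟩ := hex
  have hhalf : ∀ x ∈ K, ∃ y ∈ K, 2 * y = x := by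
    have : K.image (fun x => 2 * x) = K := by
      apply Finset.eq_of_subset_of_card_le
      · intro z hz
        obtain ⟨w, hw, rfl⟩ := Finset.mem_image.mp hz
        exact hdbl w hw
      · rw [Finset.card_image_of_injective _ (mul_right_injective₀ h20)]
    intro x hx
    rw [← this] at hx
    simpa using hx
  have hkm : k - e ∉ K := by
    intro hkm
    obtain ⟨y, hy, hy2⟩ := hhalf _ hkm
    have hye : y + e ∉ K := by
      intro hc
      apply hke
      have := hdbl _ hc
      have hz : 2 * (y + e) = k + e := by linear_combination hy2
      rwa [hz] at this
    have := huniq y hy k hk hye hke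
    subst this
    have hz : y + e = 0 := by linear_combination hy2
    rw [hz] at hke
    exact hke h0
  have hk0 : k = 0 := by
    have h1 : -k + e ∉ K := by
      intro hc
      apply hkm
      have := hneg _ hc
      have hz : -(-k + e) = k - e := by ring
      rwa [hz] at this
    have := huniq (-k) (hneg k hk) k hk h1 hke
    have h2 : 2 * k = 0 := by linear_combination -this
    rcases mul_eq_zero.mp h2 with h | h
    · exact absurd h h20
    · exact h
  subst hk0
  have hne' : (K.erase 0).Nonempty := by
    rw [← Finset.card_pos, Finset.card_erase_of_mem h0]; omega
  have := closed_univ (K.erase 0) hne' e he (by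
    intro x hx
    rw [Finset.mem_erase] at hx ⊢
    constructor
    · intro hc
      apply hkm
      have hz : 0 - e = x := by linear_combination -hc
      rw [hz]; exact hx.2
    · by_contra hc
      exact hx.1 (huniq x hx.2 0 h0 hc hke)) 0
  simp at this

end prime
end RainbowAux

namespace RainbowAux
section prime2
variable {p : ℕ} [hp : Fact p.Prime]

lemma two_ne (hp2 : p ≠ 2) : (2 : ZMod p) ≠ 0 := by
  intro h
  have : ((2 : ℕ) : ZMod p) = 0 := by exact_mod_cast h
  rw [ZMod.natCast_eq_zero_iff] at this
  exact hp2 ((Nat.prime_dvd_prime_iff_eq hp.out Nat.prime_two).mp this)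

open Pointwise in
/-- A rainbow-free coloring with three colors has a singleton color class. -/
lemma singleton3 (hp2 : p ≠ 2) (c : ZMod p → Fin 3) (h : RF c) (hs : Function.Surjective c) :
    ∃ x, ∀ y, c y = c x → y = x := by
  classical
  let K : Fin 3 → Finset (ZMod p) := fun q =>
    Finset.univ.filter (fun d => ∀ y, c y = c (y + d) ∨ c y = q ∨ c (y + d) = q)
  let L : Fin 3 → Finset (ZMod p) := fun q => Finset.univ.filter (fun y => c y = q)
  have hK : ∀ q d, d ∈ K q ↔ ∀ y, c y = c (y + d) ∨ c y = q ∨ c (y + d) = q := by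
    intro q d; simp [K]
  have hL : ∀ q y, y ∈ L q ↔ c y = q := by intro q d; simp [L]
  have h0 : ∀ q, 0 ∈ K q := by intro q; rw [hK]; intro y; left; simp
  have hneg : ∀ q, ∀ x ∈ K q, -x ∈ K q := by
    intro q x hx
    rw [hK] at hx ⊢
    intro y
    have := hx (y + -x)
    simp only [neg_add_cancel_right] at this
    tauto
  have hdbl : ∀ q, ∀ x ∈ K q, 2 * x ∈ K q := by
    intro q x hx
    rw [hK] at hx ⊢
    intro y
    have h1 := hx y
    have h2 := hx (y + x)
    have hz : y + x + x = y + 2 * x := by ring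
    rw [hz] at h2
    have h3 := h y (y + x) (y + 2 * x) (by ring)
    by_contra hcon
    push Not at hcon
    obtain ⟨a, b, e⟩ := hcon
    rcases h3 with h3 | h3 | h3
    · rcases h2 with h2 | h2 | h2
      · exact a (h3.trans h2)
      · exact b (h3.trans h2)
      · exact e h2
    · rcases h1 with h1 | h1 | h1
      · exact a (h1.trans h3)
      · exact b h1
      · exact e (h3.symm.trans h1)
    · exact a h3
  have hLne : ∀ q, (L q).Nonempty := by
    intro q
    obtain ⟨y, hy⟩ := hs q
    exact ⟨y, (hL q y).mpr hy⟩
  have hsumL : (L 0).card + (L 1).card + (L 2).card = p := by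
    have := Finset.card_eq_sum_card_fiberwise (s := (Finset.univ : Finset (ZMod p)))
      (t := (Finset.univ : Finset (Fin 3))) (f := c) (by intro x _; simp)
    rw [Finset.card_univ, ZMod.card, Fin.sum_univ_three] at this
    exact this.symm
  have hsub : ∀ q q', q' ≠ q → L q' + K q ⊆ L q' ∪ L q := by
    intro q q' hq z hz
    obtain ⟨y, hy, d, hd, rfl⟩ := Finset.mem_add.mp hz
    rw [hL] at hy
    rw [hK] at hd
    rw [Finset.mem_union, hL, hL]
    rcases hd y with a | a | a
    · left; rw [← a, hy]
    · exact absurd (hy.symm.trans a) hq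
    · right; exact a
  have hcardsub : ∀ q q', q' ≠ q → (L q' + K q).card ≤ (L q').card + (L q).card := by
    intro q q' hq
    exact (Finset.card_le_card (hsub q q' hq)).trans (Finset.card_union_le _ _)
  have hpos : ∀ q, 0 < (L q).card := fun q => (hLne q).card_pos
  have hlt : ∀ q q', q' ≠ q → (L q').card + (L q).card < p := by
    intro q q' hq
    have a0 := hpos 0
    have a1 := hpos 1
    have a2 := hpos 2
    fin_cases q <;> fin_cases q' <;> first | (exact absurd rfl hq) | (simp; omega)
  have hKle : ∀ q, (K q).card ≤ (L q).card + 1 := by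
    intro q
    obtain ⟨q', hq⟩ : ∃ q', q' ≠ q := exists_ne q
    have hcd := ZMod.cauchy_davenport hp.out (hLne q') ⟨0, h0 q⟩
    have a1 := hcardsub q q' hq
    have a2 := hlt q q' hq
    have a3 := hpos q'
    rcases min_le_iff.mp (hcd.trans a1) with b | b
    · omega
    · omega
  have hcov : p + 2 ≤ (K 0).card + (K 1).card + (K 2).card := by
    have hc : (Finset.univ : Finset (ZMod p)).erase 0 ⊆
        ((K 0).erase 0 ∪ (K 1).erase 0) ∪ (K 2).erase 0 := by
      intro d hd
      have hd0 : d ≠ 0 := (Finset.mem_erase.mp hd).1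
      obtain ⟨Q, hQ⟩ := dom c h hs d hd0
      have : d ∈ K Q := (hK Q d).mpr hQ
      simp only [Finset.mem_union, Finset.mem_erase]
      fin_cases Q
      · left; left; exact ⟨hd0, this⟩
      · left; right; exact ⟨hd0, this⟩
      · right; exact ⟨hd0, this⟩
    have h1 := Finset.card_le_card hc
    have h2 := Finset.card_union_le ((K 0).erase 0 ∪ (K 1).erase 0) ((K 2).erase 0)
    have h3 := Finset.card_union_le ((K 0).erase 0) ((K 1).erase 0)
    have e0 := Finset.card_erase_add_one (h0 0)
    have e1 := Finset.card_erase_add_one (h0 1)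
    have e2 := Finset.card_erase_add_one (h0 2)
    have e3 := Finset.card_erase_add_one (Finset.mem_univ (0 : ZMod p))
    rw [Finset.card_univ, ZMod.card] at e3
    omega
  by_contra hcon
  have hbig : ∀ q, 2 ≤ (L q).card := by
    intro q
    by_contra hb
    have h1 : (L q).card = 1 := by have := hpos q; omega
    obtain ⟨x, hx⟩ := Finset.card_eq_one.mp h1
    apply hcon
    refine ⟨x, fun y hy => ?_⟩
    have hxx : c x = q := by rw [← hL, hx]; simp
    have : y ∈ L q := by rw [hL, hy, hxx]
    rw [hx] at this
    simpa using this
  have key : ∀ q q', q' ≠ q → (K q).card = (L q).card + 1 → 2 * (L q').card + (L q).card ≤ p →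
      False := by
    intro q q' hq h1 h2
    have a1 := hbig q
    have a2 := hcardsub q q' hq
    exact no_tight hp2 (K q) (h0 q) (hneg q) (hdbl q) (by omega) _ (L q') rfl (hbig q')
      (by omega) (by omega)
  have k0 := hKle 0
  have k1 := hKle 1
  have k2 := hKle 2
  have hcase : (K 0).card = (L 0).card + 1 ∨ (K 1).card = (L 1).card + 1 ∨
      (K 2).card = (L 2).card + 1 := by omega
  rcases hcase with hc | hc | hc
  · rcases le_total (L 1).card (L 2).card with hl | hl
    · exact key 0 1 (by decide) hc (by omega)
    · exact key 0 2 (by decide) hc (by omega)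
  · rcases le_total (L 0).card (L 2).card with hl | hl
    · exact key 1 0 (by decide) hc (by omega)
    · exact key 1 2 (by decide) hc (by omega)
  · rcases le_total (L 0).card (L 1).card with hl | hl
    · exact key 2 0 (by decide) hc (by omega)
    · exact key 2 1 (by decide) hc (by omega)

lemma RF.comp {G κ μ : Type*} [CommRing G] {c : G → κ} (h : RF c) (π : κ → μ) :
    RF (fun y => π (c y)) := by
  intro x y z hxyz
  rcases h x y z hxyz with a | a | a
  · left; simp only [a]
  · right; left; simp only [a]
  · right; right; simp only [a]

lemma uniq_exists (hp2 : p ≠ 2) {r : ℕ} (c : ZMod p → Fin r) (h : RF c)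
    (a b e : ZMod p) (hab : c a ≠ c b) (hae : c a ≠ c e) (hbe : c b ≠ c e) :
    ∃ x, ∀ y, (if c y = c a then (0 : Fin 3) else if c y = c b then 1 else 2) =
      (if c x = c a then (0 : Fin 3) else if c x = c b then 1 else 2) → y = x := by
  apply singleton3 hp2 (fun y => if c y = c a then (0 : Fin 3) else if c y = c b then 1 else 2)
    (h.comp (fun v => if v = c a then (0 : Fin 3) else if v = c b then 1 else 2))
  intro q
  fin_cases q
  · exact ⟨a, by simp⟩
  · exact ⟨b, by simp [hab.symm]⟩
  · exact ⟨e, by simp [hae.symm, hbe.symm]⟩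

lemma inv_two (hp2 : p ≠ 2) {κ : Type*} (c : ZMod p → κ) (h : RF c) (x : ZMod p)
    (hx : ∀ y, c y = c x → y = x) (u : ZMod p) : c (x + 2 * u) = c (x + u) := by
  by_cases hu : u = 0
  · simp [hu]
  rcases h x (x + u) (x + 2 * u) (by ring) with a | a | a
  · have := hx _ a.symm
    simp at this; exact absurd this hu
  · exact a.symm
  · have := hx _ a.symm
    simp [two_ne hp2] at this; exact absurd this hu

lemma inv_neg {κ : Type*} (c : ZMod p → κ) (h : RF c) (x : ZMod p)
    (hx : ∀ y, c y = c x → y = x) (u : ZMod p) : c (x + -u) = c (x + u) := by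
  by_cases hu : u = 0
  · simp [hu]
  rcases h (x + u) x (x + -u) (by ring) with a | a | a
  · have := hx _ a
    simp at this; exact absurd this hu
  · have := hx _ a.symm
    simp at this; exact absurd this hu
  · exact a.symm

lemma refl_ne (hp2 : p ≠ 2) {κ : Type*} (c : ZMod p → κ) (h : RF c) (x : ZMod p)
    (hx : ∀ y, c y = c x → y = x) (x' : ZMod p) (hne : x' ≠ x) : ∃ y ≠ x', c y = c x' := by
  refine ⟨x + -(x' - x), ?_, ?_⟩
  · intro hc
    have : 2 * (x' - x) = 0 := by linear_combination -hc
    rcases mul_eq_zero.mp this with a | a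
    · exact two_ne hp2 a
    · exact hne (sub_eq_zero.mp a)
  · rw [inv_neg c h x hx]; congr 1; ring

lemma exists_uniq (hp2 : p ≠ 2) {r : ℕ} (c : ZMod p → Fin r) (h : RF c)
    (h3 : 3 ≤ (Finset.univ.image c).card) : ∃ x, ∀ y, c y = c x → y = x := by
  obtain ⟨i, j, k, hi, hj, hk, hij, hik, hjk⟩ := Finset.two_lt_card_iff.mp h3
  obtain ⟨a, -, rfl⟩ := Finset.mem_image.mp hi
  obtain ⟨b, -, rfl⟩ := Finset.mem_image.mp hj
  obtain ⟨e, -, rfl⟩ := Finset.mem_image.mp hk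
  obtain ⟨x, hx⟩ := uniq_exists hp2 c h a b e hij hik hjk
  exact ⟨x, fun y hy => hx y (by rw [hy])⟩

lemma card_three (hp2 : p ≠ 2) {r : ℕ} (c : ZMod p → Fin r) (h : RF c)
    (h3 : 3 ≤ (Finset.univ.image c).card) : (Finset.univ.image c).card = 3 := by
  by_contra hne
  obtain ⟨x, hx⟩ := exists_uniq hp2 c h h3
  have hmem : c x ∈ Finset.univ.image c := Finset.mem_image_of_mem _ (Finset.mem_univ _)
  have h4 : 2 < ((Finset.univ.image c).erase (c x)).card := by
    rw [Finset.card_erase_of_mem hmem]; omega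
  obtain ⟨i, j, k, hi, hj, hk, hij, hik, hjk⟩ := Finset.two_lt_card_iff.mp h4
  rw [Finset.mem_erase] at hi hj hk
  obtain ⟨a, -, rfl⟩ := Finset.mem_image.mp hi.2
  obtain ⟨b, -, rfl⟩ := Finset.mem_image.mp hj.2
  obtain ⟨e, -, rfl⟩ := Finset.mem_image.mp hk.2
  obtain ⟨x', hx'⟩ := uniq_exists hp2 c h a b e hij hik hjk
  have hxx : x' ≠ x → False := by
    intro hc
    obtain ⟨y, hy, hy'⟩ := refl_ne hp2 c h x hx x' hc
    exact hy (hx' y (by rw [hy']))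
  by_cases hc : x' = x
  · subst hc
    have := hx' e (by simp [hik.symm, hjk.symm, hi.1.symm, hj.1.symm])
    rw [this] at hk
    exact hk.1 rfl
  · exact hxx hc

end prime2

lemma count_image {α β : Type*} [Fintype α] [DecidableEq α] [Nonempty α] [Fintype β]
    [DecidableEq β] (s : Finset β) :
    (((Finset.univ : Finset (α → β)).filter
      (fun f => Finset.univ.image f ∈ s.powersetCard 2)).card : ℤ) =
      (s.card.choose 2 : ℤ) * (2 ^ Fintype.card α - 2) := by
  classical
  rw [Finset.card_eq_sum_card_fiberwise (f := fun f => Finset.univ.image f)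
    (t := s.powersetCard 2) (by intro f hf; simpa using hf)]
  have : ∀ t ∈ s.powersetCard 2, ((((Finset.univ : Finset (α → β)).filter
      (fun f => Finset.univ.image f ∈ s.powersetCard 2)).filter
        (fun f => Finset.univ.image f = t)).card : ℤ) = 2 ^ Fintype.card α - 2 := by
    intro t ht
    have ht2 := (Finset.mem_powersetCard.mp ht).2
    obtain ⟨a, b, hab, rfl⟩ := Finset.card_eq_two.mp ht2
    have e1 : ((Finset.univ : Finset (α → β)).filter
      (fun f => Finset.univ.image f ∈ s.powersetCard 2)).filter
        (fun f => Finset.univ.image f = {a, b}) =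
        (Fintype.piFinset (fun _ : α => ({a, b} : Finset β))) \
          {(fun _ => a), (fun _ => b)} := by
      ext f
      simp only [Finset.mem_filter, Finset.mem_univ, true_and, Finset.mem_sdiff,
        Fintype.mem_piFinset, Finset.mem_insert, Finset.mem_singleton]
      constructor
      · rintro ⟨-, hf⟩
        refine ⟨fun x => ?_, ?_⟩
        · have : f x ∈ Finset.univ.image f := Finset.mem_image_of_mem _ (Finset.mem_univ _)
          rw [hf] at this; simpa using this
        · have ha : a ∈ Finset.univ.image f := by rw [hf]; simp
          have hb : b ∈ Finset.univ.image f := by rw [hf]; simp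
          rintro (rfl | rfl)
          · simp at hb; exact hab hb
          · simp at ha; exact hab ha.symm
      · rintro ⟨hf, hn⟩
        push Not at hn
        have him : Finset.univ.image f = {a, b} := by
          apply Finset.Subset.antisymm
          · intro y hy
            obtain ⟨x, -, rfl⟩ := Finset.mem_image.mp hy
            simpa using hf x
          · intro y hy
            simp only [Finset.mem_insert, Finset.mem_singleton] at hy
            simp only [Finset.mem_image, Finset.mem_univ, true_and]
            by_contra hcon
            push Not at hcon
            rcases hy with rfl | rfl
            · exact hn.2 (funext fun x => (hf x).resolve_left (hcon x))
            · exact hn.1 (funext fun x => (hf x).resolve_right (hcon x))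
        exact ⟨by rw [him]; exact ht, him⟩
    rw [e1, Finset.card_sdiff_of_subset, Fintype.card_piFinset]
    · have hne : (fun _ : α => a) ≠ (fun _ => b) := by
        intro hc; exact hab (congrFun hc (Classical.arbitrary α))
      simp only [Finset.card_pair hab, Finset.card_pair hne, Finset.prod_const, Finset.card_univ]
      have : 2 ≤ 2 ^ Fintype.card α := by
        calc 2 = 2 ^ 1 := rfl
          _ ≤ _ := Nat.pow_le_pow_right (by norm_num) Fintype.card_pos
      push_cast [Nat.cast_sub this]; rfl
    · intro f hf
      simp only [Finset.mem_insert, Finset.mem_singleton] at hf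
      rcases hf with rfl | rfl <;> simp
  push_cast
  rw [Finset.sum_congr rfl this]
  rw [Finset.sum_const, Finset.card_powersetCard, nsmul_eq_mul]

section prime3
variable {p : ℕ} [hp : Fact p.Prime]

lemma exists_w (hp2 : p ≠ 2) : ∃ w : (ZMod p)ˣ, ((w : ZMod p) = 2 ∨ (w : ZMod p) = -2) ∧
    (-1 : (ZMod p)ˣ) ∈ Subgroup.zpowers w ∧
    Units.mk0 (2 : ZMod p) (two_ne hp2) ∈ Subgroup.zpowers w ∧
    orderOf w = (if Even (orderOf (2 : ZMod p)) then 1 else 2) * orderOf (2 : ZMod p) := by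
  set v : (ZMod p)ˣ := Units.mk0 (2 : ZMod p) (two_ne hp2) with hv
  have hvo : orderOf v = orderOf (2 : ZMod p) := by
    rw [← orderOf_units]; rfl
  rw [← hvo]
  have hm1 : (-1 : (ZMod p)ˣ) ≠ 1 := by
    intro hc
    have : ((-1 : (ZMod p)ˣ) : ZMod p) = 1 := by rw [hc]; rfl
    simp only [Units.val_neg, Units.val_one] at this
    exact two_ne hp2 (by linear_combination -this)
  by_cases he : Even (orderOf v)
  · refine ⟨v, Or.inl rfl, ?_, Subgroup.mem_zpowers v, by simp [he]⟩
    obtain ⟨n, hn⟩ := he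
    have hpos : 0 < orderOf v := orderOf_pos v
    have h1 : v ^ n ≠ 1 := pow_ne_one_of_lt_orderOf (by omega) (by omega)
    have h2 : (v ^ n) * (v ^ n) = 1 := by rw [← pow_add, ← hn, pow_orderOf_eq_one]
    have h3 : ((v ^ n : (ZMod p)ˣ) : ZMod p) * ((v ^ n : (ZMod p)ˣ) : ZMod p) = 1 := by
      rw [← Units.val_mul, h2]; rfl
    have h4 : v ^ n = -1 := by
      rcases mul_self_eq_one_iff.mp h3 with a | a
      · exact absurd (Units.ext a) h1
      · apply Units.ext; rw [a]; simp
    rw [← h4]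
    exact Subgroup.pow_mem _ (Subgroup.mem_zpowers v) n
  · have ho : Odd (orderOf v) := Nat.not_even_iff_odd.mp he
    have hmem : (-1 : (ZMod p)ˣ) ∈ Subgroup.zpowers (-v) := by
      have : (-v) ^ (orderOf v) = -1 := by rw [ho.neg_pow, pow_orderOf_eq_one]
      rw [← this]
      exact Subgroup.pow_mem _ (Subgroup.mem_zpowers _) _
    refine ⟨-v, Or.inr (by simp [hv]), hmem, ?_, ?_⟩
    · have := Subgroup.mul_mem _ hmem (Subgroup.mem_zpowers (-v))
      simpa using this
    · have h2 : orderOf (-1 : (ZMod p)ˣ) = 2 := orderOf_eq_prime (by simp) hm1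
      have := (Commute.all (-1 : (ZMod p)ˣ) v).orderOf_mul_eq_mul_orderOf_of_coprime (by
        rw [h2]; exact (Nat.coprime_two_left).mpr ho)
      rw [h2] at this
      simpa [he] using this

lemma inv_zpowers {κ : Type*} (f : (ZMod p)ˣ → κ) (w : (ZMod p)ˣ)
    (hw : ∀ u, f (u * w) = f u) (u h : (ZMod p)ˣ) (hh : h ∈ Subgroup.zpowers w) :
    f (u * h) = f u := by
  rw [← mem_powers_iff_mem_zpowers] at hh
  obtain ⟨n, rfl⟩ := hh
  simp only
  induction n with
  | zero => simp
  | succ n ih => rw [pow_succ, ← mul_assoc, hw, ih]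

lemma pigeon {κ : Type*} [DecidableEq κ] (s : Finset κ) (hs : s.card ≤ 2) (a b e : κ) (ha : a ∈ s)
    (hb : b ∈ s) (he : e ∈ s) : a = b ∨ b = e ∨ a = e := by
  by_contra hc
  push Not at hc
  have := Finset.two_lt_card_iff.mpr ⟨a, b, e, ha, hb, he, hc.1, hc.2.2, hc.2.1⟩
  omega

open Classical in
/-- The rainbow-free colorings with at least three colors, with singleton class `{x}` of
color `i`. -/
noncomputable def T (p r : ℕ) [Fact p.Prime] (x : ZMod p) (i : Fin r) :
    Finset (ZMod p → Fin r) :=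
  Finset.univ.filter (fun c => RF c ∧ 3 ≤ (Finset.univ.image c).card ∧ c x = i ∧
    ∀ y, c y = i → y = x)

open Classical in
lemma card_T (hp2 : p ≠ 2) {r : ℕ} (x : ZMod p) (i : Fin r) :
    ((T p r x i).card : ℤ) = ((r - 1).choose 2 : ℤ) *
      (2 ^ ((p - 1) / ((if Even (orderOf (2 : ZMod p)) then 1 else 2) *
            orderOf (2 : ZMod p))) - 2) := by
  obtain ⟨w, hw, hm1, hm2, hwo⟩ := exists_w hp2
  rw [← hwo]
  set H := Subgroup.zpowers w with hH
  have hQ : Fintype.card ((ZMod p)ˣ ⧸ H) = (p - 1) / orderOf w := by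
    have h1 := Subgroup.card_eq_card_quotient_mul_card_subgroup H
    rw [Nat.card_eq_fintype_card, ZMod.card_units, Nat.card_zpowers] at h1
    rw [h1, Nat.mul_div_cancel _ (orderOf_pos w), Nat.card_eq_fintype_card]
  have hcount := count_image (α := (ZMod p)ˣ ⧸ H) ((Finset.univ : Finset (Fin r)).erase i)
  rw [Finset.card_erase_of_mem (Finset.mem_univ i), Finset.card_univ, Fintype.card_fin, hQ]
    at hcount
  rw [← hcount]
  let Φ : ((ZMod p)ˣ ⧸ H → Fin r) → (ZMod p → Fin r) := fun g y =>
    if hy : y - x = 0 then i else g (QuotientGroup.mk (Units.mk0 (y - x) hy))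
  have hΦx : ∀ g, Φ g x = i := by intro g; simp [Φ]
  have hΦu : ∀ g (u : (ZMod p)ˣ), Φ g (x + u) = g (QuotientGroup.mk u) := by
    intro g u
    have : x + (u : ZMod p) - x ≠ 0 := by simp
    simp only [Φ, dif_neg this]
    congr 2
    ext; simp
  have hunit : ∀ y, y ≠ x → ∃ u : (ZMod p)ˣ, y = x + u := by
    intro y hy
    exact ⟨Units.mk0 (y - x) (sub_ne_zero.mpr hy), by simp⟩
  have hinj : Function.Injective Φ := by
    intro g g' hgg
    funext q
    obtain ⟨u, rfl⟩ := QuotientGroup.mk_surjective q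
    rw [← hΦu g, ← hΦu g', hgg]
  have himg : ∀ g, Finset.univ.image (Φ g) = insert i (Finset.univ.image g) := by
    intro g
    ext v
    simp only [Finset.mem_image, Finset.mem_univ, true_and, Finset.mem_insert]
    constructor
    · rintro ⟨y, rfl⟩
      by_cases hy : y = x
      · left; rw [hy, hΦx]
      · obtain ⟨u, rfl⟩ := hunit y hy
        right; exact ⟨_, (hΦu g u).symm⟩
    · rintro (rfl | ⟨q, rfl⟩)
      · exact ⟨x, hΦx g⟩
      · obtain ⟨u, rfl⟩ := QuotientGroup.mk_surjective q
        exact ⟨_, hΦu g u⟩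
  have hmain : T p r x i = ((Finset.univ : Finset ((ZMod p)ˣ ⧸ H → Fin r)).filter
      (fun f => Finset.univ.image f ∈ (Finset.univ.erase i).powersetCard 2)).image Φ := by
    ext c
    simp only [T, Finset.mem_filter, Finset.mem_univ, true_and, Finset.mem_image]
    constructor
    · rintro ⟨hRF, h3, hcx, huniq⟩
      have huniq' : ∀ y, c y = c x → y = x := by rw [hcx]; exact huniq
      have hinvw : ∀ u : (ZMod p)ˣ, c (x + ((u * w : (ZMod p)ˣ) : ZMod p)) = c (x + u) := by
        intro u
        rw [Units.val_mul]
        rcases hw with hw | hw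
        · rw [hw, mul_comm]; exact inv_two hp2 c hRF x huniq' _
        · have hz : x + (u : ZMod p) * (-2) = x + -(2 * u) := by ring
          rw [hw, hz, inv_neg c hRF x huniq', inv_two hp2 c hRF x huniq']
      let g : (ZMod p)ˣ ⧸ H → Fin r := fun q => c (x + (q.out : (ZMod p)ˣ))
      have hg : Φ g = c := by
        funext y
        by_cases hy : y = x
        · rw [hy, hΦx, hcx]
        · obtain ⟨u, rfl⟩ := hunit y hy
          rw [hΦu]
          obtain ⟨h, hh⟩ := QuotientGroup.mk_out_eq_mul H u
          simp only [g]
          rw [hh]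
          exact inv_zpowers (fun u : (ZMod p)ˣ => c (x + u)) w hinvw u h h.2
      refine ⟨g, ?_, hg⟩
      have hni : i ∉ Finset.univ.image g := by
        intro hi
        obtain ⟨q, -, hq⟩ := Finset.mem_image.mp hi
        have := huniq _ hq
        simp at this
      have hc3 := card_three hp2 c hRF h3
      rw [← hg, himg, Finset.card_insert_of_notMem hni] at hc3
      rw [Finset.mem_powersetCard]
      refine ⟨fun v hv => ?_, by omega⟩
      rw [Finset.mem_erase]
      exact ⟨fun hvi => hni (hvi ▸ hv), Finset.mem_univ _⟩
    · rintro ⟨g, hg, rfl⟩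
      rw [Finset.mem_powersetCard] at hg
      have hgi : ∀ q, g q ≠ i := fun q =>
        (Finset.mem_erase.mp (hg.1 (Finset.mem_image_of_mem g (Finset.mem_univ q)))).1
      have hni : i ∉ Finset.univ.image g := by
        intro hi
        obtain ⟨q, -, hq⟩ := Finset.mem_image.mp hi
        exact hgi q hq
      have hneg : ∀ u : (ZMod p)ˣ, Φ g (x + -(u : ZMod p)) = Φ g (x + u) := by
        intro u
        have := hΦu g (-u)
        rw [Units.val_neg] at this
        rw [this, hΦu]
        congr 1
        rw [QuotientGroup.eq]
        simpa using hm1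
      have htwo : ∀ u : (ZMod p)ˣ, Φ g (x + 2 * (u : ZMod p)) = Φ g (x + u) := by
        intro u
        have := hΦu g (u * Units.mk0 (2 : ZMod p) (two_ne hp2))
        rw [Units.val_mul, Units.val_mk0, mul_comm] at this
        rw [this, hΦu]
        congr 1
        symm
        rw [QuotientGroup.eq]
        simpa using hm2
      refine ⟨?_, ?_, hΦx g, ?_⟩
      · intro a b e hab
        by_cases hb : b = x
        · subst hb
          by_cases ha : a = b
          · left; rw [ha]
          · obtain ⟨u, rfl⟩ := hunit a ha
            have : e = b + -(u : ZMod p) := by linear_combination hab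
            right; right; rw [this, hneg]
        obtain ⟨u, rfl⟩ := hunit b hb
        by_cases ha : a = x
        · subst ha
          have : e = a + 2 * (u : ZMod p) := by linear_combination hab
          right; left; rw [this, htwo]
        by_cases he : e = x
        · subst he
          have : a = e + 2 * (u : ZMod p) := by linear_combination hab
          left; rw [this, htwo]
        obtain ⟨u1, rfl⟩ := hunit a ha
        obtain ⟨u2, rfl⟩ := hunit e he
        rw [hΦu, hΦu, hΦu]
        exact pigeon _ hg.2.le _ _ _ (Finset.mem_image_of_mem g (Finset.mem_univ _))
          (Finset.mem_image_of_mem g (Finset.mem_univ _))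
          (Finset.mem_image_of_mem g (Finset.mem_univ _))
      · rw [himg, Finset.card_insert_of_notMem hni, hg.2]
      · intro y hy
        by_contra hne
        obtain ⟨u, rfl⟩ := hunit y hne
        rw [hΦu] at hy
        exact hgi _ hy
  rw [hmain, Finset.card_image_of_injective _ hinj]

open Classical in
lemma card_big (hp2 : p ≠ 2) {r : ℕ} :
    (((Finset.univ : Finset (ZMod p → Fin r)).filter
      (fun c => RF c ∧ 3 ≤ (Finset.univ.image c).card)).card : ℤ) =
      r * ((r - 1).choose 2 : ℤ) * p *
      (2 ^ ((p - 1) / ((if Even (orderOf (2 : ZMod p)) then 1 else 2) *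
            orderOf (2 : ZMod p))) - 2) := by
  have hU : (Finset.univ : Finset (ZMod p → Fin r)).filter
      (fun c => RF c ∧ 3 ≤ (Finset.univ.image c).card) =
      (Finset.univ : Finset (ZMod p × Fin r)).biUnion (fun q => T p r q.1 q.2) := by
    ext c
    simp only [T, Finset.mem_filter, Finset.mem_univ, true_and, Finset.mem_biUnion]
    constructor
    · rintro ⟨h, h3⟩
      obtain ⟨x, hx⟩ := exists_uniq hp2 c h h3
      exact ⟨(x, c x), h, h3, rfl, hx⟩
    · rintro ⟨q, h, h3, -⟩
      exact ⟨h, h3⟩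
  rw [hU, Finset.card_biUnion]
  · push_cast
    rw [Finset.sum_congr rfl (fun q _ => card_T hp2 q.1 q.2)]
    simp only [Finset.sum_const, Finset.card_univ, Fintype.card_prod, ZMod.card, Fintype.card_fin,
      nsmul_eq_mul]
    push_cast
    ring
  · rintro ⟨x, i⟩ - ⟨x', i'⟩ - hne
    change Disjoint (T p r x i) (T p r x' i')
    rw [Finset.disjoint_left]
    intro c hc hc'
    simp only [T, Finset.mem_filter, Finset.mem_univ, true_and] at hc hc'
    obtain ⟨h, -, hx, hu⟩ := hc
    obtain ⟨-, -, hx', hu'⟩ := hc'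
    subst hx hx'
    have hxx : x' = x := by
      by_contra hcon
      obtain ⟨y, hy, hy'⟩ := refl_ne hp2 c h x hu x' hcon
      exact hy (hu' y hy')
    subst hxx
    exact hne rfl

end prime3

lemma rf_iff {p r : ℕ} (c : ZMod p → Fin r) : RainbowAPFreeZ c ↔ RF c := by
  constructor
  · intro h x y z hxyz
    by_cases hxy : y = x
    · left; rw [hxy]
    · exact h x y z hxyz hxy
  · intro h x y z hxyz _
    exact h x y z hxyz

end RainbowAux

open RainbowAux Classical in
theorem stmt_6_aux (p r : ℕ) (hp : p.Prime) (hp3 : 3 ≤ p) (hr : 3 ≤ r) :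
    (gZ r p : ℤ) =
      (r.choose 2 : ℤ) * 2 ^ p - r ^ 2 + 2 * r +
        r * ((r - 1).choose 2) * p *
          (2 ^ ((p - 1) / ((if Even (orderOf (2 : ZMod p)) then 1 else 2) *
            orderOf (2 : ZMod p))) - 2) := by
  have : Fact p.Prime := ⟨hp⟩
  have hp2 : p ≠ 2 := by omega
  have hg : gZ r p = ((Finset.univ : Finset (ZMod p → Fin r)).filter (fun c => RF c)).card := by
    unfold gZ
    rw [Nat.card_eq_fintype_card, Fintype.card_subtype]
    congr 1
    ext c
    simp [rf_iff]
  let I : (ZMod p → Fin r) → ℕ := fun c => (Finset.univ.image c).card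
  have hIpos : ∀ c, 1 ≤ I c := fun c => by
    have : (Finset.univ.image c).Nonempty := Finset.univ_nonempty.image c
    exact this.card_pos
  have hsmall : ∀ c, I c ≤ 2 → RF c := by
    intro c hc x y z _
    exact pigeon _ hc _ _ _ (Finset.mem_image_of_mem c (Finset.mem_univ _))
          (Finset.mem_image_of_mem c (Finset.mem_univ _))
          (Finset.mem_image_of_mem c (Finset.mem_univ _))
  have hsplit : (Finset.univ : Finset (ZMod p → Fin r)).filter (fun c => RF c) =
      (Finset.univ.filter (fun c => I c = 1) ∪ Finset.univ.filter (fun c => I c = 2)) ∪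
        Finset.univ.filter (fun c => RF c ∧ 3 ≤ I c) := by
    ext c
    simp only [Finset.mem_filter, Finset.mem_univ, true_and, Finset.mem_union]
    have := hIpos c
    have h2 := hsmall c
    constructor
    · intro h
      by_cases h3 : 3 ≤ I c
      · right; exact ⟨h, h3⟩
      · left; omega
    · rintro ((h | h) | h)
      · exact h2 (by omega)
      · exact h2 (by omega)
      · exact h.1
  have hd1 : Disjoint (Finset.univ.filter (fun c => I c = 1))
      (Finset.univ.filter (fun c => I c = 2)) := by
    rw [Finset.disjoint_left]; intro c hc hc'
    simp only [Finset.mem_filter, Finset.mem_univ, true_and] at hc hc'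
    omega
  have hd2 : Disjoint (Finset.univ.filter (fun c => I c = 1) ∪ Finset.univ.filter (fun c => I c = 2))
      (Finset.univ.filter (fun c => RF c ∧ 3 ≤ I c)) := by
    rw [Finset.disjoint_left]; intro c hc hc'
    simp only [Finset.mem_filter, Finset.mem_univ, true_and, Finset.mem_union] at hc hc'
    omega
  have h1 : (Finset.univ.filter (fun c => I c = 1)).card = r := by
    have : Finset.univ.filter (fun c => I c = 1) =
        (Finset.univ : Finset (Fin r)).image (fun b => (fun _ : ZMod p => b)) := by
      ext c
      simp only [Finset.mem_filter, Finset.mem_univ, true_and, Finset.mem_image, I]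
      constructor
      · intro h
        obtain ⟨b, hb⟩ := Finset.card_eq_one.mp h
        refine ⟨b, funext fun y => ?_⟩
        have : c y ∈ Finset.univ.image c := Finset.mem_image_of_mem _ (Finset.mem_univ _)
        rw [hb] at this
        simpa using (Finset.mem_singleton.mp this).symm
      · rintro ⟨b, rfl⟩
        rw [Finset.image_const Finset.univ_nonempty]; simp
    rw [this, Finset.card_image_of_injective _ (fun a b hab => congrFun hab 0)]
    simp
  have h2 : ((Finset.univ.filter (fun c => I c = 2)).card : ℤ) =
      (r.choose 2 : ℤ) * (2 ^ p - 2) := by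
    have := count_image (α := ZMod p) (Finset.univ : Finset (Fin r))
    rw [Finset.card_univ, Fintype.card_fin, ZMod.card] at this
    rw [← this]
    congr 2
    ext c
    simp [I, Finset.mem_powersetCard]
  have h3 := card_big hp2 (r := r)
  rw [hg, hsplit, Finset.card_union_of_disjoint hd2, Finset.card_union_of_disjoint hd1]
  push_cast
  rw [h1, h2]
  simp only [I]
  rw [h3]
  have hch : (r.choose 2 : ℤ) * 2 = r * (r - 1) := by
    have := Nat.triangle_succ (r - 1)
    have h := Nat.choose_two_right r
    have hev : 2 ∣ r * (r - 1) := (Nat.even_mul_pred_self r).two_dvd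
    have : r.choose 2 * 2 = r * (r - 1) := by rw [h]; exact Nat.div_mul_cancel hev
    have h' : ((r.choose 2 * 2 : ℕ) : ℤ) = ((r * (r - 1) : ℕ) : ℤ) := by rw [this]
    push_cast [Nat.cast_sub (show 1 ≤ r by omega)] at h'
    exact h'
  linear_combination -hch

theorem stmt_6 (p r : ℕ) (hp : p.Prime) (hp3 : 3 ≤ p) (hr : 3 ≤ r) :
    (gZ r p : ℤ) =
      (r.choose 2 : ℤ) * 2 ^ p - r ^ 2 + 2 * r +
        r * ((r - 1).choose 2) * p *
          (2 ^ ((p - 1) / ((if Even (orderOf (2 : ZMod p)) then 1 else 2) *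
            orderOf (2 : ZMod p))) - 2) := by
  have := stmt_6_aux p r hp hp3 hr
  convert this using 1
end

section
/- For every integer r ≥ 3 there exists a constant c = c(r) > 0 such that for all sufficiently large n there exists a finite collection 𝒞 of r-templates of order n satisfying: (i) every rainbow 3-AP-free r-template of order n is a subtemplate of some P ∈ 𝒞; (ii) for every P ∈ 𝒞, R(P) ≤ n^{−1/3}·f(n); (iii) log₂|𝒞| ≤ c·n^{2/3}·(log₂ n)². -/
/-- `fAP n` is the number of 3-APs in `[n] = {1, …, n}`: the number of pairs
`(a, d)` with `d ≥ 1` and `a, a+d, a+2d ∈ [n]`. -/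
def fAP (n : ℕ) : ℕ :=
  (((Finset.Icc 1 n) ×ˢ (Finset.Icc 1 n)).filter
    fun p => p.1 + p.2 ∈ Finset.Icc 1 n ∧ p.1 + 2 * p.2 ∈ Finset.Icc 1 n).card

/-- `Rtemp n P` is the number of pairs consisting of a 3-AP `(a, a+d, a+2d)` of
`[n]` together with pairwise distinct colors `i ∈ P a`, `j ∈ P (a+d)`,
`ℓ ∈ P (a+2d)`. -/
def Rtemp {r : ℕ} (n : ℕ) (P : ℕ → Finset (Fin r)) : ℕ :=
  ((((Finset.Icc 1 n) ×ˢ (Finset.Icc 1 n)) ×ˢ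
      ((Finset.univ : Finset (Fin r)) ×ˢ Finset.univ ×ˢ Finset.univ)).filter
    fun t => t.1.1 + 2 * t.1.2 ≤ n ∧ t.2.1 ∈ P t.1.1 ∧
      t.2.2.1 ∈ P (t.1.1 + t.1.2) ∧ t.2.2.2 ∈ P (t.1.1 + 2 * t.1.2) ∧
      t.2.1 ≠ t.2.2.1 ∧ t.2.2.1 ≠ t.2.2.2 ∧ t.2.1 ≠ t.2.2.2).card

/-- `P₁` is a subtemplate of `P₂` (as `r`-templates of order `n`). -/
def Subtemplate {r : ℕ} (n : ℕ) (P₁ P₂ : ℕ → Finset (Fin r)) : Prop :=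
  ∀ x ∈ Finset.Icc 1 n, P₁ x ⊆ P₂ x

open Classical in
noncomputable def ctInd (p : Prop) : ℝ := if p then 1 else 0

lemma ctInd_nonneg (p : Prop) : 0 ≤ ctInd p := by
  unfold ctInd; split_ifs <;> norm_num

lemma ctInd_mono {p q : Prop} (h : p → q) : ctInd p ≤ ctInd q := by
  by_cases hp : p
  · simp [ctInd, hp, h hp]
  · simp only [ctInd, hp, if_false]; split_ifs <;> norm_num

lemma ctInd_true {p : Prop} (h : p) : ctInd p = 1 := by simp [ctInd, h]

lemma ctInd_false {p : Prop} (h : ¬ p) : ctInd p = 0 := by simp [ctInd, h]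

lemma ctInd_congr {p q : Prop} (h : p ↔ q) : ctInd p = ctInd q := by rw [propext h]

section Run
variable {S V : Type}

open Classical in
noncomputable def ctNext (act : S → V → Prop) (yes no : S → V → S) (I : V → Prop) (s : S) (v : V) : S :=
  if act s v then (if I v then yes s v else no s v) else s

noncomputable def ctRun (act : S → V → Prop) (yes no : S → V → S) (I : V → Prop) : List V → S → S
  | [], s => s
  | v :: l, s => ctRun act yes no I l (ctNext act yes no I s v)

open Classical in
noncomputable def ctCnt (act : S → V → Prop) (yes no : S → V → S) (I : V → Prop) : List V → S → ℕ
  | [], _ => 0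
  | v :: l, s => (if act s v ∧ I v then 1 else 0) + ctCnt act yes no I l (ctNext act yes no I s v)

lemma ctRun_family (act : S → V → Prop) (yes no : S → V → S) (l : List V) :
    ∀ (s : S) (k : ℕ), ∃ F : Finset S, F.card ≤ (l.length + 1) ^ k ∧
      ∀ I : V → Prop, ctCnt act yes no I l s ≤ k → ctRun act yes no I l s ∈ F := by
  classical
  induction l with
  | nil => intro s k; exact ⟨{s}, by simp, fun I _ => by simp [ctRun]⟩
  | cons v l ih =>
    intro s k
    by_cases ha : act s v
    · obtain ⟨F0, h0, h0'⟩ := ih (no s v) k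
      cases k with
      | zero =>
        refine ⟨F0, by simpa using h0, fun I hI => ?_⟩
        by_cases hv : I v
        · simp [ctCnt, ha, hv] at hI
        · simp only [ctCnt, ctRun, ctNext, ha, hv, if_true, if_false, and_false, zero_add] at hI ⊢
          exact h0' I hI
      | succ k =>
        obtain ⟨F1, h1, h1'⟩ := ih (yes s v) k
        refine ⟨F0 ∪ F1, ?_, fun I hI => ?_⟩
        · refine (Finset.card_union_le _ _).trans ?_
          have h2 : (l.length + 1) ^ k ≤ (l.length + 1 + 1) ^ k := Nat.pow_le_pow_left (by omega) k
          simp only [List.length_cons]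
          calc F0.card + F1.card ≤ (l.length + 1) ^ (k+1) + (l.length + 1) ^ k := by omega
            _ = (l.length + 1) ^ k * (l.length + 1 + 1) := by ring
            _ ≤ (l.length + 1 + 1) ^ k * (l.length + 1 + 1) := Nat.mul_le_mul_right _ h2
            _ = _ := by ring
        · by_cases hv : I v
          · simp only [ctCnt, ctRun, ctNext, ha, hv, if_true, and_true] at hI ⊢
            exact Finset.mem_union_right _ (h1' I (by omega))
          · simp only [ctCnt, ctRun, ctNext, ha, hv, if_true, if_false, and_false, zero_add] at hI ⊢
            exact Finset.mem_union_left _ (h0' I hI)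
    · obtain ⟨F0, h0, h0'⟩ := ih s k
      refine ⟨F0, h0.trans (Nat.pow_le_pow_left (by simp) k), fun I hI => ?_⟩
      simp only [ctCnt, ctRun, ctNext, ha, if_false, false_and, zero_add] at hI ⊢
      exact h0' I hI

lemma ctRun_inv (act : S → V → Prop) (yes no : S → V → S) (I : V → Prop) (Inv : S → ℕ → Prop)
    (hy : ∀ s c v, Inv s c → act s v → I v → Inv (yes s v) (c+1))
    (hn : ∀ s c v, Inv s c → act s v → ¬ I v → Inv (no s v) c) (l : List V) :
    ∀ s c, Inv s c → Inv (ctRun act yes no I l s) (c + ctCnt act yes no I l s) := by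
  induction l with
  | nil => intro s c h; simpa [ctRun, ctCnt] using h
  | cons v l ih =>
    intro s c h
    by_cases ha : act s v
    · by_cases hv : I v
      · simp only [ctCnt, ctRun, ctNext, ha, hv, if_true, and_true]
        rw [← add_assoc]
        exact ih _ _ (hy s c v h ha hv)
      · simp only [ctCnt, ctRun, ctNext, ha, hv, if_true, if_false, and_false, zero_add]
        exact ih _ _ (hn s c v h ha hv)
    · simp only [ctCnt, ctRun, ctNext, ha, if_false, false_and, zero_add]
      exact ih _ _ h

lemma ctRun_keep (act : S → V → Prop) (yes no : S → V → S) (I : V → Prop) (Q : S → Prop)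
    (hQ : ∀ s v, Q s → Q (ctNext act yes no I s v)) (l : List V) :
    ∀ s, Q s → Q (ctRun act yes no I l s) := by
  induction l with
  | nil => intro s h; simpa [ctRun] using h
  | cons v l ih => intro s h; exact ih _ (hQ s v h)

lemma ctRun_done (act : S → V → Prop) (yes no : S → V → S) (I : V → Prop) (Q : V → S → Prop)
    (hQ : ∀ u s v, Q u s → Q u (ctNext act yes no I s v))
    (h0 : ∀ s v, Q v (ctNext act yes no I s v)) (l : List V) :
    ∀ s, ∀ v ∈ l, Q v (ctRun act yes no I l s) := by
  induction l with
  | nil => intro s v h; simp at h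
  | cons w l ih =>
    intro s v h
    rcases List.mem_cons.1 h with rfl | h
    · exact ctRun_keep act yes no I (Q v) (hQ v) l _ (h0 s v)
    · exact ih _ v h

end Run

section Step
variable {V : Type} [Fintype V]

noncomputable def ctDg (E : V → V → V → Prop) (v : V) : ℝ := ∑ x, ∑ y, ctInd (E v x y)
noncomputable def ctDeg (L : V → V → Prop) (x : V) : ℝ := ∑ y, ctInd (L x y)

/-- the pairs added to `L` when `v` is selected -/
def ctF (E : V → V → V → Prop) (τ : ℝ) (L : V → V → Prop) (v x y : V) : Prop :=
  E v x y ∧ ¬ L x y ∧ ctDeg L x < τ * ctDg E x ∧ ctDeg L y < τ * ctDg E y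

noncomputable def ctFs (E : V → V → V → Prop) (τ : ℝ) (L : V → V → Prop) (v : V) : ℝ :=
  ∑ x, ∑ y, ctInd (ctF E τ L v x y)

lemma ctDg_nonneg (E : V → V → V → Prop) (v : V) : 0 ≤ ctDg E v :=
  Finset.sum_nonneg fun _ _ => Finset.sum_nonneg fun _ _ => ctInd_nonneg _

lemma ctDeg_nonneg (L : V → V → Prop) (v : V) : 0 ≤ ctDeg L v :=
  Finset.sum_nonneg fun _ _ => ctInd_nonneg _

lemma ctDeg_mono {L L' : V → V → Prop} (h : ∀ x y, L x y → L' x y) (v : V) :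
    ctDeg L v ≤ ctDeg L' v :=
  Finset.sum_le_sum fun _ _ => ctInd_mono (h _ _)

lemma ctFs_mono (E : V → V → V → Prop) (τ : ℝ) {L L' : V → V → Prop}
    (h : ∀ x y, L x y → L' x y) (v : V) : ctFs E τ L' v ≤ ctFs E τ L v := by
  refine Finset.sum_le_sum fun x _ => Finset.sum_le_sum fun y _ => ctInd_mono ?_
  rintro ⟨h1, h2, h3, h4⟩
  exact ⟨h1, fun h' => h2 (h _ _ h'), (ctDeg_mono h x).trans_lt h3, (ctDeg_mono h y).trans_lt h4⟩

lemma phase1 (E : V → V → V → Prop) (hE1 : ∀ x y z, E x y z → E y x z)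
    (hE2 : ∀ x y z, E x y z → E x z y) (K τ M N : ℝ)
    (hK : ∀ x y, ∑ z, ctInd (E x y z) ≤ K) (hτ : 0 < τ) (hN : N = Fintype.card V) (hN0 : 0 < N)
    (hM : M = ∑ v, ctDg E v) (hM0 : 0 < M) (hK0 : 0 ≤ K)
    (h1 : 16 * K * τ ≤ 1) (h2 : 16 * K ^ 2 * N ≤ M)
    (k : ℕ) (hk : 16 * τ * N + 16 * K * N ^ 2 / M ≤ k) :
    ∃ F : Finset ((V → V → Prop) × (V → Prop)), F.card ≤ (Fintype.card V + 1) ^ k ∧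
      ∀ I : V → Prop, (∀ x y z, E x y z → I x → I y → ¬ I z) → ∃ s ∈ F,
        (∀ v, s.2 v → ¬ I v) ∧ (∀ x y, s.1 x y → s.1 y x) ∧
        (∀ x y, s.1 x y → I x → ¬ I y) ∧ (∀ x, ctDeg s.1 x ≤ τ * ctDg E x + K) ∧
        (∑ v, ctInd (s.2 v) * ctDg E v < M / 64 → τ * M / 8 ≤ ∑ x, ctDeg s.1 x) := by
  classical
  set act : (V → V → Prop) × (V → Prop) → V → Prop := fun s v =>
    M / (4 * N) ≤ ctDg E v ∧ ctDg E v / 4 ≤ ctFs E τ s.1 v with hact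
  set yes : (V → V → Prop) × (V → Prop) → V → (V → V → Prop) × (V → Prop) := fun s v =>
    (fun x y => s.1 x y ∨ ctF E τ s.1 v x y, s.2) with hyes
  set no : (V → V → Prop) × (V → Prop) → V → (V → V → Prop) × (V → Prop) := fun s v =>
    (s.1, fun x => s.2 x ∨ x = v) with hno
  set l : List V := (Finset.univ : Finset V).toList with hl
  set s0 : (V → V → Prop) × (V → Prop) := (fun _ _ => False, fun _ => False) with hs0
  obtain ⟨F, hF, hF'⟩ := ctRun_family act yes no l s0 k
  refine ⟨F, by simpa [hl] using hF, fun I hI => ?_⟩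
  have inv := ctRun_inv act yes no I (fun s c =>
      (∀ v, s.2 v → ¬ I v) ∧ (∀ x y, s.1 x y → s.1 y x) ∧
        (∀ x y, s.1 x y → I x → ¬ I y) ∧ (∀ x, ctDeg s.1 x ≤ τ * ctDg E x + K) ∧
        (c : ℝ) * (M / (16 * N)) ≤ ∑ x, ctDeg s.1 x) ?_ ?_ l s0 0 ?_
  rotate_left
  · rintro ⟨L, D⟩ c v ⟨i1, i2, i3, i4, i5⟩ ⟨a1, a2⟩ hv
    simp only [hyes] at *
    refine ⟨i1, ?_, ?_, ?_, ?_⟩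
    · rintro x y (h | ⟨h1, h2, h3, h4⟩)
      · exact Or.inl (i2 _ _ h)
      · exact Or.inr ⟨hE2 _ _ _ h1, fun h => h2 (i2 _ _ h), h4, h3⟩
    · rintro x y (h | h) hx
      · exact i3 _ _ h hx
      · exact hI _ _ _ h.1 hv hx
    · intro x
      by_cases hx : ctDeg L x < τ * ctDg E x
      · have : ctDeg (fun x y => L x y ∨ ctF E τ L v x y) x ≤ ctDeg L x + ∑ z, ctInd (E v x z) := by
          unfold ctDeg
          rw [← Finset.sum_add_distrib]
          refine Finset.sum_le_sum fun y _ => ?_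
          by_cases h : L x y
          · rw [ctInd_true (Or.inl h), ctInd_true h]; linarith [ctInd_nonneg (E v x y)]
          · rw [ctInd_false h, zero_add]
            exact ctInd_mono (fun h' => (h'.resolve_left h).1)
        linarith [hK v x]
      · refine le_trans (le_of_eq ?_) (i4 x)
        unfold ctDeg
        refine Finset.sum_congr rfl fun y _ => ctInd_congr ?_
        constructor
        · rintro (h | h)
          · exact h
          · exact absurd h.2.2.1 hx
        · exact Or.inl
    · have : ∑ x, ctDeg (fun x y => L x y ∨ ctF E τ L v x y) x = ∑ x, ctDeg L x + ctFs E τ L v := by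
        unfold ctDeg ctFs
        rw [← Finset.sum_add_distrib]
        refine Finset.sum_congr rfl fun x _ => ?_
        rw [← Finset.sum_add_distrib]
        refine Finset.sum_congr rfl fun y _ => ?_
        by_cases h : L x y
        · rw [ctInd_true (Or.inl h), ctInd_true h, ctInd_false (fun h' => h'.2.1 h), add_zero]
        · rw [ctInd_false h, zero_add]
          exact ctInd_congr ⟨fun h' => h'.resolve_left h, Or.inr⟩
      rw [this]
      push_cast
      have e : M / (16 * N) = M / (4 * N) / 4 := by field_simp; norm_num
      rw [add_mul, one_mul]
      nlinarith
  · rintro ⟨L, D⟩ c v ⟨i1, i2, i3, i4, i5⟩ ⟨a1, a2⟩ hv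
    refine ⟨?_, i2, i3, i4, i5⟩
    rintro x (h | h)
    · exact i1 x h
    · exact h ▸ hv
  · refine ⟨fun _ h => h.elim, fun _ _ h => h.elim, fun _ _ h => h.elim, fun x => ?_, ?_⟩
    · simp only [hs0, ctDeg, ctInd_false not_false, Finset.sum_const_zero]
      have := ctDg_nonneg E x
      positivity
    · simp [hs0, ctDeg, ctInd]
  have dn := ctRun_done act yes no I (fun v s =>
      s.2 v ∨ ctDg E v < M / (4 * N) ∨ ctFs E τ s.1 v ≤ ctDg E v / 4) ?_ ?_ l s0
  rotate_left
  · rintro u ⟨L, D⟩ v h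
    unfold ctNext
    split_ifs with ha hv
    · rcases h with h | h | h
      · exact Or.inl h
      · exact Or.inr (Or.inl h)
      · exact Or.inr (Or.inr ((ctFs_mono E τ (fun x y h => Or.inl h) u).trans h))
    · rcases h with h | h | h
      · exact Or.inl (Or.inl h)
      · exact Or.inr (Or.inl h)
      · exact Or.inr (Or.inr h)
    · exact h
  · rintro ⟨L, D⟩ v
    unfold ctNext
    split_ifs with ha hv
    · right; right
      have : ctFs E τ (yes (L, D) v).1 v = 0 := by
        refine Finset.sum_eq_zero fun x _ => Finset.sum_eq_zero fun y _ => ctInd_false ?_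
        intro h
        apply h.2.1
        right
        have hm : ∀ x y, L x y → (yes (L, D) v).1 x y := fun x y h => Or.inl h
        exact ⟨h.1, fun h' => h.2.1 (Or.inl h'), (ctDeg_mono hm x).trans_lt h.2.2.1,
          (ctDeg_mono hm y).trans_lt h.2.2.2⟩
      rw [this]
      have := ctDg_nonneg E v
      positivity
    · exact Or.inl (Or.inr rfl)
    · simp only [hact, not_and_or, not_le] at ha
      rcases ha with h | h
      · exact Or.inr (Or.inl h)
      · exact Or.inr (Or.inr h.le)
  have hmem := hF' I
  generalize ctRun act yes no I l s0 = s at *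
  generalize ctCnt act yes no I l s0 = c at *
  obtain ⟨L, D⟩ := s
  obtain ⟨i1, i2, i3, i4, i5⟩ := inv
  have hdegsum : ∑ x, ctDeg L x ≤ τ * M + K * N := by
    calc ∑ x, ctDeg L x ≤ ∑ x, (τ * ctDg E x + K) := Finset.sum_le_sum fun x _ => i4 x
      _ = _ := by rw [Finset.sum_add_distrib, ← Finset.mul_sum, ← hM]; simp [hN]; ring
  refine ⟨(L, D), hmem ?_, i1, i2, i3, i4, fun hD => ?_⟩
  · have h3 : (c : ℝ) * (M / (16 * N)) ≤ τ * M + K * N := by simpa using i5.trans hdegsum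
    have : (c : ℝ) ≤ k := by
      refine le_trans ?_ hk
      have e : 16 * τ * N + 16 * K * N ^ 2 / M = (τ * M + K * N) / (M / (16 * N)) := by
        field_simp
      rw [e, le_div_iff₀ (by positivity)]
      exact h3
    exact_mod_cast this
  · simp only at hD i4 dn ⊢
    have hv : ∀ v, v ∈ l := by simp [hl]
    have hFsum : ∑ v, ctFs E τ L v ≤ M / 64 + M / 4 + M / 4 := by
      have hle : ∀ v, ctFs E τ L v ≤ ctDg E v := fun v =>
        Finset.sum_le_sum fun x _ => Finset.sum_le_sum fun y _ => ctInd_mono fun h => h.1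
      calc ∑ v, ctFs E τ L v ≤ ∑ v, (ctInd (D v) * ctDg E v + M / (4 * N) + ctDg E v / 4) := by
            refine Finset.sum_le_sum fun v _ => ?_
            have p1 : 0 ≤ M / (4 * N) := by positivity
            have p2 := ctDg_nonneg E v
            have p3 : 0 ≤ ctInd (D v) * ctDg E v := mul_nonneg (ctInd_nonneg _) p2
            rcases dn v (hv v) with h | h | h
            · rw [ctInd_true h]; linarith [hle v]
            · linarith [hle v]
            · linarith
        _ = ∑ v, ctInd (D v) * ctDg E v + M / 4 + M / 4 := by
            have e4 : ∑ v, ctDg E v / 4 = M / 4 := by rw [hM, Finset.sum_div]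
            rw [Finset.sum_add_distrib, Finset.sum_add_distrib, e4]
            simp only [Finset.sum_const, Finset.card_univ, nsmul_eq_mul, ← hN]
            field_simp
        _ ≤ _ := by linarith
    set B : V → Prop := fun x => τ * ctDg E x ≤ ctDeg L x with hB
    have key : M ≤ ∑ v, ctFs E τ L v + K * ∑ x, ctDeg L x + 2 * ∑ x, ctInd (B x) * ctDg E x := by
      have e1 : ∑ v, ∑ x, ∑ y, ctInd (L x y) * ctInd (E v x y) ≤ K * ∑ x, ctDeg L x := by
        rw [Finset.sum_comm, Finset.mul_sum]
        refine Finset.sum_le_sum fun x _ => ?_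
        rw [Finset.sum_comm]
        unfold ctDeg
        rw [Finset.mul_sum]
        refine Finset.sum_le_sum fun y _ => ?_
        rw [← Finset.mul_sum, mul_comm]
        refine mul_le_mul_of_nonneg_right ?_ (ctInd_nonneg _)
        refine le_trans (le_of_eq ?_) (hK x y)
        exact Finset.sum_congr rfl fun z _ => ctInd_congr
          ⟨fun h => hE2 _ _ _ (hE1 _ _ _ h), fun h => hE1 _ _ _ (hE2 _ _ _ h)⟩
      have e2 : ∑ v, ∑ x, ∑ y, ctInd (B x) * ctInd (E v x y) = ∑ x, ctInd (B x) * ctDg E x := by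
        rw [Finset.sum_comm]
        refine Finset.sum_congr rfl fun x _ => ?_
        unfold ctDg
        rw [Finset.mul_sum]
        refine Finset.sum_congr rfl fun v _ => ?_
        rw [Finset.mul_sum]
        refine Finset.sum_congr rfl fun y _ => ?_
        rw [ctInd_congr ⟨hE1 v x y, hE1 x v y⟩]
      have e3 : ∑ v, ∑ x, ∑ y, ctInd (B y) * ctInd (E v x y) = ∑ x, ctInd (B x) * ctDg E x := by
        rw [← e2]
        refine Finset.sum_congr rfl fun v _ => ?_
        rw [Finset.sum_comm]
        refine Finset.sum_congr rfl fun x _ => Finset.sum_congr rfl fun y _ => ?_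
        rw [ctInd_congr ⟨hE2 v y x, hE2 v x y⟩]
      have : M ≤ ∑ v, ∑ x, ∑ y, (ctInd (ctF E τ L v x y) + ctInd (L x y) * ctInd (E v x y)
          + ctInd (B x) * ctInd (E v x y) + ctInd (B y) * ctInd (E v x y)) := by
        rw [hM]
        refine Finset.sum_le_sum fun v _ => Finset.sum_le_sum fun x _ =>
          Finset.sum_le_sum fun y _ => ?_
        have q0 := ctInd_nonneg (E v x y)
        have q1 := ctInd_nonneg (ctF E τ L v x y)
        have q2 := mul_nonneg (ctInd_nonneg (L x y)) q0
        have q3 := mul_nonneg (ctInd_nonneg (B x)) q0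
        have q4 := mul_nonneg (ctInd_nonneg (B y)) q0
        by_cases hE : E v x y
        · by_cases hL : L x y
          · rw [ctInd_true hL] at *; linarith
          · by_cases hx : B x
            · rw [ctInd_true hx] at *; linarith
            · by_cases hy : B y
              · rw [ctInd_true hy] at *; linarith
              · have : ctF E τ L v x y := ⟨hE, hL, not_le.1 hx, not_le.1 hy⟩
                have := ctInd_mono (p := E v x y) (fun _ => this)
                linarith
        · rw [ctInd_false hE] at *; linarith
      simp only [Finset.sum_add_distrib] at this
      rw [e2, e3] at this
      unfold ctFs
      linarith
    have hBs : M / 8 ≤ ∑ x, ctInd (B x) * ctDg E x := by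
      have : K * ∑ x, ctDeg L x ≤ K * (τ * M + K * N) := mul_le_mul_of_nonneg_left hdegsum hK0
      nlinarith
    calc τ * M / 8 ≤ τ * ∑ x, ctInd (B x) * ctDg E x := by nlinarith
      _ ≤ _ := by
        rw [Finset.mul_sum]
        refine Finset.sum_le_sum fun x _ => ?_
        by_cases hx : B x
        · rw [ctInd_true hx, one_mul]; exact hx
        · rw [ctInd_false hx]; simpa using ctDeg_nonneg L x

lemma phase2 (w : V → ℝ) (hw : ∀ v, 0 ≤ w v) (L : V → V → Prop) (K τ M N : ℝ)
    (hτ : 0 < τ) (hN : N = Fintype.card V) (hN0 : 0 < N)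
    (hM : M = ∑ v, w v) (hM0 : 0 < M) (hK0 : 0 ≤ K)
    (h1 : 64 * K * N ≤ τ * M) (hsym : ∀ x y, L x y → L y x)
    (hdeg : ∀ x, ctDeg L x ≤ τ * w x + K)
    (k : ℕ) (hk : 1024 * N ^ 2 / (τ * M) ≤ k) :
    ∃ F : Finset (V → Prop), F.card ≤ (Fintype.card V + 1) ^ k ∧
      ∀ I : V → Prop, (∀ x y, L x y → I x → ¬ I y) → ∃ D ∈ F,
        (∀ v, D v → ¬ I v) ∧
        (τ * M / 8 ≤ ∑ x, ctDeg L x → M / 64 ≤ ∑ v, ctInd (D v) * w v) := by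
  classical
  set q : ℝ := τ * M ^ 2 / (1024 * N ^ 2) with hq
  have hq0 : 0 < q := by positivity
  set Su : (V → Prop) → V → ℝ := fun D u => ∑ y, ctInd (L u y ∧ ¬ D y) * w y with hSu
  have Su_mono : ∀ D D' : V → Prop, (∀ x, D x → D' x) → ∀ u, Su D' u ≤ Su D u := by
    intro D D' h u
    refine Finset.sum_le_sum fun y _ => mul_le_mul_of_nonneg_right (ctInd_mono ?_) (hw y)
    exact fun h' => ⟨h'.1, fun h'' => h'.2 (h _ h'')⟩
  set act : (V → Prop) → V → Prop := fun D u => q ≤ Su D u with hact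
  set yes : (V → Prop) → V → (V → Prop) := fun D u => fun y => D y ∨ L u y with hyes
  set no : (V → Prop) → V → (V → Prop) := fun D u => fun y => D y ∨ y = u with hno
  set l : List V := (Finset.univ : Finset V).toList with hl
  set s0 : V → Prop := fun _ => False with hs0
  obtain ⟨F, hF, hF'⟩ := ctRun_family act yes no l s0 k
  refine ⟨F, by simpa [hl] using hF, fun I hI => ?_⟩
  have inv := ctRun_inv act yes no I (fun D c =>
      (∀ v, D v → ¬ I v) ∧ (c : ℝ) * q ≤ ∑ x, ctInd (D x) * w x) ?_ ?_ l s0 0 ?_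
  rotate_left
  · rintro D c u ⟨i1, i2⟩ ha hu
    refine ⟨?_, ?_⟩
    · rintro x (h | h)
      · exact i1 x h
      · exact hI _ _ h hu
    · have : ∑ x, ctInd (yes D u x) * w x = ∑ x, ctInd (D x) * w x + Su D u := by
        rw [hSu]
        simp only
        rw [← Finset.sum_add_distrib]
        refine Finset.sum_congr rfl fun y _ => ?_
        rw [← add_mul]
        congr 1
        by_cases h : D y
        · rw [ctInd_true (show yes D u y from Or.inl h), ctInd_true h, ctInd_false (fun h' => h'.2 h),
            add_zero]
        · rw [ctInd_false h, zero_add]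
          exact ctInd_congr ⟨fun h' => ⟨h'.resolve_left h, h⟩, fun h' => Or.inr h'.1⟩
      rw [this]
      push_cast
      have : q ≤ Su D u := ha
      linarith
  · rintro D c u ⟨i1, i2⟩ ha hu
    refine ⟨?_, i2.trans ?_⟩
    · rintro x (h | h)
      · exact i1 x h
      · exact h ▸ hu
    · exact Finset.sum_le_sum fun y _ => mul_le_mul_of_nonneg_right (ctInd_mono Or.inl) (hw y)
  · exact ⟨fun _ h => h.elim, by simp [hs0, ctInd]⟩
  have dn := ctRun_done act yes no I (fun u D => D u ∨ Su D u < q) ?_ ?_ l s0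
  rotate_left
  · intro u D v h
    unfold ctNext
    split_ifs with ha hv
    · exact h.imp Or.inl fun h => (Su_mono _ _ (fun x h => Or.inl h) u).trans_lt h
    · exact h.imp Or.inl fun h => (Su_mono _ _ (fun x h => Or.inl h) u).trans_lt h
    · exact h
  · intro D v
    unfold ctNext
    split_ifs with ha hv
    · right
      have : Su (yes D v) v = 0 := by
        refine Finset.sum_eq_zero fun y _ => ?_
        rw [ctInd_false (fun h => h.2 (Or.inr h.1)), zero_mul]
      rw [this]; exact hq0
    · exact Or.inl (Or.inr rfl)
    · exact Or.inr (not_le.1 ha)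
  have hmem := hF' I
  generalize ctRun act yes no I l s0 = D at *
  generalize ctCnt act yes no I l s0 = c at *
  obtain ⟨i1, i2⟩ := inv
  refine ⟨D, hmem ?_, i1, fun hL => ?_⟩
  · have h3 : (c : ℝ) * q ≤ M := by
      rw [zero_add] at i2
      refine i2.trans ?_
      rw [hM]
      refine Finset.sum_le_sum fun y _ => ?_
      have := ctInd_mono (p := D y) (q := True) (fun _ => trivial)
      rw [ctInd_true trivial] at this
      nlinarith [hw y]
    have : (c : ℝ) ≤ k := by
      refine le_trans ?_ hk
      have e : 1024 * N ^ 2 / (τ * M) = M / q := by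
        rw [hq]; field_simp
      rw [e, le_div_iff₀ hq0]
      exact h3
    exact_mod_cast this
  · by_contra hcon
    rw [not_le] at hcon
    set L' : V → V → Prop := fun x y => L x y ∧ ¬ D x ∧ ¬ D y with hL'
    have hsub : ∀ x, ctDeg L' x ≤ ctDeg L x := fun x => ctDeg_mono (fun _ _ h => h.1) x
    set Λ : ℝ := ∑ x, ctDeg L' x with hΛ
    have e1 : ∑ x, ctInd (D x) * ctDeg L x ≤ τ * M / 64 + K * N := by
      calc ∑ x, ctInd (D x) * ctDeg L x ≤ ∑ x, (τ * (ctInd (D x) * w x) + K) := by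
            refine Finset.sum_le_sum fun x _ => ?_
            by_cases h : D x
            · rw [ctInd_true h]; linarith [hdeg x]
            · rw [ctInd_false h]; simpa using hK0
        _ = τ * ∑ x, ctInd (D x) * w x + K * N := by
            rw [Finset.sum_add_distrib, ← Finset.mul_sum]; simp [hN]; ring
        _ ≤ _ := by nlinarith
    have e2 : ∑ x, ctDeg L x ≤ Λ + 2 * ∑ x, ctInd (D x) * ctDeg L x := by
      have a1 : ∑ x, ∑ y, ctInd (D x) * ctInd (L x y) = ∑ x, ctInd (D x) * ctDeg L x := by
        simp only [ctDeg, Finset.mul_sum]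
      have a2 : ∑ x, ∑ y, ctInd (D y) * ctInd (L x y) = ∑ x, ctInd (D x) * ctDeg L x := by
        rw [← a1, Finset.sum_comm]
        refine Finset.sum_congr rfl fun x _ => Finset.sum_congr rfl fun y _ => ?_
        rw [ctInd_congr ⟨hsym y x, hsym x y⟩]
      have : ∑ x, ctDeg L x ≤ ∑ x, ∑ y, (ctInd (L' x y) + ctInd (D x) * ctInd (L x y)
          + ctInd (D y) * ctInd (L x y)) := by
        refine Finset.sum_le_sum fun x _ => Finset.sum_le_sum fun y _ => ?_
        have q0 := ctInd_nonneg (L x y)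
        have q1 := ctInd_nonneg (L' x y)
        have q3 := mul_nonneg (ctInd_nonneg (D x)) q0
        have q4 := mul_nonneg (ctInd_nonneg (D y)) q0
        by_cases hx : D x
        · rw [ctInd_true hx] at *; linarith
        · by_cases hy : D y
          · rw [ctInd_true hy] at *; linarith
          · have := ctInd_mono (p := L x y) (q := L' x y) (fun h => ⟨h, hx, hy⟩)
            linarith
      simp only [Finset.sum_add_distrib] at this
      rw [a1, a2] at this
      have a3 : Λ = ∑ x, ∑ y, ctInd (L' x y) := rfl
      linarith
    have e3 : ∑ y, w y * ctDeg L' y ≤ N * q := by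
      calc ∑ y, w y * ctDeg L' y = ∑ u, ∑ y, ctInd (L' u y) * w y := by
            rw [Finset.sum_comm]
            refine Finset.sum_congr rfl fun y _ => ?_
            unfold ctDeg
            rw [Finset.mul_sum]
            refine Finset.sum_congr rfl fun u _ => ?_
            rw [mul_comm]
            congr 1
            exact ctInd_congr ⟨fun h => ⟨hsym _ _ h.1, h.2.2, h.2.1⟩,
              fun h => ⟨hsym _ _ h.1, h.2.2, h.2.1⟩⟩
        _ ≤ ∑ u : V, q := by
            refine Finset.sum_le_sum fun u _ => ?_
            rcases dn u (by simp [hl]) with h | h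
            · refine le_trans (le_of_eq ?_) hq0.le
              refine Finset.sum_eq_zero fun y _ => ?_
              rw [ctInd_false (fun h' => h'.2.1 h), zero_mul]
            · refine le_trans ?_ h.le
              refine Finset.sum_le_sum fun y _ => mul_le_mul_of_nonneg_right (ctInd_mono ?_) (hw y)
              exact fun h' => ⟨h'.1, h'.2.2⟩
        _ = N * q := by simp [hN]
    have e4 : ∑ y, ctDeg L' y ^ 2 - K * Λ ≤ τ * ∑ y, w y * ctDeg L' y := by
      rw [hΛ, Finset.mul_sum, Finset.mul_sum, ← Finset.sum_sub_distrib]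
      refine Finset.sum_le_sum fun y _ => ?_
      have := mul_le_mul_of_nonneg_right ((hsub y).trans (hdeg y)) (ctDeg_nonneg L' y)
      nlinarith
    have e5 : Λ ^ 2 ≤ N * ∑ y, ctDeg L' y ^ 2 := by
      have := sq_sum_le_card_mul_sum_sq (s := (Finset.univ : Finset V)) (f := fun y => ctDeg L' y)
      rw [hN]; simpa using this
    have e6 : τ * M / 16 ≤ Λ := by linarith
    have e7 : N * (τ * (N * q)) = (τ * M) ^ 2 / 1024 := by rw [hq]; field_simp
    have e8 : Λ ^ 2 - K * N * Λ ≤ (τ * M) ^ 2 / 1024 := by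
      rw [← e7]
      have b1 : ∑ y, ctDeg L' y ^ 2 - K * Λ ≤ τ * (N * q) :=
        e4.trans (mul_le_mul_of_nonneg_left e3 hτ.le)
      nlinarith
    have hp : 0 < τ * M := by positivity
    generalize τ * M = X at *
    have : X / 16 * (X / 16 - X / 64) ≤ Λ * (Λ - K * N) :=
      mul_le_mul e6 (by linarith) (by linarith) (by linarith)
    nlinarith

/-- The total weight (number of ordered edges inside `C`). -/
noncomputable def ctTot (E : V → V → V → Prop) (C : V → Prop) : ℝ :=
  ∑ x, ∑ y, ∑ z, ctInd (E x y z ∧ C x ∧ C y ∧ C z)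

lemma ctStep (E : V → V → V → Prop) (hE1 : ∀ x y z, E x y z → E y x z)
    (hE2 : ∀ x y z, E x y z → E x z y) (K τ m N : ℝ)
    (hK : ∀ x y, ∑ z, ctInd (E x y z) ≤ K) (hτ : 0 < τ) (hN : N = Fintype.card V) (hN0 : 0 < N)
    (hm : 0 < m) (hK0 : 0 ≤ K)
    (h1 : 16 * K * τ ≤ 1) (h2 : 16 * K ^ 2 * N ≤ m) (h3 : 64 * K * N ≤ τ * m)
    (k1 k2 : ℕ) (hk1 : 16 * τ * N + 16 * K * N ^ 2 / m ≤ k1) (hk2 : 1024 * N ^ 2 / (τ * m) ≤ k2)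
    (C : V → Prop) :
    ∃ F : Finset (V → Prop), F.card ≤ (Fintype.card V + 1) ^ (k1 + k2) ∧
      (∀ I : V → Prop, (∀ x y z, E x y z → I x → I y → ¬ I z) → (∀ x, I x → C x) →
        ∃ C' ∈ F, ∀ x, I x → C' x) ∧
      ∀ C' ∈ F, ctTot E C' ≤ max m (63 / 64 * ctTot E C) := by
  classical
  rcases le_or_gt (ctTot E C) m with hle | hgt
  · exact ⟨{C}, by simpa using Nat.one_le_pow _ _ (by omega), fun I _ h => ⟨C, by simp, h⟩,
      fun C' h => by rw [Finset.mem_singleton.1 h]; exact le_max_of_le_left hle⟩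
  set M := ctTot E C with hMdef
  have hM0 : 0 < M := hm.trans hgt
  set G : V → V → V → Prop := fun x y z => E x y z ∧ C x ∧ C y ∧ C z with hG
  have hM : M = ∑ v, ctDg G v := rfl
  have hG1 : ∀ x y z, G x y z → G y x z := fun x y z h => ⟨hE1 _ _ _ h.1, h.2.2.1, h.2.1, h.2.2.2⟩
  have hG2 : ∀ x y z, G x y z → G x z y := fun x y z h => ⟨hE2 _ _ _ h.1, h.2.1, h.2.2.2, h.2.2.1⟩
  have hGK : ∀ x y, ∑ z, ctInd (G x y z) ≤ K := fun x y =>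
    (Finset.sum_le_sum fun z _ => ctInd_mono (fun h => h.1)).trans (hK x y)
  obtain ⟨F1, hF1, hF1'⟩ := phase1 G hG1 hG2 K τ M N hGK hτ hN hN0 hM hM0 hK0 h1
    (h2.trans hgt.le) k1 (le_trans (by gcongr) hk1)
  have h3' : 64 * K * N ≤ τ * M := h3.trans (by gcongr)
  have hk2' : 1024 * N ^ 2 / (τ * M) ≤ k2 := le_trans (by gcongr) hk2
  have ph2 : ∀ s : (V → V → Prop) × (V → Prop), ∃ F : Finset (V → Prop),
      F.card ≤ (Fintype.card V + 1) ^ k2 ∧ ((∀ x y, s.1 x y → s.1 y x) →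
      (∀ x, ctDeg s.1 x ≤ τ * ctDg G x + K) → 
      ∀ I : V → Prop, (∀ x y, s.1 x y → I x → ¬ I y) → ∃ D ∈ F,
        (∀ v, D v → ¬ I v) ∧
        (τ * M / 8 ≤ ∑ x, ctDeg s.1 x → M / 64 ≤ ∑ v, ctInd (D v) * ctDg G v)) := by
    intro s
    by_cases hs : (∀ x y, s.1 x y → s.1 y x) ∧ (∀ x, ctDeg s.1 x ≤ τ * ctDg G x + K)
    · obtain ⟨F, hF, hF'⟩ := phase2 (ctDg G) (ctDg_nonneg G) s.1 K τ M N hτ hN hN0 hM hM0 hK0 h3'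
        hs.1 hs.2 k2 hk2'
      exact ⟨F, hF, fun _ _ => hF'⟩
    · exact ⟨∅, by simp, fun a b => absurd ⟨a, b⟩ hs⟩
  choose F2 hF2 hF2' using ph2
  refine ⟨(F1.biUnion fun s => (F2 s).image fun D => fun x => C x ∧ ¬ s.2 x ∧ ¬ D x).filter
    (fun C' => ctTot E C' ≤ max m (63 / 64 * M)), ?_, ?_, ?_⟩
  · refine (Finset.card_filter_le _ _).trans ?_
    refine (Finset.card_biUnion_le_card_mul _ _ ((Fintype.card V + 1) ^ k2)
      fun s _ => Finset.card_image_le.trans (hF2 s)).trans ?_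
    rw [pow_add]
    exact Nat.mul_le_mul_right _ hF1
  · intro I hI hIC
    obtain ⟨s, hs, a1, a2, a3, a4, a5⟩ := hF1' I (fun x y z h => hI x y z h.1)
    obtain ⟨D, hD, b1, b2⟩ := hF2' s a2 a4 I a3
    refine ⟨fun x => C x ∧ ¬ s.2 x ∧ ¬ D x, ?_, fun x hx =>
      ⟨hIC x hx, fun h => a1 x h hx, fun h => b1 x h hx⟩⟩
    refine Finset.mem_filter.2 ⟨Finset.mem_biUnion.2 ⟨s, hs, Finset.mem_image.2 ⟨D, hD, rfl⟩⟩, ?_⟩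
    refine le_max_of_le_right ?_
    have big : M / 64 ≤ ∑ v, ctInd (s.2 v ∨ D v) * ctDg G v := by
      by_cases h : ∑ v, ctInd (s.2 v) * ctDg G v < M / 64
      · exact (b2 (a5 h)).trans (Finset.sum_le_sum fun y _ =>
          mul_le_mul_of_nonneg_right (ctInd_mono Or.inr) (ctDg_nonneg G y))
      · exact (not_lt.1 h).trans (Finset.sum_le_sum fun y _ =>
          mul_le_mul_of_nonneg_right (ctInd_mono Or.inl) (ctDg_nonneg G y))
    have : ctTot E (fun x => C x ∧ ¬ s.2 x ∧ ¬ D x) + ∑ v, ctInd (s.2 v ∨ D v) * ctDg G v ≤ M := by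
      unfold ctTot
      rw [hM, ← Finset.sum_add_distrib]
      refine Finset.sum_le_sum fun x _ => ?_
      by_cases h : s.2 x ∨ D x
      · rw [ctInd_true h, one_mul]
        refine le_of_eq (add_eq_right.2 ?_)
        refine Finset.sum_eq_zero fun y _ => Finset.sum_eq_zero fun z _ => ctInd_false ?_
        rintro ⟨_, ⟨_, h1, h2⟩, _⟩
        exact h.elim h1 h2
      · rw [ctInd_false h, zero_mul, add_zero]
        refine Finset.sum_le_sum fun y _ => Finset.sum_le_sum fun z _ => ctInd_mono ?_
        rintro ⟨h, h1, h2, h3⟩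
        exact ⟨h, h1.1, h2.1, h3.1⟩
    linarith
  · intro C' h
    exact (Finset.mem_filter.1 h).2

lemma ctIter (E : V → V → V → Prop) (hE1 : ∀ x y z, E x y z → E y x z)
    (hE2 : ∀ x y z, E x y z → E x z y) (K τ m N : ℝ)
    (hK : ∀ x y, ∑ z, ctInd (E x y z) ≤ K) (hτ : 0 < τ) (hN : N = Fintype.card V) (hN0 : 0 < N)
    (hm : 0 < m) (hK0 : 0 ≤ K)
    (h1 : 16 * K * τ ≤ 1) (h2 : 16 * K ^ 2 * N ≤ m) (h3 : 64 * K * N ≤ τ * m)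
    (k1 k2 : ℕ) (hk1 : 16 * τ * N + 16 * K * N ^ 2 / m ≤ k1) (hk2 : 1024 * N ^ 2 / (τ * m) ≤ k2)
    (t : ℕ) :
    ∃ F : Finset (V → Prop), F.card ≤ (Fintype.card V + 1) ^ ((k1 + k2) * t) ∧
      (∀ I : V → Prop, (∀ x y z, E x y z → I x → I y → ¬ I z) →
        ∃ C' ∈ F, ∀ x, I x → C' x) ∧
      ∀ C' ∈ F, ctTot E C' ≤ max m ((63 / 64) ^ t * (K * N ^ 2)) := by
  classical
  induction t with
  | zero =>
    refine ⟨{fun _ => True}, by simp, fun I _ => ⟨_, Finset.mem_singleton_self _, fun _ _ => trivial⟩,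
      fun C' _ => le_max_of_le_right ?_⟩
    calc ctTot E C' ≤ ∑ x : V, ∑ y : V, K := Finset.sum_le_sum fun x _ => Finset.sum_le_sum fun y _ =>
          (Finset.sum_le_sum fun z _ => ctInd_mono (fun h => h.1)).trans (hK x y)
      _ = _ := by simp [hN]; ring
  | succ t ih =>
    obtain ⟨F, hF, hFI, hFt⟩ := ih
    choose G hG hGI hGt using ctStep E hE1 hE2 K τ m N hK hτ hN hN0 hm hK0 h1 h2 h3 k1 k2 hk1 hk2
    refine ⟨F.biUnion G, ?_, ?_, ?_⟩
    · refine (Finset.card_biUnion_le_card_mul _ _ _ fun C _ => hG C).trans ?_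
      rw [Nat.mul_succ, pow_add _ ((k1 + k2) * t)]
      exact Nat.mul_le_mul_right _ hF
    · intro I hI
      obtain ⟨C, hC, hIC⟩ := hFI I hI
      obtain ⟨C', hC', h⟩ := hGI C I hI hIC
      exact ⟨C', Finset.mem_biUnion.2 ⟨C, hC, hC'⟩, h⟩
    · intro C' hC'
      obtain ⟨C, hC, h⟩ := Finset.mem_biUnion.1 hC'
      refine (hGt C C' h).trans (max_le (le_max_left _ _) ?_)
      rcases le_max_iff.1 (hFt C hC) with h | h
      · exact le_max_of_le_left (by linarith)
      · refine le_max_of_le_right ?_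
        rw [pow_succ]; linarith

end Step

section App

/-- ordered rainbow 3-APs in any order on `{0,…,n} × [r]` -/
def ctAP (n r : ℕ) (p q s : Fin (n+1) × Fin r) : Prop :=
  (p.1.val ≠ q.1.val ∧ q.1.val ≠ s.1.val ∧ p.1.val ≠ s.1.val) ∧
  (p.2 ≠ q.2 ∧ q.2 ≠ s.2 ∧ p.2 ≠ s.2) ∧
  (p.1.val + q.1.val = 2 * s.1.val ∨ p.1.val + s.1.val = 2 * q.1.val ∨
    q.1.val + s.1.val = 2 * p.1.val)

lemma ctAP_symm1 (n r : ℕ) : ∀ p q s, ctAP n r p q s → ctAP n r q p s := by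
  rintro p q s ⟨⟨a, b, c⟩, ⟨d, e, f⟩, g⟩
  exact ⟨⟨a.symm, c, b⟩, ⟨d.symm, f, e⟩, by omega⟩

lemma ctAP_symm2 (n r : ℕ) : ∀ p q s, ctAP n r p q s → ctAP n r p s q := by
  rintro p q s ⟨⟨a, b, c⟩, ⟨d, e, f⟩, g⟩
  exact ⟨⟨c, b.symm, a⟩, ⟨f, e.symm, d⟩, by omega⟩

lemma ctAP_codeg (n r : ℕ) (p q : Fin (n+1) × Fin r) :
    ∑ s, ctInd (ctAP n r p q s) ≤ 3 * (r : ℝ) := by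
  classical
  have e : ∑ s, ctInd (ctAP n r p q s) = ((Finset.univ.filter fun s => ctAP n r p q s).card : ℝ) := by
    rw [Finset.card_filter]; push_cast
    exact Finset.sum_congr rfl fun s _ => by unfold ctInd; congr
  rw [e]
  have : (Finset.univ.filter fun s => ctAP n r p q s).card ≤
      ((({(p.1.val + q.1.val) / 2, 2 * q.1.val - p.1.val, 2 * p.1.val - q.1.val} : Finset ℕ)) ×ˢ
        (Finset.univ : Finset (Fin r))).card := by
    refine Finset.card_le_card_of_injOn (fun s => (s.1.val, s.2)) ?_ ?_
    · intro s hs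
      have hs := (Finset.mem_filter.1 hs).2
      obtain ⟨_, _, h⟩ := hs
      simp only [Finset.coe_product, Set.mem_prod, Finset.mem_coe, Finset.mem_insert,
        Finset.mem_singleton, Finset.mem_univ, and_true]
      omega
    · rintro ⟨a, b⟩ _ ⟨c, d⟩ _ h
      simp only [Prod.mk.injEq] at h
      exact Prod.ext (Fin.ext h.1) h.2
  rw [Finset.card_product, Finset.card_univ, Fintype.card_fin] at this
  have h3 := Finset.card_le_three (a := (p.1.val + q.1.val) / 2) (b := 2 * q.1.val - p.1.val)
    (c := 2 * p.1.val - q.1.val)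
  exact_mod_cast this.trans (Nat.mul_le_mul_right r h3)

lemma ct_Rtemp_zero {r n : ℕ} {P : ℕ → Finset (Fin r)} (h : Rtemp n P = 0)
    (a b c : ℕ) (i j l : Fin r) (ha : 1 ≤ a) (hc : c ≤ n) (hac : a < c) (hb : a + c = 2 * b)
    (hi : i ∈ P a) (hj : j ∈ P b) (hl : l ∈ P c) (hij : i ≠ j) (hjl : j ≠ l) (hil : i ≠ l) :
    False := by
  unfold Rtemp at h
  rw [Finset.card_eq_zero] at h
  have : ((a, b - a), (i, j, l)) ∈ (∅ : Finset ((ℕ × ℕ) × (Fin r × Fin r × Fin r))) := by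
    rw [← h]
    have e1 : a + (b - a) = b := by omega
    have e2 : a + 2 * (b - a) = c := by omega
    simp only [Finset.mem_filter, Finset.mem_product, Finset.mem_Icc, Finset.mem_univ, e1, e2]
    exact ⟨⟨⟨⟨ha, by omega⟩, by omega, by omega⟩, by simp⟩, hc, hi, hj, hl, hij, hjl, hil⟩
  simp at this

lemma ct_indep {r n : ℕ} {P : ℕ → Finset (Fin r)} (h : Rtemp n P = 0) (p q s : Fin (n+1) × Fin r)
    (hE : ctAP n r p q s) (hp : 1 ≤ p.1.val ∧ p.2 ∈ P p.1.val) (hq : 1 ≤ q.1.val ∧ q.2 ∈ P q.1.val) :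
    ¬ (1 ≤ s.1.val ∧ s.2 ∈ P s.1.val) := by
  intro hs
  obtain ⟨⟨a, b, c⟩, ⟨d, e, f⟩, g⟩ := hE
  have b1 : p.1.val ≤ n := by omega
  have b2 : q.1.val ≤ n := by omega
  have b3 : s.1.val ≤ n := by omega
  rcases g with g | g | g
  · rcases lt_or_gt_of_ne a with k | k
    · exact ct_Rtemp_zero h _ _ _ _ _ _ hp.1 b2 k g hp.2 hs.2 hq.2 f e.symm d
    · exact ct_Rtemp_zero h _ _ _ _ _ _ hq.1 b1 k (by omega) hq.2 hs.2 hp.2 e f.symm d.symm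
  · rcases lt_or_gt_of_ne c with k | k
    · exact ct_Rtemp_zero h _ _ _ _ _ _ hp.1 b3 k g hp.2 hq.2 hs.2 d e f
    · exact ct_Rtemp_zero h _ _ _ _ _ _ hs.1 b1 k (by omega) hs.2 hq.2 hp.2 e.symm d.symm f.symm
  · rcases lt_or_gt_of_ne b with k | k
    · exact ct_Rtemp_zero h _ _ _ _ _ _ hq.1 b3 k g hq.2 hp.2 hs.2 d.symm f e
    · exact ct_Rtemp_zero h _ _ _ _ _ _ hs.1 b2 k (by omega) hs.2 hp.2 hq.2 f.symm d e.symm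

open Classical in
noncomputable def ctQ (n r : ℕ) (C : Fin (n+1) × Fin r → Prop) (x : ℕ) : Finset (Fin r) :=
  Finset.univ.filter fun i => C (Fin.ofNat (n+1) x, i)

lemma ct_Rtemp_le (n r : ℕ) (C : Fin (n+1) × Fin r → Prop) :
    (Rtemp n (ctQ n r C) : ℝ) ≤ ctTot (ctAP n r) C := by
  classical
  have e : ctTot (ctAP n r) C = (((Finset.univ : Finset ((Fin (n+1) × Fin r) × (Fin (n+1) × Fin r) ×
      (Fin (n+1) × Fin r))).filter fun t => ctAP n r t.1 t.2.1 t.2.2 ∧ C t.1 ∧ C t.2.1 ∧ C t.2.2).card : ℝ) := by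
    rw [Finset.card_filter]; push_cast
    rw [Fintype.sum_prod_type]
    unfold ctTot
    refine Finset.sum_congr rfl fun x _ => ?_
    refine Eq.trans ?_ (Fintype.sum_prod_type _).symm
    refine Finset.sum_congr rfl fun y _ => Finset.sum_congr rfl fun z _ => ?_
    unfold ctInd; congr
  rw [e]
  have ov : ∀ x, x ≤ n → (Fin.ofNat (n+1) x).val = x := fun x hx =>
    Nat.mod_eq_of_lt (Nat.lt_succ_of_le hx)
  norm_cast
  unfold Rtemp
  refine Finset.card_le_card_of_injOn (fun t => ((Fin.ofNat (n+1) t.1.1, t.2.1),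
    (Fin.ofNat (n+1) (t.1.1 + t.1.2), t.2.2.1), (Fin.ofNat (n+1) (t.1.1 + 2 * t.1.2), t.2.2.2))) ?_ ?_
  · rintro ⟨⟨a, d⟩, i, j, l⟩ h
    have h := Finset.mem_filter.1 h
    simp only [Finset.mem_product, Finset.mem_Icc, Finset.mem_univ, and_true, ctQ, Finset.mem_filter,
      true_and] at h
    obtain ⟨⟨⟨ha, ha'⟩, hd, hd'⟩, hn, h1, h2, h3, h4, h5, h6⟩ := h
    have v1 := ov a (by omega)
    have v2 := ov (a + d) (by omega)
    have v3 := ov (a + 2 * d) (by omega)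
    refine Finset.mem_coe.2 (Finset.mem_filter.2 ⟨Finset.mem_univ _, ⟨?_, ⟨h4, h5, h6⟩, ?_⟩, h1, h2, h3⟩)
    · simp only [v1, v2, v3]; omega
    · simp only [v1, v2, v3]; omega
  · rintro ⟨⟨a, d⟩, i, j, l⟩ h ⟨⟨a', d'⟩, i', j', l'⟩ h' heq
    have h := Finset.mem_filter.1 h
    have h' := Finset.mem_filter.1 h'
    have w1 := h.2.1
    have w2 := h'.2.1
    simp only at w1 w2
    simp only [Prod.mk.injEq] at heq
    obtain ⟨⟨q1, q2⟩, ⟨q3, q4⟩, q5, q6⟩ := heq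
    have q1 := congrArg Fin.val q1
    have q3 := congrArg Fin.val q3
    rw [ov a (by omega), ov a' (by omega)] at q1
    rw [ov _ (by omega), ov _ (by omega)] at q3
    have : d = d' := by omega
    subst this q1 q2 q4 q6
    rfl

lemma ct_fAP (n : ℕ) (hn : 8 ≤ n) : (n : ℝ) ^ 2 / 16 ≤ fAP n := by
  have : (n / 3) * (n / 3) ≤ fAP n := by
    unfold fAP
    calc (n / 3) * (n / 3) = ((Finset.Icc 1 (n/3)) ×ˢ (Finset.Icc 1 (n/3))).card := by
          rw [Finset.card_product]; simp
      _ ≤ _ := by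
          refine Finset.card_le_card ?_
          rintro ⟨a, d⟩ h
          simp only [Finset.mem_filter, Finset.mem_product, Finset.mem_Icc] at h ⊢
          omega
  have h2 : ((n / 3 : ℕ) : ℝ) * ((n / 3 : ℕ) : ℝ) ≤ fAP n := by exact_mod_cast this
  have h3 : (n : ℝ) / 4 ≤ ((n / 3 : ℕ) : ℝ) := by
    rw [div_le_iff₀ (by norm_num)]
    have : n ≤ (n / 3) * 4 := by omega
    exact_mod_cast this
  have : (0:ℝ) ≤ n := by positivity
  nlinarith

end App

set_option maxHeartbeats 1000000 in
theorem stmt_8 (r : ℕ) (hr : 3 ≤ r) :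
    ∃ c : ℝ, 0 < c ∧ ∃ n₀ : ℕ, ∀ n : ℕ, n₀ ≤ n →
      ∃ 𝒞 : Finset (ℕ → Finset (Fin r)),
        (∀ P : ℕ → Finset (Fin r), Rtemp n P = 0 →
          ∃ Q ∈ 𝒞, Subtemplate n P Q) ∧
        (∀ Q ∈ 𝒞, (Rtemp n Q : ℝ) ≤ (n : ℝ) ^ (-(1/3 : ℝ)) * fAP n) ∧
        Real.logb 2 (𝒞.card) ≤ c * (n : ℝ) ^ ((2 : ℝ) / 3) * (Real.logb 2 n) ^ 2 := by
  classical
  set R : ℝ := (r : ℝ) with hR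
  have hR3 : 3 ≤ R := by rw [hR]; exact_mod_cast hr
  have hR0 : 0 < R := by linarith
  have hRR : R ≤ R ^ 3 := by nlinarith [sq_nonneg R, mul_nonneg hR0.le hR0.le]
  have hRR2 : R ^ 2 ≤ R ^ 3 := by nlinarith [sq_nonneg R, mul_nonneg hR0.le hR0.le]
  set c0 : ℝ := 32 * R + 3072 * R ^ 3 + 65536 * R ^ 2 with hc0
  refine ⟨258 * (c0 + 2), by positivity, (6144 * r ^ 3) ^ 3, fun n hn => ?_⟩
  have hnR : (6144 * R ^ 3) ^ 3 ≤ (n : ℝ) := by rw [hR]; exact_mod_cast hn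
  have hbig : 6144 * 27 ≤ 6144 * R ^ 3 := by
    have : (3:ℝ) ^ 3 ≤ R ^ 3 := by gcongr
    linarith
  have hn0 : (0 : ℝ) < n := by
    have : 0 < (6144 * R ^ 3) ^ 3 := by positivity
    linarith
  set x : ℝ := (n : ℝ) ^ (1/3 : ℝ) with hx
  have hx0 : 0 < x := by positivity
  have hx3 : x ^ 3 = n := by
    rw [hx, ← Real.rpow_natCast, ← Real.rpow_mul hn0.le]; norm_num
  have hx2 : (n : ℝ) ^ ((2:ℝ)/3) = x ^ 2 := by
    rw [hx, ← Real.rpow_natCast, ← Real.rpow_mul hn0.le]; norm_num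
  have hxi : (n : ℝ) ^ (-(1/3 : ℝ)) = x⁻¹ := by
    rw [hx, Real.rpow_neg hn0.le]
  have hxb : 6144 * R ^ 3 ≤ x := by
    rw [← hx3] at hnR
    exact le_of_pow_le_pow_left₀ (by norm_num) hx0.le hnR
  have hx1 : 1 ≤ x := by linarith
  have hxx : x ≤ x ^ 2 := by nlinarith
  have hnx : x ≤ n := by rw [← hx3]; nlinarith
  have hn8 : 8 ≤ n := by
    have : (8 : ℝ) ≤ n := by linarith
    exact_mod_cast this
  set m : ℝ := (n : ℝ) ^ (-(1/3 : ℝ)) * fAP n with hm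
  have hmx : x ^ 5 / 16 ≤ m := by
    rw [hm, hxi]
    have := ct_fAP n hn8
    rw [← hx3] at this
    calc x ^ 5 / 16 = x⁻¹ * ((x ^ 3) ^ 2 / 16) := by field_simp
      _ ≤ _ := by gcongr
  have hm0 : 0 < m := lt_of_lt_of_le (by positivity) hmx
  set N : ℝ := (Fintype.card (Fin (n+1) × Fin r) : ℝ) with hN
  have hNe : N = (n + 1) * R := by rw [hN]; simp [hR]
  have hN0 : 0 < N := by rw [hNe]; positivity
  have hN2 : N ≤ 2 * R * x ^ 3 := by
    rw [hNe, hx3]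
    nlinarith
  set τ : ℝ := x⁻¹ with hτ
  have hτ0 : 0 < τ := by positivity
  have hx4 : x ^ 3 * x ≤ x ^ 5 := by nlinarith [pow_pos hx0 4]
  have A1 : 16 * (3 * R) * τ ≤ 1 := by
    rw [hτ, ← div_eq_mul_inv, div_le_one hx0]; linarith
  have A2 : 16 * (3 * R) ^ 2 * N ≤ m := by
    refine le_trans ?_ hmx
    calc 16 * (3 * R) ^ 2 * N ≤ 16 * (3 * R) ^ 2 * (2 * R * x ^ 3) := by gcongr
      _ = x ^ 3 * (288 * R ^ 3) := by ring
      _ ≤ x ^ 3 * (x / 16) := by gcongr; linarith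
      _ ≤ _ := by linarith
  have A3 : 64 * (3 * R) * N ≤ τ * m := by
    calc 64 * (3 * R) * N ≤ 64 * (3 * R) * (2 * R * x ^ 3) := by gcongr
      _ = x ^ 3 * (384 * R ^ 2) := by ring
      _ ≤ x ^ 3 * (x / 16) := by gcongr; linarith
      _ = τ * (x ^ 5 / 16) := by rw [hτ]; field_simp
      _ ≤ _ := by gcongr
  set k1 : ℕ := ⌈(32 * R + 3072 * R ^ 3) * x ^ 2⌉₊ with hk1
  set k2 : ℕ := ⌈65536 * R ^ 2 * x ^ 2⌉₊ with hk2
  have A4 : 16 * τ * N + 16 * (3 * R) * N ^ 2 / m ≤ k1 := by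
    refine le_trans ?_ (Nat.le_ceil _)
    have a : 16 * τ * N ≤ 32 * R * x ^ 2 := by
      calc 16 * τ * N ≤ 16 * τ * (2 * R * x ^ 3) := by gcongr
        _ = _ := by rw [hτ]; field_simp; norm_num
    have b : 16 * (3 * R) * N ^ 2 / m ≤ 3072 * R ^ 3 * x := by
      calc 16 * (3 * R) * N ^ 2 / m ≤ 16 * (3 * R) * (2 * R * x ^ 3) ^ 2 / (x ^ 5 / 16) := by gcongr
        _ = _ := by field_simp; norm_num
    have : 3072 * R ^ 3 * x ≤ 3072 * R ^ 3 * x ^ 2 := by gcongr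
    linarith
  have A5 : 1024 * N ^ 2 / (τ * m) ≤ k2 := by
    refine le_trans ?_ (Nat.le_ceil _)
    calc 1024 * N ^ 2 / (τ * m) ≤ 1024 * (2 * R * x ^ 3) ^ 2 / (τ * (x ^ 5 / 16)) := by gcongr
      _ = _ := by rw [hτ]; field_simp; norm_num
  set t : ℕ := ⌈128 * Real.log n⌉₊ with ht
  obtain ⟨F, hF, hFI, hFt⟩ := ctIter (ctAP n r) (ctAP_symm1 n r) (ctAP_symm2 n r) (3 * R) τ m N
    (ctAP_codeg n r) hτ0 hN hN0 hm0 (by positivity) A1 A2 A3 k1 k2 A4 A5 t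
  refine ⟨F.image (ctQ n r), ?_, ?_, ?_⟩
  · intro P hP
    obtain ⟨C, hC, hI⟩ := hFI (fun p => 1 ≤ p.1.val ∧ p.2 ∈ P p.1.val) (ct_indep hP)
    refine ⟨ctQ n r C, Finset.mem_image_of_mem _ hC, fun y hy i hi => ?_⟩
    rw [Finset.mem_Icc] at hy
    have ov : (Fin.ofNat (n+1) y).val = y := Nat.mod_eq_of_lt (Nat.lt_succ_of_le hy.2)
    refine Finset.mem_filter.2 ⟨Finset.mem_univ _, hI _ ?_⟩
    simp only [ov]
    exact ⟨hy.1, hi⟩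
  · intro Q hQ
    obtain ⟨C, hC, rfl⟩ := Finset.mem_image.1 hQ
    refine (ct_Rtemp_le n r C).trans ((hFt C hC).trans (max_le le_rfl ?_))
    have g1 : (63 / 64 : ℝ) ^ t ≤ ((n : ℝ) ^ 2)⁻¹ := by
      have : (63 / 64 : ℝ) ≤ Real.exp (-(1/64)) := by
        have := Real.add_one_le_exp (-(1/64) : ℝ); linarith
      calc (63 / 64 : ℝ) ^ t ≤ Real.exp (-(1/64)) ^ t := by gcongr
        _ = Real.exp (t * (-(1/64))) := by rw [Real.exp_nat_mul]
        _ ≤ Real.exp (-(2 * Real.log n)) := by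
            apply Real.exp_le_exp.2
            have := Nat.le_ceil (128 * Real.log n)
            rw [← ht] at this
            linarith
        _ = _ := by
            rw [Real.exp_neg, two_mul, Real.exp_add, Real.exp_log hn0, sq]
    calc (63 / 64 : ℝ) ^ t * (3 * R * N ^ 2)
        ≤ ((n : ℝ) ^ 2)⁻¹ * (3 * R * (2 * R * x ^ 3) ^ 2) := by gcongr
      _ = 12 * R ^ 3 := by rw [hx3]; field_simp; norm_num
      _ ≤ x ^ 5 / 16 := by
          have : x ≤ x ^ 5 := le_self_pow₀ hx1 (by norm_num)
          linarith
      _ ≤ m := hmx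
  · set ℓ : ℝ := Real.logb 2 n with hℓ
    have hn2 : (2:ℝ) ≤ n := by linarith
    have hℓ1 : 1 ≤ ℓ := by
      rw [hℓ, Real.le_logb_iff_rpow_le (by norm_num) hn0]; simpa using hn2
    have hlog0 : 0 ≤ Real.log n := Real.log_nonneg (by linarith)
    have hlogℓ : Real.log n ≤ ℓ := by
      rw [hℓ, Real.logb, le_div_iff₀ (Real.log_pos (by norm_num))]
      have : Real.log 2 ≤ 1 := by linarith [Real.log_two_lt_d9]
      nlinarith
    have htb : (t : ℝ) ≤ 129 * ℓ := by
      have := (Nat.ceil_lt_add_one (a := 128 * Real.log n) (by positivity)).le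
      rw [← ht] at this
      linarith
    have hkb : ((k1 + k2 : ℕ) : ℝ) ≤ (c0 + 2) * x ^ 2 := by
      have a := (Nat.ceil_lt_add_one (a := (32 * R + 3072 * R ^ 3) * x ^ 2) (by positivity)).le
      have b := (Nat.ceil_lt_add_one (a := 65536 * R ^ 2 * x ^ 2) (by positivity)).le
      rw [← hk1] at a
      rw [← hk2] at b
      push_cast
      have h1x : 1 ≤ x ^ 2 := hx1.trans hxx
      have e : (c0 + 2) * x ^ 2 = (32 * R + 3072 * R ^ 3) * x ^ 2 + 65536 * R ^ 2 * x ^ 2 + 2 * x ^ 2 := by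
        rw [hc0]; ring
      linarith
    rcases Nat.eq_zero_or_pos (F.image (ctQ n r)).card with h0 | hpos
    · rw [h0]; simp; positivity
    have hcard : ((F.image (ctQ n r)).card : ℝ) ≤ (N + 1) ^ ((k1 + k2) * t) := by
      rw [hN]; exact_mod_cast Finset.card_image_le.trans hF
    have hNn : N + 1 ≤ (n : ℝ) ^ 2 := by
      rw [hNe]
      have b1 : 2 * R + 1 ≤ n := by linarith
      have b2 : (n : ℝ) * (2 * R + 1) ≤ n * n := mul_le_mul_of_nonneg_left b1 hn0.le
      have b3 : R ≤ n * R := le_mul_of_one_le_left hR0.le (by linarith)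
      linarith
    have hlN : Real.logb 2 (N + 1) ≤ 2 * ℓ := by
      calc Real.logb 2 (N + 1) ≤ Real.logb 2 ((n:ℝ) ^ 2) :=
            Real.logb_le_logb_of_le (by norm_num) (by positivity) hNn
        _ = _ := by rw [Real.logb_pow, hℓ]; norm_num
    have hlN0 : 0 ≤ Real.logb 2 (N + 1) := Real.logb_nonneg (by norm_num) (by linarith)
    rw [hx2]
    calc Real.logb 2 ((F.image (ctQ n r)).card : ℝ) ≤ Real.logb 2 ((N + 1) ^ ((k1 + k2) * t)) :=
          Real.logb_le_logb_of_le (by norm_num) (by exact_mod_cast hpos) hcard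
      _ = ((k1 + k2 : ℕ) : ℝ) * t * Real.logb 2 (N + 1) := by
          rw [Real.logb_pow]; push_cast; ring
      _ ≤ ((c0 + 2) * x ^ 2) * (129 * ℓ) * (2 * ℓ) := by gcongr
      _ = _ := by ring
end
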